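/- Let m ≥ 1, let λ = (λ₀,…,λ_{m−1}) be generic, and fix a dimension vector α ∈ ℕ^m. Then the group of transformations of representation data generated by all Ψ_{k,μ}, all Φ_{k,ν} (k ≥ 1, μ, ν ∈ ℂ) and all base changes acts transitively on the set of representation data of dimension α: for any two tuples (X_i, Y_i, v, w) and (X′_i, Y′_i, v′, w′) satisfying the relations (qv1)–(qv2), some finite composition of these transformations carries the first tuple to the second. -/

import Mathlib

open Matrix

namespace CM

noncomputable section

variable {α : ℕ → ℕ}

/-- Reindex a square complex matrix along an equality of sizes. -/
def recast {a b : ℕ} (h : a = b) (M : Matrix (Fin a) (Fin a) ℂ) :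
    Matrix (Fin b) (Fin b) ℂ :=
  M.submatrix (Fin.cast h.symm) (Fin.cast h.symm)

/-- `yprod Y k = Y (k-1) * ⋯ * Y 1 * Y 0`. -/
def yprod (Y : ∀ i : ℕ, Matrix (Fin (α (i + 1))) (Fin (α i)) ℂ) :
    (k : ℕ) → Matrix (Fin (α k)) (Fin (α 0)) ℂ
  | 0 => 1
  | k + 1 => Y k * yprod Y k

/-- `xprod X k = X 0 * X 1 * ⋯ * X (k-1)`. -/
def xprod (X : ∀ i : ℕ, Matrix (Fin (α i)) (Fin (α (i + 1))) ℂ) :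
    (k : ℕ) → Matrix (Fin (α 0)) (Fin (α k)) ℂ
  | 0 => 1
  | k + 1 => xprod X k * X k

/-- `ysegFrom Y i k = Y (i+k-1) * ⋯ * Y (i+1) * Y i`. -/
def ysegFrom (Y : ∀ i : ℕ, Matrix (Fin (α (i + 1))) (Fin (α i)) ℂ) (i : ℕ) :
    (k : ℕ) → Matrix (Fin (α (i + k))) (Fin (α i)) ℂ
  | 0 => (1 : Matrix (Fin (α i)) (Fin (α i)) ℂ)
  | k + 1 => Y (i + k) * ysegFrom Y i k

/-- `xsegFrom X i k = X i * X (i+1) * ⋯ * X (i+k-1)`. -/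
def xsegFrom (X : ∀ i : ℕ, Matrix (Fin (α i)) (Fin (α (i + 1))) ℂ) (i : ℕ) :
    (k : ℕ) → Matrix (Fin (α i)) (Fin (α (i + k))) ℂ
  | 0 => (1 : Matrix (Fin (α i)) (Fin (α i)) ℂ)
  | k + 1 => xsegFrom X i k * X (i + k)

/-- A tuple `(X_i, Y_i, v, w)` of representation data for the framed cyclic quiver with
`m = p + 1` vertices `0, 1, …, p` (only the components with index `≤ p` are meaningful;
the remaining ones are required to vanish where relevant). -/
structure Datum (α : ℕ → ℕ) where
  X : ∀ i : ℕ, Matrix (Fin (α i)) (Fin (α (i + 1))) ℂ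
  Y : ∀ i : ℕ, Matrix (Fin (α (i + 1))) (Fin (α i)) ℂ
  v : Fin (α 0) → ℂ
  w : Fin (α 0) → ℂ

/-- The relations (qv1)–(qv2) for the deformed preprojective algebra of the framed
cyclic quiver with `m = p + 1` vertices. -/
def IsRepDatum (p : ℕ) (lam : ℕ → ℂ) (h0 : α (p + 1) = α 0) (d : Datum α) : Prop :=
  d.X 0 * d.Y 0 - recast h0 (d.Y p * d.X p) + vecMulVec d.v d.w
      = lam 0 • (1 : Matrix (Fin (α 0)) (Fin (α 0)) ℂ) ∧
    ∀ j : ℕ, j < p → d.X (j + 1) * d.Y (j + 1) - d.Y j * d.X j = lam (j + 1) • 1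

/-- `A = Y_{m-1} ⋯ Y_1 Y_0`, as a square matrix at the vertex `0`. -/
def Amat (p : ℕ) (h0 : α (p + 1) = α 0)
    (Y : ∀ i : ℕ, Matrix (Fin (α (i + 1))) (Fin (α i)) ℂ) :
    Matrix (Fin (α 0)) (Fin (α 0)) ℂ :=
  (yprod Y (p + 1)).submatrix (Fin.cast h0.symm) id

/-- `B = X_0 X_1 ⋯ X_{m-1}`, as a square matrix at the vertex `0`. -/
def Bmat (p : ℕ) (h0 : α (p + 1) = α 0)
    (X : ∀ i : ℕ, Matrix (Fin (α i)) (Fin (α (i + 1))) ℂ) :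
    Matrix (Fin (α 0)) (Fin (α 0)) ℂ :=
  (xprod X (p + 1)).submatrix id (Fin.cast h0.symm)

/-- `C_k = Y_{m-1} ⋯ Y_{m-k} X_{m-k} ⋯ X_{m-1}` (for `k ≤ m`; junk value `1` otherwise),
as a square matrix at the vertex `0`; `C_0 = Id`. -/
def Cmat (p : ℕ) (h0 : α (p + 1) = α 0)
    (X : ∀ i : ℕ, Matrix (Fin (α i)) (Fin (α (i + 1))) ℂ)
    (Y : ∀ i : ℕ, Matrix (Fin (α (i + 1))) (Fin (α i)) ℂ) (k : ℕ) :
    Matrix (Fin (α 0)) (Fin (α 0)) ℂ :=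
  if h : k ≤ p + 1 then
    recast ((congrArg α (by omega : p + 1 - k + k = p + 1)).trans h0)
      (ysegFrom Y (p + 1 - k) k * xsegFrom X (p + 1 - k) k)
  else 1

/-- `Y_{m-1} ⋯ Y_{i+1}` viewed as a matrix from vertex `i+1` to vertex `0` (zero for `i > p`). -/
def ycap (p : ℕ) (h0 : α (p + 1) = α 0)
    (Y : ∀ i : ℕ, Matrix (Fin (α (i + 1))) (Fin (α i)) ℂ) (i : ℕ) :
    Matrix (Fin (α 0)) (Fin (α (i + 1))) ℂ :=
  if h : i ≤ p then
    (ysegFrom Y (i + 1) (p - i)).submatrix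
      (Fin.cast (h0.symm.trans (congrArg α (by omega : p + 1 = i + 1 + (p - i))))) id
  else 0

/-- `X_{i+1} ⋯ X_{m-1}` viewed as a matrix from vertex `0` to vertex `i+1` (zero for `i > p`). -/
def xcap (p : ℕ) (h0 : α (p + 1) = α 0)
    (X : ∀ i : ℕ, Matrix (Fin (α i)) (Fin (α (i + 1))) ℂ) (i : ℕ) :
    Matrix (Fin (α (i + 1))) (Fin (α 0)) ℂ :=
  if h : i ≤ p then
    (xsegFrom X (i + 1) (p - i)).submatrix id
      (Fin.cast (h0.symm.trans (congrArg α (by omega : p + 1 = i + 1 + (p - i)))))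
  else 0

/-- The transformation `Ψ_{k,μ}`:
`X_i ↦ X_i + μ • Y_{i-1} ⋯ Y_0 (Y_{m-1} ⋯ Y_0)^{k-1} Y_{m-1} ⋯ Y_{i+1}`. -/
def psiT (p : ℕ) (h0 : α (p + 1) = α 0) (k : ℕ) (μ : ℂ) (d : Datum α) : Datum α where
  X := fun i => d.X i + μ • (yprod d.Y i * Amat p h0 d.Y ^ (k - 1) * ycap p h0 d.Y i)
  Y := d.Y
  v := d.v
  w := d.w

/-- The transformation `Φ_{k,ν}`:
`Y_i ↦ Y_i + ν • X_{i+1} ⋯ X_{m-1} (X_0 ⋯ X_{m-1})^{k-1} X_0 ⋯ X_{i-1}`. -/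
def phiT (p : ℕ) (h0 : α (p + 1) = α 0) (k : ℕ) (ν : ℂ) (d : Datum α) : Datum α where
  X := d.X
  Y := fun i => d.Y i + ν • (xcap p h0 d.X i * Bmat p h0 d.X ^ (k - 1) * xprod d.X i)
  v := d.v
  w := d.w

/-- Base change by a family of (invertible) matrices `g_i`. -/
def bcT (p : ℕ) (g : ∀ i : ℕ, Matrix (Fin (α i)) (Fin (α i)) ℂ) (d : Datum α) : Datum α where
  X := fun i => if i ≤ p then g i * d.X i * (g (i + 1))⁻¹ else d.X i
  Y := fun i => if i ≤ p then g (i + 1) * d.Y i * (g i)⁻¹ else d.Y i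
  v := g 0 *ᵥ d.v
  w := vecMul d.w (g 0)⁻¹

/-- One elementary move: a `Ψ_{k,μ}`, a `Φ_{k,ν}`, or a base change. -/
def Step (p : ℕ) (h0 : α (p + 1) = α 0) (d d' : Datum α) : Prop :=
  (∃ k : ℕ, ∃ μ : ℂ, 1 ≤ k ∧ d' = psiT p h0 k μ d) ∨
  (∃ k : ℕ, ∃ ν : ℂ, 1 ≤ k ∧ d' = phiT p h0 k ν d) ∨
  (∃ g : ∀ i : ℕ, Matrix (Fin (α i)) (Fin (α i)) ℂ,
      (∀ i, IsUnit (g i)) ∧ g (p + 1) = recast h0.symm (g 0) ∧ d' = bcT p g d)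

/-- `λ` is generic: `λ·β ≠ 0` for every root `β` of the affine quiver of type `Ã_{m-1}`. -/
def Generic (p : ℕ) (lam : ℕ → ℂ) : Prop :=
  (∑ t ∈ Finset.range (p + 1), lam t) ≠ 0 ∧
    ∀ i j : ℕ, 1 ≤ i → i ≤ j → j ≤ p → ∀ k : ℤ,
      (∑ t ∈ Finset.Icc i j, lam t) + (k : ℂ) * ∑ t ∈ Finset.range (p + 1), lam t ≠ 0

set_option linter.all false
set_option linter.unusedSectionVars false
set_option linter.unusedSimpArgs false
set_option linter.unusedVariables false

namespace Tot

/-- A representation datum on the total graded space `ℂ^T`. -/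
structure RD (T : Type) where
  X : Matrix T T ℂ
  Y : Matrix T T ℂ
  v : T → ℂ
  w : T → ℂ

section basics
variable {m : ℕ} {T : Type} [Fintype T] [DecidableEq T]

/-- `M` shifts the degree by `c`. -/
def Hom (deg : T → ZMod m) (c : ZMod m) (M : Matrix T T ℂ) : Prop :=
  ∀ s t, M s t ≠ 0 → deg s = deg t + c

/-- `y` is homogeneous of degree `r`. -/
def HomV (deg : T → ZMod m) (r : ZMod m) (y : T → ℂ) : Prop :=
  ∀ s, y s ≠ 0 → deg s = r

/-- Diagonal matrix depending on the degree. -/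
def Dg (deg : T → ZMod m) (φ : ZMod m → ℂ) : Matrix T T ℂ := diagonal (fun s => φ (deg s))

structure IsR (deg : T → ZMod m) (lam : ZMod m → ℂ) (P : RD T) : Prop where
  hX : Hom deg (-1) P.X
  hY : Hom deg 1 P.Y
  hv : HomV deg 0 P.v
  hw : HomV deg 0 P.w
  rel : P.X * P.Y - P.Y * P.X + vecMulVec P.v P.w = Dg deg lam

def Gen (lam : ZMod m → ℂ) : Prop :=
  ∃ θ : ℤ → ℂ, Function.Injective θ ∧ ∀ j : ℤ, θ (j + 1) - θ j = lam (j : ZMod m)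

variable {deg : T → ZMod m}

lemma Hom.one : Hom deg 0 (1 : Matrix T T ℂ) := by
  intro s t h
  by_cases hst : s = t
  · simp [hst]
  · simp [Matrix.one_apply_ne hst] at h

lemma Hom.mul {c d : ZMod m} {M N : Matrix T T ℂ} (hM : Hom deg c M) (hN : Hom deg d N) :
    Hom deg (c + d) (M * N) := by
  intro s t h
  rw [Matrix.mul_apply] at h
  obtain ⟨r, _, hr⟩ := Finset.exists_ne_zero_of_sum_ne_zero h
  rw [hM s r (left_ne_zero_of_mul hr), hN r t (right_ne_zero_of_mul hr)]
  ring

lemma Hom.pow {c : ZMod m} {M : Matrix T T ℂ} (hM : Hom deg c M) (k : ℕ) :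
    Hom deg (k * c) (M ^ k) := by
  induction k with
  | zero => simpa using Hom.one
  | succ k ih =>
    rw [pow_succ]
    have := ih.mul hM
    convert this using 1
    push_cast; ring

lemma Hom.add {c : ZMod m} {M N : Matrix T T ℂ} (hM : Hom deg c M) (hN : Hom deg c N) :
    Hom deg c (M + N) := by
  intro s t h
  by_cases h1 : M s t = 0
  · apply hN; intro h2; apply h; simp [h1, h2]
  · exact hM s t h1

lemma Hom.smul {c : ZMod m} {M : Matrix T T ℂ} (hM : Hom deg c M) (a : ℂ) :
    Hom deg c (a • M) := by
  intro s t h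
  apply hM; intro h2; apply h; simp [h2]

lemma Hom.neg {c : ZMod m} {M : Matrix T T ℂ} (hM : Hom deg c M) :
    Hom deg c (-M) := by
  intro s t h
  apply hM; intro h2; apply h; simp [h2]

lemma Hom.transpose {c : ZMod m} {M : Matrix T T ℂ} (hM : Hom deg c M) :
    Hom (fun s => - deg s) c Mᵀ := by
  intro s t h
  have := hM t s h
  simp only [this]; ring

lemma Hom.flip {c : ZMod m} {M : Matrix T T ℂ} (hM : Hom deg c M) :
    Hom (fun s => - deg s) (-c) M := by
  intro s t h
  have := hM s t h
  simp only [this]; ring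

lemma HomV.flip {c : ZMod m} {y : T → ℂ} (hM : HomV deg c y) :
    HomV (fun s => - deg s) (-c) y := by
  intro s h
  simp only [hM s h]

lemma Hom.Dg_mul {c : ZMod m} {M : Matrix T T ℂ} (hM : Hom deg c M) (φ : ZMod m → ℂ) :
    Dg deg φ * M = M * Dg deg (fun i => φ (i + c)) := by
  ext s t
  simp only [Dg, Matrix.diagonal_mul, Matrix.mul_diagonal]
  by_cases h : M s t = 0
  · simp [h]
  · rw [hM s t h]; ring

lemma Dg_hom (φ : ZMod m → ℂ) : Hom deg 0 (Dg deg φ) := by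
  intro s t h
  by_cases hst : s = t
  · simp [hst]
  · simp [Dg, Matrix.diagonal_apply_ne _ hst] at h

lemma Dg_transpose (φ : ZMod m → ℂ) : (Dg deg φ)ᵀ = Dg deg φ := by
  simp [Dg]

lemma Dg_mulVec {r : ZMod m} {y : T → ℂ} (hy : HomV deg r y) (φ : ZMod m → ℂ) :
    Dg deg φ *ᵥ y = φ r • y := by
  ext s
  simp only [Dg, Matrix.mulVec_diagonal, Pi.smul_apply, smul_eq_mul]
  by_cases h : y s = 0
  · simp [h]
  · rw [hy s h]

lemma Hom.mulVec {c r : ZMod m} {M : Matrix T T ℂ} {y : T → ℂ} (hM : Hom deg c M)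
    (hy : HomV deg r y) : HomV deg (r + c) (M *ᵥ y) := by
  intro s h
  rw [Matrix.mulVec, dotProduct] at h
  obtain ⟨t, _, ht⟩ := Finset.exists_ne_zero_of_sum_ne_zero h
  rw [hM s t (left_ne_zero_of_mul ht), hy t (right_ne_zero_of_mul ht)]

lemma Hom.vecMul {c r : ZMod m} {M : Matrix T T ℂ} {y : T → ℂ} (hM : Hom deg c M)
    (hy : HomV deg r y) : HomV deg (r - c) (y ᵥ* M) := by
  intro t h
  rw [Matrix.vecMul, dotProduct] at h
  obtain ⟨s, _, ht⟩ := Finset.exists_ne_zero_of_sum_ne_zero h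
  have h1 := hM s t (right_ne_zero_of_mul ht)
  rw [hy s (left_ne_zero_of_mul ht)] at h1
  rw [h1]; ring

lemma HomV.eq_zero_of_ne {r r' : ZMod m} {y : T → ℂ} (hy : HomV deg r y) (hy' : HomV deg r' y)
    (h : r ≠ r') : y = 0 := by
  ext s
  by_contra hs
  exact h ((hy s hs).symm.trans (hy' s hs))

/-- the dual datum -/
def RD.dual (P : RD T) : RD T := ⟨P.Xᵀ, P.Yᵀ, P.w, -P.v⟩
/-- the swapped datum -/
def RD.swap (P : RD T) : RD T := ⟨P.Y, P.X, -P.v, P.w⟩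

lemma IsR.dual {lam : ZMod m → ℂ} {P : RD T} (h : IsR deg lam P) :
    IsR (fun s => - deg s) (fun i => - lam (-i)) P.dual where
  hX := h.hX.transpose
  hY := h.hY.transpose
  hv := by have := h.hw.flip; rw [neg_zero] at this; exact this
  hw := by
    intro s hs
    have := h.hv s (by simpa [RD.dual] using hs)
    simp [this]
  rel := by
    have h1 := congrArg (fun M => - Mᵀ) h.rel
    simp only [Matrix.transpose_add, Matrix.transpose_sub, Matrix.transpose_mul,
      Matrix.transpose_vecMulVec, Dg_transpose] at h1
    have h2 : Dg (fun s => - deg s) (fun i => - lam (-i)) = - Dg deg lam := by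
      simp [Dg, Matrix.diagonal_neg]
    rw [h2, ← h1]
    simp only [RD.dual, Matrix.vecMulVec_neg]
    abel

lemma IsR.swap {lam : ZMod m → ℂ} {P : RD T} (h : IsR deg lam P) :
    IsR (fun s => - deg s) (fun i => - lam (-i)) P.swap where
  hX := h.hY.flip
  hY := by have := h.hX.flip; rw [neg_neg] at this; exact this
  hv := by
    intro s hs
    have := h.hv s (by simpa [RD.swap] using hs)
    simp [this]
  hw := by have := h.hw.flip; rw [neg_zero] at this; exact this
  rel := by
    have h2 : Dg (fun s => - deg s) (fun i => - lam (-i)) = - Dg deg lam := by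
      simp [Dg, Matrix.diagonal_neg]
    rw [h2, ← h.rel]
    simp only [RD.swap, Matrix.neg_vecMulVec]
    abel

lemma Gen.dual {lam : ZMod m → ℂ} (h : Gen lam) : Gen (fun i => - lam (-i)) := by
  obtain ⟨θ, hi, hd⟩ := h
  refine ⟨fun j => θ (1 - j), fun a b hab => ?_, fun j => ?_⟩
  · have := hi hab; omega
  · have := hd (-j)
    push_cast at this
    simp only [← this]
    have e1 : 1 - (j + 1) = -j := by ring
    have e2 : (1 : ℤ) - j = -j + 1 := by ring
    simp only [e1, e2]; ring

/-- string sums are nonzero and injective -/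
lemma Gen.string {lam : ZMod m → ℂ} {θ : ℤ → ℂ}
    (hd : ∀ j : ℤ, θ (j + 1) - θ j = lam (j : ZMod m)) (r : ℤ) (k : ℕ) :
    ∑ j ∈ Finset.range k, lam ((r : ZMod m) + j) = θ (r + k) - θ r := by
  induction k with
  | zero => simp
  | succ k ih =>
    rw [Finset.sum_range_succ, ih]
    have := hd (r + k)
    push_cast at this ⊢
    rw [← this, add_assoc]; ring

lemma Gen.ne {lam : ZMod m → ℂ} (h : Gen lam) (r : ZMod m) {k : ℕ} (hk : 0 < k) :
    ∑ j ∈ Finset.range k, lam (r + j) ≠ 0 := by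
  obtain ⟨θ, hi, hd⟩ := h
  obtain ⟨r', rfl⟩ := ZMod.intCast_surjective r
  rw [Gen.string hd]
  intro h0
  have := hi (sub_eq_zero.mp h0)
  omega

lemma Gen.inj {lam : ZMod m → ℂ} (h : Gen lam) (r : ZMod m) :
    Function.Injective (fun k : ℕ => ∑ j ∈ Finset.range k, lam (r + j)) := by
  obtain ⟨θ, hi, hd⟩ := h
  obtain ⟨r', rfl⟩ := ZMod.intCast_surjective r
  intro a b hab
  simp only [Gen.string hd] at hab
  have := hi (sub_left_injective hab)
  omega

/-- the sum over a whole number of periods -/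
lemma sum_period [NeZero m] (lam : ZMod m → ℂ) (r : ZMod m) (q : ℕ) :
    ∑ j ∈ Finset.range (m * q), lam (r + j) = q * ∑ i, lam i := by
  have h1 : ∀ r : ZMod m, ∑ j ∈ Finset.range m, lam (r + j) = ∑ i, lam i := by
    intro r
    refine Finset.sum_bij' (fun j _ => r + (j : ZMod m)) (fun i _ => (i - r).val) ?_ ?_ ?_ ?_ ?_
    · simp
    · intro i _; simpa using ZMod.val_lt _
    · intro j hj
      simp only [add_sub_cancel_left]
      exact ZMod.val_cast_of_lt (by simpa using hj)
    · intro i _; simp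
    · simp
  induction q with
  | zero => simp
  | succ q ih =>
    rw [mul_add, mul_one, Finset.sum_range_add, ih]
    have := h1 r
    simp only [Nat.cast_add, Nat.cast_mul, CharP.cast_eq_zero, zero_mul, zero_add]
    rw [this]; push_cast; ring

/-- the elementary moves -/
def Mv (deg : T → ZMod m) (P Q : RD T) : Prop :=
  (∃ k : ℕ, ∃ μ : ℂ, 1 ≤ k ∧ Q = ⟨P.X + μ • P.Y ^ (m * k - 1), P.Y, P.v, P.w⟩) ∨
  (∃ k : ℕ, ∃ μ : ℂ, 1 ≤ k ∧ Q = ⟨P.X, P.Y + μ • P.X ^ (m * k - 1), P.v, P.w⟩) ∨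
  (∃ g h : Matrix T T ℂ, g * h = 1 ∧ Hom deg 0 g ∧ Hom deg 0 h ∧
    Q = ⟨g * P.X * h, g * P.Y * h, g *ᵥ P.v, P.w ᵥ* h⟩)

/-- reachability -/
def Orb (deg : T → ZMod m) : RD T → RD T → Prop := Relation.ReflTransGen (Mv deg)

lemma hom_pow_neg [NeZero m] {c : ZMod m} {M : Matrix T T ℂ} (hM : Hom deg c M) {k : ℕ}
    (hk : 1 ≤ k) : Hom deg (-c) (M ^ (m * k - 1)) := by
  have := hM.pow (m * k - 1)
  convert this using 1
  have h1 : 1 ≤ m * k := Nat.mul_pos (NeZero.pos m) hk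
  rw [Nat.cast_sub h1]; simp

lemma Mv.isR [NeZero m] {lam : ZMod m → ℂ} {P Q : RD T} (hP : IsR deg lam P) (h : Mv deg P Q) :
    IsR deg lam Q := by
  rcases h with ⟨k, μ, hk, rfl⟩ | ⟨k, μ, hk, rfl⟩ | ⟨g, h, hgh, hg, hh, rfl⟩
  · refine ⟨hP.hX.add ((hom_pow_neg hP.hY hk).smul μ), hP.hY, hP.hv, hP.hw, ?_⟩
    rw [← hP.rel]
    simp only [add_mul, mul_add, Matrix.smul_mul, Matrix.mul_smul, pow_mul_comm']
    abel
  · refine ⟨hP.hX, hP.hY.add (by simpa using (hom_pow_neg hP.hX hk).smul μ), hP.hv, hP.hw, ?_⟩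
    rw [← hP.rel]
    simp only [add_mul, mul_add, Matrix.smul_mul, Matrix.mul_smul, pow_mul_comm']
    abel
  · have hhg : h * g = 1 := mul_eq_one_comm.mp hgh
    refine ⟨by simpa using (hg.mul hP.hX).mul hh, by simpa using (hg.mul hP.hY).mul hh,
      by simpa using hg.mulVec hP.hv, by simpa using hh.vecMul hP.hw, ?_⟩
    have e1 : g * P.X * h * (g * P.Y * h) = g * (P.X * P.Y) * h := by
      calc _ = g * P.X * (h * g) * P.Y * h := by simp only [mul_assoc]
        _ = _ := by rw [hhg]; simp only [mul_assoc, one_mul, mul_one]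
    have e2 : g * P.Y * h * (g * P.X * h) = g * (P.Y * P.X) * h := by
      calc _ = g * P.Y * (h * g) * P.X * h := by simp only [mul_assoc]
        _ = _ := by rw [hhg]; simp only [mul_assoc, one_mul, mul_one]
    have e3 : vecMulVec (g *ᵥ P.v) (P.w ᵥ* h) = g * vecMulVec P.v P.w * h := by
      rw [Matrix.mul_vecMulVec, Matrix.vecMulVec_mul]
    simp only [e1, e2, e3]
    have e4 : g * (P.X * P.Y) * h - g * (P.Y * P.X) * h + g * vecMulVec P.v P.w * h
        = g * (P.X * P.Y - P.Y * P.X + vecMulVec P.v P.w) * h := by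
      simp only [Matrix.mul_sub, Matrix.mul_add, Matrix.sub_mul, Matrix.add_mul]
    rw [e4, hP.rel]
    have := hg.Dg_mul lam
    simp only [add_zero] at this
    rw [← this, mul_assoc, hgh, mul_one]

lemma Mv.symm {P Q : RD T} (h : Mv deg P Q) : Mv deg Q P := by
  rcases h with ⟨k, μ, hk, rfl⟩ | ⟨k, μ, hk, rfl⟩ | ⟨g, h, hgh, hg, hh, rfl⟩
  · exact Or.inl ⟨k, -μ, hk, by cases P; simp⟩
  · exact Or.inr (Or.inl ⟨k, -μ, hk, by cases P; simp⟩)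
  · have hhg : h * g = 1 := mul_eq_one_comm.mp hgh
    refine Or.inr (Or.inr ⟨h, g, hhg, hh, hg, ?_⟩)
    have e (M : Matrix T T ℂ) : h * (g * M * h) * g = M := by
      calc _ = (h * g) * M * (h * g) := by simp only [mul_assoc]
        _ = M := by rw [hhg]; simp
    cases P
    simp [e, Matrix.mulVec_mulVec, Matrix.vecMul_vecMul, hhg]

lemma Orb.symm {P Q : RD T} (h : Orb deg P Q) : Orb deg Q P := by
  induction h with
  | refl => exact .refl
  | tail _ h ih => exact .head h.symm ih

lemma Orb.trans {P Q R : RD T} (h : Orb deg P Q) (h' : Orb deg Q R) : Orb deg P R :=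
  Relation.ReflTransGen.trans h h'

lemma Orb.isR [NeZero m] {lam : ZMod m → ℂ} {P Q : RD T} (hP : IsR deg lam P)
    (h : Orb deg P Q) : IsR deg lam Q := by
  induction h with
  | refl => exact hP
  | tail _ h ih => exact h.isR ih

end basics
end Tot

namespace Tot
section irr
variable {m : ℕ} {T : Type} [Fintype T] [DecidableEq T] {deg : T → ZMod m}

lemma eig_inf {M : Matrix T T ℂ} {e : ℕ → ℂ} (he : Function.Injective e) (y : ℕ → T → ℂ)
    (hM : ∀ k, M *ᵥ y k = e k • y k) : ∃ k, y k = 0 := by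
  by_contra! hne
  have hfin := Module.End.finite_hasEigenvalue (Matrix.toLin' M)
  have hsub : Set.range e ⊆ Module.End.HasEigenvalue (Matrix.toLin' M) := by
    rintro _ ⟨k, rfl⟩
    exact Module.End.hasEigenvalue_of_hasEigenvector (x := y k)
      ⟨Module.End.mem_eigenspace_iff.mpr (by simpa using hM k), hne k⟩
  exact Set.infinite_range_of_injective he (hfin.subset hsub)

/-- an eigenvector in a nonzero invariant subspace -/
lemma exists_eig {M : Matrix T T ℂ} {Q : Submodule ℂ (T → ℂ)} (hQ : Q ≠ ⊥)
    (hM : ∀ y ∈ Q, M *ᵥ y ∈ Q) : ∃ h : ℂ, ∃ y ∈ Q, y ≠ 0 ∧ M *ᵥ y = h • y := by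
  have : Nontrivial Q := Submodule.nontrivial_iff_ne_bot.mpr hQ
  let f : Module.End ℂ Q := (Matrix.toLin' M).restrict (p := Q) (q := Q) (by simpa using hM)
  obtain ⟨c, hc⟩ := Module.End.exists_eigenvalue f
  obtain ⟨y, hy⟩ := hc.exists_hasEigenvector
  refine ⟨c, y, y.2, fun h => hy.2 (Subtype.ext h), ?_⟩
  have := congrArg Subtype.val hy.apply_eq_smul
  simpa [f] using this

/-- homogeneous components -/
lemma exists_comp {y : T → ℂ} (hy : y ≠ 0) :
    ∃ r : ZMod m, HomV deg r (Dg deg (fun i => if i = r then 1 else 0) *ᵥ y) ∧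
      Dg deg (fun i => if i = r then 1 else 0) *ᵥ y ≠ 0 := by
  obtain ⟨s, hs⟩ := Function.ne_iff.mp hy
  refine ⟨deg s, fun t ht => ?_, fun h => hs ?_⟩
  · by_contra h
    simp [Dg, Matrix.mulVec_diagonal, h] at ht
  · have := congrFun h s
    simpa [Dg, Matrix.mulVec_diagonal] using this

lemma Hom.comm_Dg {M : Matrix T T ℂ} (hM : Hom deg 0 M) (φ : ZMod m → ℂ) :
    Dg deg φ * M = M * Dg deg φ := by simpa using hM.Dg_mul φ

lemma exists_eig_hom {M : Matrix T T ℂ} {Q : Submodule ℂ (T → ℂ)} (hQ : Q ≠ ⊥)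
    (hM0 : Hom deg 0 M)
    (hM : ∀ y ∈ Q, M *ᵥ y ∈ Q) (hD : ∀ φ, ∀ y ∈ Q, Dg deg φ *ᵥ y ∈ Q) :
    ∃ h : ℂ, ∃ r : ZMod m, ∃ y ∈ Q, y ≠ 0 ∧ HomV deg r y ∧ M *ᵥ y = h • y := by
  obtain ⟨h, y, hy, hy0, he⟩ := exists_eig hQ hM
  obtain ⟨r, h1, h2⟩ := exists_comp (deg := deg) hy0
  refine ⟨h, r, _, hD _ y hy, h2, h1, ?_⟩
  rw [Matrix.mulVec_mulVec, ← hM0.comm_Dg, ← Matrix.mulVec_mulVec, he, Matrix.mulVec_smul]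

lemma pow_mem {M : Matrix T T ℂ} {Q : Submodule ℂ (T → ℂ)} (hM : ∀ y ∈ Q, M *ᵥ y ∈ Q)
    {y : T → ℂ} (hy : y ∈ Q) (k : ℕ) : M ^ k *ᵥ y ∈ Q := by
  induction k with
  | zero => simpa
  | succ k ih => rw [pow_succ', ← Matrix.mulVec_mulVec]; exact hM _ ih

/-- Lemma N -/
lemma lemN {lam : ZMod m → ℂ} (hg : Gen lam) {X Y : Matrix T T ℂ} (hX : Hom deg (-1) X)
    (hY : Hom deg 1 Y) {Q : Submodule ℂ (T → ℂ)} (hXQ : ∀ y ∈ Q, X *ᵥ y ∈ Q)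
    (hYQ : ∀ y ∈ Q, Y *ᵥ y ∈ Q) (hD : ∀ φ, ∀ y ∈ Q, Dg deg φ *ᵥ y ∈ Q)
    (hrel : ∀ y ∈ Q, (X * Y - Y * X) *ᵥ y = Dg deg lam *ᵥ y) : Q = ⊥ := by
  by_contra hQ
  have hrel' : ∀ y ∈ Q, ∀ r, HomV deg r y → X *ᵥ (Y *ᵥ y) = Y *ᵥ (X *ᵥ y) + lam r • y := by
    intro y hy r hr
    have := hrel y hy
    rw [Dg_mulVec hr, Matrix.sub_mulVec, ← Matrix.mulVec_mulVec, ← Matrix.mulVec_mulVec] at this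
    rw [← this]; abel
  obtain ⟨h, r, y, hy, hy0, hr, he⟩ := exists_eig_hom (M := Y * X) hQ
    (by simpa using hY.mul hX)
    (fun y hy => by rw [← Matrix.mulVec_mulVec]; exact hYQ _ (hXQ _ hy)) hD
  have hXd : ∀ k : ℕ, HomV deg (r - k) (X ^ k *ᵥ y) := fun k => by
    have := (hX.pow k).mulVec hr
    convert this using 1; ring
  have h1 : ∀ k : ℕ, (Y * X) *ᵥ (X ^ k *ᵥ y)
      = (h + ∑ j ∈ Finset.range k, (fun i => - lam (-i)) ((1 - r) + (j : ZMod m))) •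
        (X ^ k *ᵥ y) := by
    intro k
    induction k with
    | zero => simpa using he
    | succ k ih =>
      have e1 : X ^ (k + 1) *ᵥ y = X *ᵥ (X ^ k *ᵥ y) := by rw [pow_succ', Matrix.mulVec_mulVec]
      have hm := pow_mem hXQ hy (k + 1)
      have h3 := hrel' _ hm _ (hXd (k + 1))
      rw [← Matrix.mulVec_mulVec] at ih ⊢
      have h4 : Y *ᵥ (X *ᵥ (X ^ (k + 1) *ᵥ y)) =
        X *ᵥ (Y *ᵥ (X ^ (k + 1) *ᵥ y)) - lam (r - ((k + 1 : ℕ) : ZMod m)) • (X ^ (k + 1) *ᵥ y) := by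
        rw [h3]; abel
      rw [h4]
      nth_rewrite 1 [e1]
      rw [ih, Matrix.mulVec_smul, ← e1, ← sub_smul, Finset.sum_range_succ]
      congr 1
      have e2 : r - ((k + 1 : ℕ) : ZMod m) = -(1 - r + (k : ZMod m)) := by push_cast; ring
      rw [e2]; ring
  have hex := eig_inf (M := Y * X) (fun a b hab => hg.dual.inj (1 - r) (add_left_cancel hab))
    (fun k => X ^ k *ᵥ y) h1
  classical
  obtain ⟨k0, hk0⟩ : ∃ k, X ^ k *ᵥ y ≠ 0 ∧ X ^ (k + 1) *ᵥ y = 0 := by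
    have hs := Nat.find_spec hex
    have hm := fun k => Nat.find_min (H := hex) (m := k)
    have hpos : Nat.find hex ≠ 0 := by
      intro h0; rw [h0] at hs; exact hy0 (by simpa using hs)
    refine ⟨Nat.find hex - 1, hm _ (by omega), ?_⟩
    have : Nat.find hex - 1 + 1 = Nat.find hex := by omega
    rw [this]; exact hs
  obtain ⟨y', hy'⟩ : ∃ y', y' = X ^ k0 *ᵥ y := ⟨_, rfl⟩
  have hXy' : X *ᵥ y' = 0 := by rw [hy', Matrix.mulVec_mulVec, ← pow_succ']; exact hk0.2
  rw [← hy'] at hk0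
  set r' := r - (k0 : ZMod m)
  have hr' : HomV deg r' y' := hy' ▸ hXd k0
  have hy'Q : y' ∈ Q := hy' ▸ pow_mem hXQ hy k0
  have hYd : ∀ k : ℕ, HomV deg (r' + k) (Y ^ k *ᵥ y') := fun k => by
    have := (hY.pow k).mulVec hr'
    convert this using 1; ring
  have h2 : ∀ k : ℕ, X *ᵥ (Y ^ (k + 1) *ᵥ y') =
      (∑ j ∈ Finset.range (k + 1), lam (r' + (j : ZMod m))) • (Y ^ k *ᵥ y') := by
    intro k
    have e1 : ∀ k, Y ^ (k + 1) *ᵥ y' = Y *ᵥ (Y ^ k *ᵥ y') := fun k => by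
      rw [pow_succ', Matrix.mulVec_mulVec]
    induction k with
    | zero =>
      have := hrel' _ hy'Q _ hr'
      simp [hXy'] at this
      simpa using this
    | succ k ih =>
      rw [e1 (k + 1), hrel' _ (pow_mem hYQ hy'Q _) _ (hYd (k + 1)), ih, Matrix.mulVec_smul, ← e1,
        ← add_smul, Finset.sum_range_succ _ (k + 1)]
  have hne : ∀ k, Y ^ k *ᵥ y' ≠ 0 := by
    intro k
    induction k with
    | zero => simpa using hk0.1
    | succ k ih =>
      intro h0
      have := h2 k
      rw [h0, Matrix.mulVec_zero] at this
      exact (smul_ne_zero (hg.ne r' (Nat.succ_pos k)) ih) this.symm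
  obtain ⟨k, hk⟩ := eig_inf (M := X * Y) (e := fun k => ∑ j ∈ Finset.range (k + 1), lam (r' + (j : ZMod m)))
    (fun a b hab => by have := hg.inj r' hab; omega) (fun k => Y ^ k *ᵥ y') (fun k => by
      rw [← Matrix.mulVec_mulVec, Matrix.mulVec_mulVec (Y ^ k *ᵥ y') , ← Matrix.mulVec_mulVec,
        Matrix.mulVec_mulVec _ Y, ← pow_succ']
      exact h2 k)
  exact hne k hk

/-- the filtration -/
def Fl (P : RD T) (l : ℕ) : Submodule ℂ (T → ℂ) :=
  Submodule.span ℂ {y | ∃ i < l, ∃ j, y = P.X ^ j *ᵥ (P.Y ^ i *ᵥ P.v)}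

lemma Fl_zero (P : RD T) : Fl P 0 = ⊥ := by simp [Fl]

lemma Fl_mono (P : RD T) {a b : ℕ} (h : a ≤ b) : Fl P a ≤ Fl P b := by
  apply Submodule.span_mono
  rintro y ⟨i, hi, j, rfl⟩
  exact ⟨i, by omega, j, rfl⟩

lemma Fl_mem (P : RD T) {i l : ℕ} (h : i < l) (j : ℕ) : P.X ^ j *ᵥ (P.Y ^ i *ᵥ P.v) ∈ Fl P l :=
  Submodule.subset_span ⟨i, h, j, rfl⟩

/-- to check a matrix maps `Fl` somewhere -/
lemma Fl_map {P : RD T} {l : ℕ} {M : Matrix T T ℂ} {Q : Submodule ℂ (T → ℂ)}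
    (h : ∀ i < l, ∀ j, M *ᵥ (P.X ^ j *ᵥ (P.Y ^ i *ᵥ P.v)) ∈ Q) : ∀ y ∈ Fl P l, M *ᵥ y ∈ Q := by
  intro y hy
  have : Fl P l ≤ Q.comap (Matrix.toLin' M) := by
    apply Submodule.span_le.mpr
    rintro y ⟨i, hi, j, rfl⟩
    simpa using h i hi j
  simpa using this hy

lemma Fl_X (P : RD T) (l : ℕ) : ∀ y ∈ Fl P l, P.X *ᵥ y ∈ Fl P l :=
  Fl_map fun i hi j => by
    rw [Matrix.mulVec_mulVec, ← pow_succ']; exact Fl_mem P hi _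

lemma Fl_D {lam : ZMod m → ℂ} {P : RD T} (hP : IsR deg lam P) (l : ℕ) (φ : ZMod m → ℂ) :
    ∀ y ∈ Fl P l, Dg deg φ *ᵥ y ∈ Fl P l :=
  Fl_map fun i hi j => by
    rw [Dg_mulVec ((hP.hX.pow j).mulVec ((hP.hY.pow i).mulVec hP.hv))]
    exact Submodule.smul_mem _ _ (Fl_mem P hi _)

lemma comm_mulVec {lam : ZMod m → ℂ} {P : RD T} (hP : IsR deg lam P) (y : T → ℂ) :
    P.X *ᵥ (P.Y *ᵥ y) = P.Y *ᵥ (P.X *ᵥ y) + (Dg deg lam *ᵥ y - (P.w ⬝ᵥ y) • P.v) := by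
  rw [← hP.rel, Matrix.add_mulVec, Matrix.sub_mulVec, Matrix.vecMulVec_mulVec]
  simp only [Matrix.mulVec_mulVec]
  ext s; simp

lemma Fl_comm {lam : ZMod m → ℂ} {P : RD T} (hP : IsR deg lam P) {l : ℕ} :
    ∀ y ∈ Fl P l, P.X *ᵥ (P.Y *ᵥ y) - P.Y *ᵥ (P.X *ᵥ y) ∈ Fl P l := by
  intro y hy
  rw [comm_mulVec hP, add_sub_cancel_left]
  rcases Nat.eq_zero_or_pos l with rfl | hl
  · rw [Fl_zero] at *
    rw [Submodule.mem_bot] at *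
    simp [hy]
  · exact Submodule.sub_mem _ (Fl_D hP _ _ _ hy)
      (Submodule.smul_mem _ _ (by simpa using Fl_mem P hl 0))

lemma Fl_comm_pow {lam : ZMod m → ℂ} {P : RD T} (hP : IsR deg lam P) {l : ℕ} (c : ℕ) :
    ∀ y ∈ Fl P l, P.X ^ c *ᵥ (P.Y *ᵥ y) - P.Y *ᵥ (P.X ^ c *ᵥ y) ∈ Fl P l := by
  induction c with
  | zero => intro y hy; simp
  | succ c ih =>
    intro y hy
    have h1 := Fl_X P l _ (ih y hy)
    have h2 := Fl_comm hP (P.X ^ c *ᵥ y) (pow_mem (Fl_X P l) hy c)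
    have := Submodule.add_mem _ h1 h2
    rw [Matrix.mulVec_sub] at this
    simp only [pow_succ', ← Matrix.mulVec_mulVec]
    convert this using 1; abel

lemma Fl_Y {lam : ZMod m → ℂ} {P : RD T} (hP : IsR deg lam P) (l : ℕ) :
    ∀ y ∈ Fl P l, P.Y *ᵥ y ∈ Fl P (l + 1) :=
  Fl_map fun i hi j => by
    have h1 := Fl_comm_pow hP (l := i + 1) j (P.Y ^ i *ᵥ P.v) (by
      simpa using Fl_mem P (Nat.lt_succ_self i) 0)
    have h2 : P.X ^ j *ᵥ (P.Y *ᵥ (P.Y ^ i *ᵥ P.v)) ∈ Fl P (l + 1) := by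
      rw [Matrix.mulVec_mulVec _ P.Y, ← pow_succ']
      exact Fl_mem P (by omega) j
    have := Submodule.sub_mem _ h2 (Fl_mono P (by omega) h1)
    convert this using 1; abel

/-- Lemma A -/
lemma lemA {lam : ZMod m → ℂ} (hg : Gen lam) {P : RD T} (hP : IsR deg lam P) {u : T → ℂ}
    (hu : ∀ l, ∀ y ∈ Fl P l, u ⬝ᵥ y = 0) : u = 0 := by
  let Q : Submodule ℂ (T → ℂ) :=
    { carrier := {u | ∀ l, ∀ y ∈ Fl P l, u ⬝ᵥ y = 0}
      add_mem' := fun {a b} ha hb l y hy => by rw [add_dotProduct, ha l y hy, hb l y hy, add_zero]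
      zero_mem' := fun l y hy => by simp
      smul_mem' := fun c a ha l y hy => by rw [smul_dotProduct, ha l y hy, smul_zero] }
  have key : Q = ⊥ := by
    have hd := hP.dual
    apply lemN hg.dual hd.hX hd.hY
    · intro a ha l y hy
      simp only [RD.dual]
      rw [Matrix.mulVec_transpose, ← Matrix.dotProduct_mulVec]
      exact ha l _ (Fl_X P l y hy)
    · intro a ha l y hy
      simp only [RD.dual]
      rw [Matrix.mulVec_transpose, ← Matrix.dotProduct_mulVec]
      exact ha _ _ (Fl_Y hP l y hy)
    · intro φ a ha l y hy
      have e : Dg (fun s => - deg s) φ = (Dg deg (fun i => φ (-i)))ᵀ := by simp [Dg]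
      rw [e, Matrix.mulVec_transpose, ← Matrix.dotProduct_mulVec]
      exact ha l _ (Fl_D hP l _ y hy)
    · intro a ha
      rw [← hd.rel, Matrix.add_mulVec, Matrix.vecMulVec_mulVec]
      have : a ⬝ᵥ P.v = 0 := ha 1 _ (by simpa using Fl_mem P Nat.one_pos 0)
      have h2 : P.dual.w ⬝ᵥ a = 0 := by
        simp only [RD.dual, neg_dotProduct]
        rw [dotProduct_comm, this, neg_zero]
      rw [h2]; simp
  have : u ∈ Q := hu
  rw [key] at this
  simpa using this

end irr
end Tot

namespace Tot
section lemC
variable {m : ℕ} {T : Type} [Fintype T] [DecidableEq T] {deg : T → ZMod m}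

lemma Gen.c_ne [NeZero m] {lam : ZMod m → ℂ} (h : Gen lam) : ∑ i, lam i ≠ 0 := by
  have h1 := sum_period lam 0 1
  have h2 := h.ne 0 (k := m * 1) (by simpa using NeZero.pos m)
  rw [h1] at h2; simpa using h2

lemma comm_pow (X Y : Matrix T T ℂ) (n : ℕ) :
    X * Y ^ n = Y ^ n * X + ∑ i ∈ Finset.range n, Y ^ i * (X * Y - Y * X) * Y ^ (n - 1 - i) := by
  induction n with
  | zero => simp
  | succ n ih =>
    rw [Finset.sum_range_succ]
    have h1 : ∑ i ∈ Finset.range n, Y ^ i * (X * Y - Y * X) * Y ^ (n + 1 - 1 - i)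
        = (∑ i ∈ Finset.range n, Y ^ i * (X * Y - Y * X) * Y ^ (n - 1 - i)) * Y := by
      rw [Finset.sum_mul]
      refine Finset.sum_congr rfl fun i hi => ?_
      have hi := Finset.mem_range.mp hi
      have : n + 1 - 1 - i = (n - 1 - i) + 1 := by omega
      rw [this, pow_succ]; simp only [mul_assoc]
    have h2 : n + 1 - 1 - n = 0 := by omega
    rw [h1, h2, pow_zero, mul_one]
    calc X * Y ^ (n + 1) = (X * Y ^ n) * Y := by rw [pow_succ, mul_assoc]
      _ = _ := by
        rw [ih, add_mul, mul_sub, pow_succ]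
        simp only [mul_assoc]
        abel

lemma sum_Dg [NeZero m] {lam : ZMod m → ℂ} {Y : Matrix T T ℂ} (hY : Hom deg 1 Y) {N q : ℕ}
    (hN : N + 1 = m * q) :
    ∑ i ∈ Finset.range (N + 1), Y ^ i * Dg deg lam * Y ^ (N - i)
      = ((q : ℂ) * ∑ i, lam i) • Y ^ N := by
  have h1 : ∀ i ∈ Finset.range (N + 1), Y ^ i * Dg deg lam * Y ^ (N - i)
      = Y ^ N * Dg deg (fun d => lam (d + ((N - i : ℕ) : ZMod m))) := by
    intro i hi
    have hi := Finset.mem_range.mp hi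
    rw [mul_assoc, (hY.pow (N - i)).Dg_mul, ← mul_assoc, ← pow_add]
    congr 2
    · omega
    · ext d; simp
  rw [Finset.sum_congr rfl h1, ← Finset.mul_sum]
  have h2 : ∑ i ∈ Finset.range (N + 1), Dg deg (fun d => lam (d + ((N - i : ℕ) : ZMod m)))
      = ((q : ℂ) * ∑ i, lam i) • (1 : Matrix T T ℂ) := by
    ext s t
    rw [Matrix.sum_apply]
    by_cases hst : s = t
    · subst hst
      simp only [Dg, Matrix.diagonal_apply_eq, Matrix.smul_apply, Matrix.one_apply_eq, smul_eq_mul,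
        mul_one]
      rw [← sum_period lam (deg s) q, ← hN]
      exact Finset.sum_range_reflect (fun j => lam (deg s + (j : ZMod m))) (N + 1)
    · simp [Dg, Matrix.diagonal_apply_ne _ hst, Matrix.one_apply_ne hst]
  rw [h2]; simp

lemma lemC0 [NeZero m] {lam : ZMod m → ℂ} {P : RD T} (hP : IsR deg lam P) {u z : T → ℂ} {x : ℂ}
    (hu : u ᵥ* P.X = x • u) (hz : P.X *ᵥ z = x • z) {N q : ℕ} (hN : N + 1 = m * q) :
    ∑ i ∈ Finset.range (N + 1), (u ⬝ᵥ (P.Y ^ i *ᵥ P.v)) * (P.w ⬝ᵥ (P.Y ^ (N - i) *ᵥ z))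
      = ((q : ℂ) * ∑ i, lam i) * (u ⬝ᵥ (P.Y ^ N *ᵥ z)) := by
  have h1 := congrArg (fun M => u ⬝ᵥ (M *ᵥ z)) (comm_pow P.X P.Y (N + 1))
  have e1 : u ⬝ᵥ ((P.X * P.Y ^ (N + 1)) *ᵥ z) = x * (u ⬝ᵥ (P.Y ^ (N + 1) *ᵥ z)) := by
    rw [← Matrix.mulVec_mulVec, Matrix.dotProduct_mulVec, hu, smul_dotProduct, smul_eq_mul]
  have e2 : u ⬝ᵥ ((P.Y ^ (N + 1) * P.X) *ᵥ z) = x * (u ⬝ᵥ (P.Y ^ (N + 1) *ᵥ z)) := by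
    rw [← Matrix.mulVec_mulVec, hz, Matrix.mulVec_smul, dotProduct_smul, smul_eq_mul]
  simp only [Matrix.add_mulVec, dotProduct_add, e1, e2] at h1
  have h2 := left_eq_add.mp h1
  have h3 : P.X * P.Y - P.Y * P.X = Dg deg lam - vecMulVec P.v P.w := by
    rw [← hP.rel]; abel
  rw [h3] at h2
  have h4 : ∑ i ∈ Finset.range (N + 1), P.Y ^ i * (Dg deg lam - vecMulVec P.v P.w) *
      P.Y ^ (N + 1 - 1 - i) = ((q : ℂ) * ∑ i, lam i) • P.Y ^ N -
      ∑ i ∈ Finset.range (N + 1), vecMulVec (P.Y ^ i *ᵥ P.v) (P.w ᵥ* P.Y ^ (N - i)) := by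
    rw [← sum_Dg hP.hY hN, ← Finset.sum_sub_distrib]
    refine Finset.sum_congr rfl fun i _ => ?_
    rw [mul_sub, sub_mul, Matrix.mul_vecMulVec, Matrix.vecMulVec_mul]
    simp
  rw [h4, Matrix.sub_mulVec, dotProduct_sub, sub_eq_zero, Matrix.smul_mulVec,
    dotProduct_smul, smul_eq_mul] at h2
  rw [h2, Matrix.sum_mulVec, dotProduct_sum]
  refine Finset.sum_congr rfl fun i _ => ?_
  rw [Matrix.vecMulVec_mulVec, ← Matrix.dotProduct_mulVec]
  simp [mul_comm]

/-- coefficients of `(G + ε Y)^i v` -/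
def Sq (G Y : Matrix T T ℂ) (v : T → ℂ) : ℕ → ℕ → (T → ℂ)
  | 0, 0 => v
  | 0, _ + 1 => 0
  | i + 1, 0 => G *ᵥ Sq G Y v i 0
  | i + 1, l + 1 => G *ᵥ Sq G Y v i (l + 1) + Y *ᵥ Sq G Y v i l

lemma Sq_gt (G Y : Matrix T T ℂ) (v : T → ℂ) {i l : ℕ} (h : i < l) : Sq G Y v i l = 0 := by
  induction i generalizing l with
  | zero => cases l with
    | zero => omega
    | succ l => rfl
  | succ i ih => cases l with
    | zero => omega
    | succ l => rw [Sq, ih (by omega), ih (by omega)]; simp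

lemma Sq_sum (G Y : Matrix T T ℂ) (v : T → ℂ) (ε : ℂ) (i : ℕ) :
    (G + ε • Y) ^ i *ᵥ v = ∑ l ∈ Finset.range (i + 1), ε ^ l • Sq G Y v i l := by
  induction i with
  | zero => simp [Sq]
  | succ i ih =>
    rw [pow_succ', ← Matrix.mulVec_mulVec, ih, Matrix.add_mulVec, Finset.sum_range_succ' _ (i + 1)]
    simp only [Sq, smul_add, Finset.sum_add_distrib]
    have h1 : G *ᵥ ∑ l ∈ Finset.range (i + 1), ε ^ l • Sq G Y v i l
        = ∑ l ∈ Finset.range (i + 1), ε ^ (l + 1) • G *ᵥ Sq G Y v i (l + 1)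
          + ε ^ 0 • G *ᵥ Sq G Y v i 0 := by
      rw [← Finset.sum_range_succ' (fun l => ε ^ l • G *ᵥ Sq G Y v i l) (i + 1),
        Finset.sum_range_succ _ (i + 1), Sq_gt G Y v (Nat.lt_succ_self i), Matrix.mulVec_sum]
      simp [Matrix.mulVec_smul]
    have h2 : (ε • Y) *ᵥ ∑ l ∈ Finset.range (i + 1), ε ^ l • Sq G Y v i l
        = ∑ l ∈ Finset.range (i + 1), ε ^ (l + 1) • Y *ᵥ Sq G Y v i l := by
      rw [Matrix.mulVec_sum]
      refine Finset.sum_congr rfl fun l _ => ?_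
      rw [Matrix.mulVec_smul, Matrix.smul_mulVec, smul_smul, pow_succ]
    rw [h1, h2]; abel

lemma Sq_Fl {lam : ZMod m → ℂ} {P : RD T} (hP : IsR deg lam P) (e : ℕ) (i l : ℕ) :
    Sq (P.X ^ e) P.Y P.v i l - (i.choose l : ℂ) • (P.X ^ (e * (i - l)) *ᵥ (P.Y ^ l *ᵥ P.v))
      ∈ Fl P l := by
  induction i generalizing l with
  | zero => cases l with
    | zero => simp [Sq]
    | succ l => simp [Sq]
  | succ i ih => cases l with
    | zero =>
      have := pow_mem (Fl_X P 0) (ih 0) e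
      rw [Matrix.mulVec_sub] at this
      simp only [Nat.choose_zero_right, Nat.cast_one, one_smul, Nat.sub_zero] at this ⊢
      rw [Matrix.mulVec_mulVec _ (P.X ^ e), ← pow_add] at this
      rw [Sq, mul_add, mul_one, add_comm (e * i)]
      exact this
    | succ l =>
      have h1 := pow_mem (Fl_X P _) (ih (l + 1)) e
      have h2 := Fl_Y hP _ _ (ih l)
      have h3 := Fl_comm_pow hP (l := l + 1) (e * (i - l)) (P.Y ^ l *ᵥ P.v)
        (by simpa using Fl_mem P (Nat.lt_succ_self l) 0)
      have h4 := Submodule.sub_mem _ (Submodule.add_mem _ h1 h2)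
        (Submodule.smul_mem _ (i.choose l : ℂ) h3)
      have e1 : (i.choose (l + 1) : ℂ) • (P.X ^ e *ᵥ (P.X ^ (e * (i - (l + 1))) *ᵥ
          (P.Y ^ (l + 1) *ᵥ P.v))) =
          (i.choose (l + 1) : ℂ) • (P.X ^ (e * (i - l)) *ᵥ (P.Y ^ (l + 1) *ᵥ P.v)) := by
        by_cases hl : l + 1 ≤ i
        · rw [Matrix.mulVec_mulVec _ (P.X ^ e), ← pow_add]
          have : e + e * (i - (l + 1)) = e * (i - l) := by
            have : i - l = (i - (l + 1)) + 1 := by omega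
            rw [this]; ring
          rw [this]
        · rw [Nat.choose_eq_zero_of_lt (by omega)]; simp
      convert h4 using 1
      have e2 : P.Y *ᵥ (P.Y ^ l *ᵥ P.v) = P.Y ^ (l + 1) *ᵥ P.v := by
        rw [Matrix.mulVec_mulVec, ← pow_succ']
      rw [Matrix.mulVec_sub, Matrix.mulVec_sub, Matrix.mulVec_smul, Matrix.mulVec_smul, e1, e2, Sq,
        Nat.add_sub_add_right, Nat.choose_succ_succ]
      push_cast
      rw [add_smul, smul_sub]
      abel

lemma exists_p {lam : ZMod m → ℂ} (hg : Gen lam) {P : RD T} (hP : IsR deg lam P) {u : T → ℂ}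
    {x : ℂ} (hu0 : u ≠ 0) (hu : u ᵥ* P.X = x • u) :
    ∃ p, (∀ y ∈ Fl P p, u ⬝ᵥ y = 0) ∧ u ⬝ᵥ (P.Y ^ p *ᵥ P.v) ≠ 0 := by
  classical
  have hex : ∃ l, ∃ y ∈ Fl P l, u ⬝ᵥ y ≠ 0 := by
    by_contra! h
    exact hu0 (lemA hg hP h)
  have hs := Nat.find_spec hex
  have hm := fun k => Nat.find_min (H := hex) (m := k)
  set l := Nat.find hex
  have hl : l ≠ 0 := by
    intro h0
    obtain ⟨y, hy, hy'⟩ := hs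
    rw [h0, Fl_zero, Submodule.mem_bot] at hy
    simp [hy] at hy'
  obtain ⟨p, hp⟩ := Nat.exists_eq_succ_of_ne_zero hl
  have hk : ∀ y ∈ Fl P p, u ⬝ᵥ y = 0 := by
    have := hm p (by omega)
    push Not at this
    exact this
  refine ⟨p, hk, fun h0 => ?_⟩
  obtain ⟨y, hy, hy'⟩ := hs
  have huX : ∀ j, u ᵥ* P.X ^ j = x ^ j • u := by
    intro j
    induction j with
    | zero => simp
    | succ j ih => rw [pow_succ, ← Matrix.vecMul_vecMul, ih, Matrix.smul_vecMul, hu, smul_smul, pow_succ]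
  apply hy'
  let Q : Submodule ℂ (T → ℂ) :=
    { carrier := {y | u ⬝ᵥ y = 0}
      add_mem' := fun {a b} ha hb => by
        simp only [Set.mem_setOf_eq] at *
        rw [dotProduct_add, ha, hb, add_zero]
      zero_mem' := by simp
      smul_mem' := fun c a ha => by
        simp only [Set.mem_setOf_eq] at *
        rw [dotProduct_smul, ha, smul_zero] }
  have : Fl P l ≤ Q := by
    apply Submodule.span_le.mpr
    rintro y ⟨i, hi, j, rfl⟩
    show u ⬝ᵥ _ = 0
    rcases Nat.lt_or_ge i p with h | h
    · exact hk _ (Fl_mem P h j)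
    · have : i = p := by omega
      rw [this, Matrix.dotProduct_mulVec, huX, smul_dotProduct, h0, smul_zero]
  exact this hy

open Polynomial in
lemma polyA {lam : ZMod m → ℂ} (hg : Gen lam) {P : RD T} (hP : IsR deg lam P) {u : T → ℂ}
    {x : ℂ} (hu0 : u ≠ 0) (hu : u ᵥ* P.X = x • u) (e : ℕ) :
    ∃ p : ℕ, ∃ a : ℂ, a ≠ 0 ∧ (∀ r, HomV deg r u → r = (p : ZMod m)) ∧
      ∃ A' : ℕ → ℂ[X], (∀ i ε, u ⬝ᵥ ((P.X ^ e + ε • P.Y) ^ i *ᵥ P.v) = ε ^ p * (A' i).eval ε) ∧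
        ∀ i, (A' i).eval 0 = (i.choose p : ℂ) * (x ^ e) ^ (i - p) * a := by
  obtain ⟨p, hk, ha⟩ := exists_p hg hP hu0 hu
  have huX : ∀ j, u ᵥ* P.X ^ j = x ^ j • u := by
    intro j
    induction j with
    | zero => simp
    | succ j ih => rw [pow_succ, ← Matrix.vecMul_vecMul, ih, Matrix.smul_vecMul, hu, smul_smul, pow_succ]
  refine ⟨p, u ⬝ᵥ (P.Y ^ p *ᵥ P.v), ha, ?_, ?_⟩
  · intro r hr
    rw [dotProduct] at ha
    obtain ⟨s, _, hs⟩ := Finset.exists_ne_zero_of_sum_ne_zero ha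
    have h1 := hr s (left_ne_zero_of_mul hs)
    have h2 := (hP.hY.pow p).mulVec hP.hv s (right_ne_zero_of_mul hs)
    rw [← h1, h2]; ring
  have hlt : ∀ i l, l < p → u ⬝ᵥ Sq (P.X ^ e) P.Y P.v i l = 0 := by
    intro i l hl
    apply hk
    have h1 := Fl_mono P hl.le (Sq_Fl hP e i l)
    have h2 := Submodule.smul_mem _ (i.choose l : ℂ) (Fl_mem P hl (e * (i - l)))
    have := Submodule.add_mem _ h1 h2
    simpa using this
  have heq : ∀ i, u ⬝ᵥ Sq (P.X ^ e) P.Y P.v i p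
      = (i.choose p : ℂ) * (x ^ e) ^ (i - p) * (u ⬝ᵥ (P.Y ^ p *ᵥ P.v)) := by
    intro i
    have h1 := hk _ (Sq_Fl hP e i p)
    rw [dotProduct_sub, sub_eq_zero] at h1
    rw [h1, dotProduct_smul, Matrix.dotProduct_mulVec, huX, smul_dotProduct, pow_mul, smul_eq_mul,
      smul_eq_mul, mul_assoc]
  refine ⟨fun i => ∑ l ∈ Finset.range (i + 1), C (u ⬝ᵥ Sq (P.X ^ e) P.Y P.v i (l + p)) * X ^ l,
    fun i ε => ?_, fun i => ?_⟩
  · rw [Sq_sum, dotProduct_sum, eval_finset_sum, Finset.mul_sum]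
    simp only [dotProduct_smul, smul_eq_mul, eval_mul, eval_C, eval_pow, eval_X]
    have h1 : ∑ l ∈ Finset.range (i + 1), ε ^ l * u ⬝ᵥ Sq (P.X ^ e) P.Y P.v i l =
        ∑ l ∈ Finset.range (p + (i + 1)), ε ^ l * u ⬝ᵥ Sq (P.X ^ e) P.Y P.v i l := by
      apply Finset.sum_subset
      · intro a; simp only [Finset.mem_range]; omega
      · intro l _ hl
        rw [Sq_gt _ _ _ (by simpa using hl)]; simp
    rw [h1, Finset.sum_range_add, Finset.sum_eq_zero, zero_add]
    · refine Finset.sum_congr rfl fun l _ => ?_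
      rw [pow_add, add_comm l p]; ring
    · intro l hl
      rw [hlt i l (by simpa using hl), mul_zero]
  · rw [eval_finset_sum, Finset.sum_range_succ', Finset.sum_eq_zero]
    · simp [heq]
    · intro l _; simp

open Polynomial in
/-- Lemma C -/
lemma lemC [NeZero m] {lam : ZMod m → ℂ} (hg : Gen lam) {P : RD T} (hP : IsR deg lam P)
    {u z : T → ℂ} {x : ℂ} (hu0 : u ≠ 0) (hz0 : z ≠ 0)
    (hu : u ᵥ* P.X = x • u) (hz : P.X *ᵥ z = x • z)
    (hx : x ≠ 0 ∨ ∃ r, HomV deg (r - 1) u ∧ HomV deg r z) :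
    ∃ t : ℂ, ∃ q : ℕ, 1 ≤ q ∧
      u ⬝ᵥ ((P.Y + t • P.X ^ (m * 1 - 1)) ^ (m * q - 1) *ᵥ z) ≠ 0 := by
  by_contra! hcon
  obtain ⟨p, a, ha, hpr, A, hA, hA0⟩ := polyA hg hP hu0 hu (m * 1 - 1)
  obtain ⟨p', b, hb, hpr', B, hB, hB0⟩ := polyA hg.dual hP.dual (x := x) hz0
    (by simp only [RD.dual]; rw [Matrix.vecMul_transpose, hz]) (m * 1 - 1)
  have hB' : ∀ i ε, P.w ⬝ᵥ ((P.X ^ (m * 1 - 1) + ε • P.Y) ^ i *ᵥ z) = ε ^ p' * (B i).eval ε := by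
    intro i ε
    rw [← hB]
    simp only [RD.dual]
    have : (P.Xᵀ ^ (m * 1 - 1) + ε • P.Yᵀ) ^ i = ((P.X ^ (m * 1 - 1) + ε • P.Y) ^ i)ᵀ := by
      rw [Matrix.transpose_pow, Matrix.transpose_add, Matrix.transpose_pow, Matrix.transpose_smul]
    rw [this, Matrix.mulVec_transpose, Matrix.dotProduct_mulVec, dotProduct_comm]
  obtain ⟨N, q, hq, hN, hNp, hNx⟩ : ∃ N q : ℕ, 1 ≤ q ∧ N + 1 = m * q ∧ p + p' ≤ N ∧
      (x ≠ 0 ∨ N = p + p') := by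
    have hm := NeZero.pos m
    rcases hx with hx | ⟨r, h1, h2⟩
    · refine ⟨m * (p + p' + 1) - 1, p + p' + 1, by omega, ?_, ?_, Or.inl hx⟩
      · have : 1 ≤ m * (p + p' + 1) := Nat.mul_pos hm (by omega)
        omega
      · have : 1 * (p + p' + 1) ≤ m * (p + p' + 1) := Nat.mul_le_mul_right _ hm
        omega
    · have e1 := hpr _ h1
      have e2 := hpr' _ h2.flip
      have : ((p + p' + 1 : ℕ) : ZMod m) = 0 := by
        push_cast; rw [← e1, ← e2]; ring
      obtain ⟨q, hq⟩ := (ZMod.natCast_eq_zero_iff _ _).mp this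
      refine ⟨p + p', q, ?_, hq, le_rfl, Or.inr rfl⟩
      rcases Nat.eq_zero_or_pos q with h | h
      · subst h; omega
      · exact h
  have hmq : m * q - 1 = N := by omega
  have key : ∀ ε : ℂ, ε ≠ 0 → ∑ i ∈ Finset.range (N + 1), (A i).eval ε * (B (N - i)).eval ε = 0 := by
    intro ε hε
    have hP2 : IsR deg lam ⟨P.X, P.Y + ε⁻¹ • P.X ^ (m * 1 - 1), P.v, P.w⟩ :=
      Mv.isR hP (Or.inr (Or.inl ⟨1, ε⁻¹, le_rfl, rfl⟩))
    have h1 := lemC0 hP2 hu hz hN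
    have h2 := hcon ε⁻¹ q hq
    rw [hmq] at h2
    simp only [h2, mul_zero] at h1
    have e1 : P.Y + ε⁻¹ • P.X ^ (m * 1 - 1) = ε⁻¹ • (P.X ^ (m * 1 - 1) + ε • P.Y) := by
      rw [smul_add, smul_smul, inv_mul_cancel₀ hε, one_smul, add_comm]
    have e2 : ∀ i ∈ Finset.range (N + 1),
        (u ⬝ᵥ ((P.Y + ε⁻¹ • P.X ^ (m * 1 - 1)) ^ i *ᵥ P.v)) *
        (P.w ⬝ᵥ ((P.Y + ε⁻¹ • P.X ^ (m * 1 - 1)) ^ (N - i) *ᵥ z)) =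
        (ε⁻¹ ^ N * ε ^ p * ε ^ p') * ((A i).eval ε * (B (N - i)).eval ε) := by
      intro i hi
      have hi := Finset.mem_range.mp hi
      have e3 : ε⁻¹ ^ N = ε⁻¹ ^ i * ε⁻¹ ^ (N - i) := by rw [← pow_add]; congr 1; omega
      rw [e1, _root_.smul_pow, _root_.smul_pow, Matrix.smul_mulVec, Matrix.smul_mulVec,
        dotProduct_smul, dotProduct_smul, hA, hB', e3]
      simp only [smul_eq_mul]; ring
    rw [Finset.sum_congr rfl e2, ← Finset.mul_sum] at h1
    rcases mul_eq_zero.mp h1 with h | h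
    · exfalso; revert h; simp [hε]
    · exact h
  have hpoly : ∑ i ∈ Finset.range (N + 1), A i * B (N - i) = 0 := by
    apply Polynomial.eq_zero_of_infinite_isRoot
    refine Set.Infinite.mono (s := {ε : ℂ | ε ≠ 0}) ?_ ?_
    · intro ε hε
      simp only [Set.mem_setOf_eq, IsRoot, eval_finset_sum, eval_mul]
      exact key ε hε
    · exact (Set.finite_singleton (0 : ℂ)).infinite_compl
  have h0 := congrArg (eval 0) hpoly
  rw [eval_finset_sum] at h0
  simp only [eval_mul, hA0, hB0, eval_zero] at h0
  have e4 : ∀ i ∈ Finset.range (N + 1), ((i.choose p : ℂ) * (x ^ (m * 1 - 1)) ^ (i - p) * a) *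
      (((N - i).choose p' : ℂ) * (x ^ (m * 1 - 1)) ^ (N - i - p') * b) =
      ((x ^ (m * 1 - 1)) ^ (N - (p + p')) * a * b) * ((i.choose p * (N - i).choose p' : ℕ) : ℂ) := by
    intro i hi
    have hi := Finset.mem_range.mp hi
    by_cases h1 : i < p
    · rw [Nat.choose_eq_zero_of_lt h1]; simp
    by_cases h2 : N - i < p'
    · rw [Nat.choose_eq_zero_of_lt h2]; simp
    have : N - (p + p') = (i - p) + (N - i - p') := by omega
    rw [this, pow_add]; push_cast; ring
  rw [Finset.sum_congr rfl e4, ← Finset.mul_sum, ← Nat.cast_sum] at h0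
  rcases mul_eq_zero.mp h0 with h | h
  · rcases mul_eq_zero.mp h with h | h
    · rcases mul_eq_zero.mp h with h | h
      · rcases hNx with hx | hx
        · exact pow_ne_zero _ (pow_ne_zero _ hx) h
        · rw [hx] at h; simp at h
      · exact ha h
    · exact hb h
  · rw [Nat.cast_eq_zero, Finset.sum_eq_zero_iff] at h
    have := h p (by simp; omega)
    rcases Nat.mul_eq_zero.mp this with h | h
    · rw [Nat.choose_self] at h; omega
    · have := Nat.choose_pos (n := N - p) (k := p') (by omega)
      omega

end lemC
end Tot

namespace Tot
section cyc
variable {m : ℕ} {T : Type} [Fintype T] [DecidableEq T] {deg : T → ZMod m}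

lemma exists_maxi {α : Type*} (S : α → Prop) (f : α → ℕ) (N : ℕ) (hb : ∀ a, S a → f a ≤ N)
    (a0 : α) (h0 : S a0) : ∃ a, S a ∧ ∀ b, S b → f b ≤ f a := by
  obtain ⟨a, ha, hm⟩ := WellFounded.has_min (measure (fun a => N - f a)).wf {a | S a} ⟨a0, h0⟩
  refine ⟨a, ha, fun b hbS => ?_⟩
  have := hm b hbS
  simp only [measure, invImage, InvImage, WellFoundedRelation.rel] at this
  have h1 := hb b hbS
  have h2 := hb a ha
  change ¬ (N - f b < N - f a) at this
  omega

open Filter Topology in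
lemma pert {ι : Type} [Fintype ι] (f : ℂ → ι → T → ℂ) (hc : ∀ i, Continuous (fun s => f s i))
    (h0 : LinearIndependent ℂ (f 0)) (W : ℂ → Submodule ℂ (T → ℂ))
    (hW : ∀ s, s ≠ 0 → ∀ i, f s i ∈ W s) (p : ℂ → Prop) (hp : ∀ᶠ s in 𝓝 (0 : ℂ), p s) :
    ∃ s, s ≠ 0 ∧ p s ∧ Fintype.card ι ≤ Module.finrank ℂ (W s) := by
  have hcont : Continuous f := continuous_pi hc
  have hev : ∀ᶠ s in 𝓝 (0 : ℂ), LinearIndependent ℂ (f s) :=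
    hcont.continuousAt.eventually_mem ((isOpen_setOf_linearIndependent (𝕜 := ℂ)).mem_nhds h0)
  have h1 := (hev.and hp).filter_mono (nhdsWithin_le_nhds (s := {0}ᶜ))
  obtain ⟨s, hs, hs0⟩ := (h1.and self_mem_nhdsWithin).exists
  refine ⟨s, hs0, hs.2, ?_⟩
  rw [← finrank_span_eq_card hs.1]
  apply Submodule.finrank_mono
  apply Submodule.span_le.mpr
  rintro _ ⟨i, rfl⟩
  exact hW s hs0 i

lemma rank_incr {X D : Matrix T T ℂ} {u z : T → ℂ} (hu : u ᵥ* X = 0) (hz : X *ᵥ z = 0)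
    (hD : u ⬝ᵥ (D *ᵥ z) ≠ 0) : ∃ s : ℂ, s ≠ 0 ∧ X.rank < (X + s • D).rank := by
  let R := LinearMap.range X.mulVecLin
  let b := Module.finBasis ℂ R
  have hc : ∀ i, ∃ c, X *ᵥ c = (b i : T → ℂ) := fun i => by
    obtain ⟨c, hc⟩ := (b i).2
    exact ⟨c, by simpa using hc⟩
  choose c hc using hc
  have key := pert (T := T) (ι := Option (Fin (Module.finrank ℂ R)))
    (fun s o => o.elim (D *ᵥ z) (fun i => (X + s • D) *ᵥ c i))
    (by
      rintro (_ | i)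
      · exact continuous_const
      · simp only [Option.elim_some, Matrix.add_mulVec, Matrix.smul_mulVec]
        fun_prop)
    (by
      rw [linearIndependent_option]
      have e : ((fun o : Option (Fin (Module.finrank ℂ R)) => o.elim (D *ᵥ z)
          (fun i => (X + (0 : ℂ) • D) *ᵥ c i)) ∘ some) = fun i => (b i : T → ℂ) := by
        ext i; simp [hc]
      rw [e]
      refine ⟨b.linearIndependent.map' R.subtype (Submodule.ker_subtype R), fun hmem => hD ?_⟩
      have hle : Submodule.span ℂ (Set.range fun i => (b i : T → ℂ)) ≤ R := by
        apply Submodule.span_le.mpr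
        rintro _ ⟨i, rfl⟩
        exact (b i).2
      obtain ⟨y, hy⟩ := hle hmem
      simp only [Option.elim_none] at hy
      rw [← hy, Matrix.mulVecLin_apply, Matrix.dotProduct_mulVec, hu, zero_dotProduct])
    (fun s => LinearMap.range (X + s • D).mulVecLin)
    (by
      rintro s hs (_ | i)
      · refine ⟨s⁻¹ • z, ?_⟩
        simp [Matrix.add_mulVec, Matrix.mulVec_smul, hz, Matrix.smul_mulVec, smul_smul, hs]
      · exact ⟨c i, rfl⟩)
    (fun _ => True) (by simp)
  obtain ⟨s, hs, -, h⟩ := key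
  refine ⟨s, hs, ?_⟩
  rw [Fintype.card_option, Fintype.card_fin] at h
  exact h

lemma sum_sub {T : Type} [Fintype T] {p : T → Prop} [DecidablePred p] (f : T → ℂ)
    (h : ∀ t, f t ≠ 0 → p t) : ∑ x : {t // p t}, f x = ∑ t, f t := by
  rw [← Finset.sum_subtype (Finset.univ.filter p) (by simp) f, Finset.sum_filter_of_ne]
  intro t _ ht; exact h t ht

/-- left kernel vector from equal fibre sizes -/
lemma left_ker {n : ℕ} (hn : ∀ r, Fintype.card {t // deg t = r} = n) {X : Matrix T T ℂ}
    (hX : Hom deg (-1) X) {z : T → ℂ} {r : ZMod m} (hz0 : z ≠ 0) (hz : HomV deg r z)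
    (hXz : X *ᵥ z = 0) : ∃ u, u ≠ 0 ∧ HomV deg (r - 1) u ∧ u ᵥ* X = 0 := by
  classical
  let e : {t // deg t = r - 1} ≃ {t // deg t = r} := Fintype.equivOfCardEq (by rw [hn, hn])
  let N : Matrix {t // deg t = r} {t // deg t = r} ℂ := fun i j => X (e.symm i) j
  have h1 : ∃ y, y ≠ 0 ∧ N *ᵥ y = 0 := by
    refine ⟨fun j => z j, ?_, ?_⟩
    · intro h
      apply hz0
      ext t
      by_contra ht
      exact ht (congrFun h ⟨t, hz t ht⟩)
    · ext i
      have := congrFun hXz (e.symm i)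
      simp only [Matrix.mulVec, dotProduct, Pi.zero_apply] at this ⊢
      refine (sum_sub (fun t => X (e.symm i) t * z t) ?_).trans this
      intro t ht; exact hz t (right_ne_zero_of_mul ht)
  rw [Matrix.exists_mulVec_eq_zero_iff, ← Matrix.exists_vecMul_eq_zero_iff] at h1
  obtain ⟨u', hu0, hu⟩ := h1
  refine ⟨fun s => if h : deg s = r - 1 then u' (e ⟨s, h⟩) else 0, ?_, ?_, ?_⟩
  · intro h
    apply hu0
    ext i
    have := congrFun h (e.symm i)
    simpa [(e.symm i).2] using this
  · intro s hs
    by_contra h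
    simp [h] at hs
  · ext t
    by_cases ht : deg t = r
    · have := congrFun hu ⟨t, ht⟩
      simp only [Matrix.vecMul, dotProduct, Pi.zero_apply] at this ⊢
      rw [← Equiv.sum_comp e] at this
      have e1 : ∀ i : {t // deg t = r - 1}, u' (e i) * N (e i) ⟨t, ht⟩ =
          (fun s => (if h : deg s = r - 1 then u' (e ⟨s, h⟩) else 0) * X s t) (i : T) := by
        rintro ⟨i, hi⟩
        simp [N, hi]
      simp only [e1] at this
      refine (sum_sub (fun s => (if h : deg s = r - 1 then u' (e ⟨s, h⟩) else 0) * X s t)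
        ?_).symm.trans this
      intro t ht
      by_contra h
      simp [h] at ht
    · simp only [Matrix.vecMul, dotProduct, Pi.zero_apply]
      apply Finset.sum_eq_zero
      intro s _
      by_cases h : deg s = r - 1
      · have : X s t = 0 := by
          by_contra h0
          apply ht
          have := hX s t h0
          rw [h] at this
          have h2 := congrArg (· + 1) this
          simpa using h2.symm
        rw [this, mul_zero]
      · simp [h]

lemma two_moves {P : RD T} (t s : ℂ) {q : ℕ} (hq : 1 ≤ q) :
    Orb deg P ⟨P.X + s • (P.Y + t • P.X ^ (m * 1 - 1)) ^ (m * q - 1), P.Y + t • P.X ^ (m * 1 - 1),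
      P.v, P.w⟩ := by
  have h1 : Mv deg P ⟨P.X, P.Y + t • P.X ^ (m * 1 - 1), P.v, P.w⟩ :=
    Or.inr (Or.inl ⟨1, t, le_rfl, rfl⟩)
  exact (Relation.ReflTransGen.single h1).tail (Or.inl ⟨q, s, hq, rfl⟩)

/-- Step A -/
lemma stepA [NeZero m] {lam : ZMod m → ℂ} (hg : Gen lam) {n : ℕ}
    (hn : ∀ r, Fintype.card {t // deg t = r} = n) {P : RD T} (hP : IsR deg lam P) :
    ∃ Q, Orb deg P Q ∧ Q.X.det ≠ 0 := by
  obtain ⟨Q, hPQ, hmax⟩ := exists_maxi (fun Q => Orb deg P Q) (fun Q => Q.X.rank) (Fintype.card T)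
    (fun Q _ => Matrix.rank_le_card_height _) P .refl
  have hQ := hPQ.isR hP
  refine ⟨Q, hPQ, fun hdet => ?_⟩
  obtain ⟨z', hz0', hz'⟩ := Matrix.exists_mulVec_eq_zero_iff.mpr hdet
  obtain ⟨r, hzr, hz0⟩ := exists_comp (deg := deg) hz0'
  set z := Dg deg (fun i => if i = r then 1 else 0) *ᵥ z' with hz
  have hXz : Q.X *ᵥ z = 0 := by
    have := hQ.hX.Dg_mul (fun i => if i + 1 = r then (1 : ℂ) else 0)
    simp only [neg_add_cancel_right] at this
    rw [hz, Matrix.mulVec_mulVec, ← this, ← Matrix.mulVec_mulVec, hz', Matrix.mulVec_zero]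
  obtain ⟨u, hu0, hur, huX⟩ := left_ker hn hQ.hX hz0 hzr hXz
  obtain ⟨t, q, hq, hne⟩ := lemC hg hQ (x := 0) hu0 hz0 (by simpa using huX) (by simpa using hXz)
    (Or.inr ⟨r, hur, hzr⟩)
  obtain ⟨s, -, hs⟩ := rank_incr huX hXz hne
  have := hmax _ (hPQ.trans (two_moves t s hq))
  simp only at this
  omega

open Polynomial

/-- evaluation at a vector -/
def evp (X : Matrix T T ℂ) (v : T → ℂ) : ℂ[X] →ₗ[ℂ] (T → ℂ) where
  toFun p := aeval X p *ᵥ v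
  map_add' p q := by rw [map_add, Matrix.add_mulVec]
  map_smul' c p := by rw [map_smul, Matrix.smul_mulVec]; rfl

lemma evp_apply (X : Matrix T T ℂ) (v : T → ℂ) (p : ℂ[X]) : evp X v p = aeval X p *ᵥ v := rfl

lemma aeval_mem {M : Matrix T T ℂ} {Q : Submodule ℂ (T → ℂ)} (hM : ∀ y ∈ Q, M *ᵥ y ∈ Q)
    {y : T → ℂ} (hy : y ∈ Q) (p : ℂ[X]) : aeval M p *ᵥ y ∈ Q := by
  induction p using Polynomial.induction_on' with
  | add p q hp hq => rw [map_add, Matrix.add_mulVec]; exact Q.add_mem hp hq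
  | monomial n a =>
    rw [aeval_monomial, ← Matrix.mulVec_mulVec, Algebra.algebraMap_eq_smul_one, Matrix.smul_mulVec,
      Matrix.one_mulVec]
    exact Q.smul_mem _ (pow_mem hM hy n)

lemma aeval_pert (X D : Matrix T T ℂ) (f : ℂ[X]) :
    ∃ Z : ℂ → Matrix T T ℂ, Continuous Z ∧ ∀ s, aeval (X + s • D) f = aeval X f + s • Z s := by
  induction f using Polynomial.induction_on with
  | C a => exact ⟨fun _ => 0, continuous_const, fun s => by simp⟩
  | add p q hp hq =>
    obtain ⟨Z1, h1, h1'⟩ := hp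
    obtain ⟨Z2, h2, h2'⟩ := hq
    exact ⟨fun s => Z1 s + Z2 s, by fun_prop, fun s => by
      rw [map_add, map_add, h1', h2', smul_add]; abel⟩
  | monomial n a ih =>
    obtain ⟨Z, h1, h2⟩ := ih
    refine ⟨fun s => aeval X (C a * Polynomial.X ^ n) * D + Z s * X + s • (Z s * D), ?_, fun s => ?_⟩
    · have : Continuous fun s => Z s * X := h1.matrix_mul continuous_const
      have : Continuous fun s => Z s * D := h1.matrix_mul continuous_const
      fun_prop
    · rw [pow_succ, ← mul_assoc, map_mul, map_mul (aeval X), aeval_X, aeval_X, h2]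
      simp only [add_mul, mul_add, Matrix.mul_smul, Matrix.smul_mul, smul_add]
      abel

lemma comm_Fl1 {lam : ZMod m → ℂ} {P : RD T} (hP : IsR deg lam P) {y : T → ℂ} (hy : y ∈ Fl P 1)
    (l : ℕ) : P.Y ^ l *ᵥ y ∈ Fl P (l + 1) ∧
      P.X *ᵥ (P.Y ^ l *ᵥ y) - P.Y ^ l *ᵥ (P.X *ᵥ y) ∈ Fl P l := by
  induction l with
  | zero => simpa using hy
  | succ l ih =>
    have e : ∀ y, P.Y ^ (l + 1) *ᵥ y = P.Y *ᵥ (P.Y ^ l *ᵥ y) := fun y => by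
      rw [pow_succ', Matrix.mulVec_mulVec]
    refine ⟨by rw [e]; exact Fl_Y hP _ _ ih.1, ?_⟩
    have h1 := Fl_comm hP _ ih.1
    have h2 := Fl_Y hP _ _ ih.2
    have := Submodule.add_mem _ h1 h2
    rw [e, e]
    rw [Matrix.mulVec_sub] at this
    convert this using 1; abel

set_option maxHeartbeats 400000 in
/-- Step B -/
lemma stepB [NeZero m] {lam : ZMod m → ℂ} (hg : Gen lam) {P : RD T} (hP : IsR deg lam P)
    (hdet : P.X.det ≠ 0) : ∃ Q, Orb deg P Q ∧ LinearMap.range (evp Q.X Q.v) = ⊤ := by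
  obtain ⟨Q, ⟨hPQ, hQd⟩, hmax⟩ := exists_maxi (fun Q => Orb deg P Q ∧ Q.X.det ≠ 0)
    (fun Q => Module.finrank ℂ (LinearMap.range (evp Q.X Q.v))) (Module.finrank ℂ (T → ℂ))
    (fun Q _ => Submodule.finrank_le _) P ⟨.refl, hdet⟩
  have hQ := hPQ.isR hP
  refine ⟨Q, hPQ, ?_⟩
  by_contra htop
  set W := LinearMap.range (evp Q.X Q.v) with hW
  have hWX : ∀ y ∈ W, Q.X *ᵥ y ∈ W := by
    rintro _ ⟨p, rfl⟩
    exact ⟨Polynomial.X * p, by simp [evp_apply, ← Matrix.mulVec_mulVec]⟩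
  have hvW : Q.v ∈ W := ⟨1, by simp [evp_apply]⟩
  let An : Submodule ℂ (T → ℂ) :=
    { carrier := {u | ∀ y ∈ W, u ⬝ᵥ y = 0}
      add_mem' := fun {a b} ha hb y hy => by rw [add_dotProduct, ha y hy, hb y hy, add_zero]
      zero_mem' := fun y hy => by simp
      smul_mem' := fun c a ha y hy => by rw [smul_dotProduct, ha y hy, smul_zero] }
  have hAn : An ≠ ⊥ := by
    obtain ⟨f, hf0, hf⟩ := Submodule.exists_le_ker_of_lt_top W (lt_top_iff_ne_top.mpr htop)
    intro h
    have hfa : ∀ y, f y = (fun i => f (Pi.single i 1)) ⬝ᵥ y := by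
      intro y
      rw [LinearMap.pi_apply_eq_sum_univ f y]
      simp only [dotProduct, smul_eq_mul]
      refine Finset.sum_congr rfl fun i _ => ?_
      rw [mul_comm]; congr 2
      ext j; simp [Pi.single_apply, eq_comm]
    have hmem : (fun i => f (Pi.single i 1)) ∈ An := by
      intro y hy
      rw [← hfa]; exact hf hy
    rw [h, Submodule.mem_bot] at hmem
    apply hf0
    ext i
    simpa using congrFun hmem i
  obtain ⟨x, u, huAn, hu0, hux⟩ := exists_eig (M := Q.Xᵀ) hAn (by
    intro u hu y hy
    rw [Matrix.mulVec_transpose, ← Matrix.dotProduct_mulVec]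
    exact hu _ (hWX y hy))
  rw [Matrix.mulVec_transpose] at hux
  have hx0 : x ≠ 0 := by
    rintro rfl
    rw [zero_smul] at hux
    exact hQd (Matrix.exists_vecMul_eq_zero_iff.mp ⟨u, hu0, hux⟩)
  -- the eigenvalue occurs on W
  obtain ⟨z, hzW, hz0, hXz⟩ : ∃ z ∈ W, z ≠ 0 ∧ Q.X *ᵥ z = x • z := by
    by_contra! hno
    let f : W →ₗ[ℂ] W := (Matrix.toLin' (Q.X - x • 1)).restrict (p := W) (q := W) (by
      intro y hy
      simp only [Matrix.toLin'_apply, Matrix.sub_mulVec, Matrix.smul_mulVec, Matrix.one_mulVec]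
      exact W.sub_mem (hWX y hy) (W.smul_mem _ hy))
    have hf : ∀ y, (f y : T → ℂ) = Q.X *ᵥ y - x • (y : T → ℂ) := by
      intro y
      simp [f, Matrix.sub_mulVec, Matrix.smul_mulVec]
    have hinj : Function.Injective f := by
      rw [← LinearMap.ker_eq_bot, LinearMap.ker_eq_bot']
      intro y hy
      by_contra h0
      have := congrArg Subtype.val hy
      rw [hf] at this
      exact hno y y.2 (fun h => h0 (Subtype.ext h)) (sub_eq_zero.mp this)
    obtain ⟨⟨v', hv'⟩, hv⟩ := (LinearMap.injective_iff_surjective.mp hinj) ⟨Q.v, hvW⟩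
    have hv := congrArg Subtype.val hv
    rw [hf] at hv
    simp only at hv
    obtain ⟨p, hk, hp⟩ := exists_p hg hQ hu0 hux
    have hv1 : v' ∈ Fl Q 1 := by
      obtain ⟨h, rfl⟩ := hv'
      exact aeval_mem (Fl_X Q 1) (by simpa using Fl_mem Q Nat.one_pos 0) h
    have := hk _ (comm_Fl1 hQ hv1 p).2
    apply hp
    rw [← hv, Matrix.mulVec_sub, dotProduct_sub, Matrix.mulVec_smul, dotProduct_smul]
    rw [dotProduct_sub, Matrix.dotProduct_mulVec u Q.X, hux, smul_dotProduct] at this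
    rw [← neg_eq_zero, ← this]; ring
  obtain ⟨h, hh⟩ := hzW
  rw [evp_apply] at hh
  obtain ⟨t, q, hq, hne⟩ := lemC hg hQ hu0 hz0 hux hXz (Or.inl hx0)
  obtain ⟨D, hD⟩ : ∃ D, D = (Q.Y + t • Q.X ^ (m * 1 - 1)) ^ (m * q - 1) := ⟨_, rfl⟩
  rw [← hD] at hne
  obtain ⟨Zh, hZc, hZ⟩ := aeval_pert Q.X D h
  let b := Module.finBasis ℂ W
  have hp : ∀ i, ∃ p : ℂ[X], aeval Q.X p *ᵥ Q.v = (b i : T → ℂ) := fun i => by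
    obtain ⟨p, hp⟩ := (b i).2
    exact ⟨p, hp⟩
  choose p hp using hp
  let Zf : ℂ → Matrix T T ℂ := fun s =>
    (Q.X - x • 1) * Zh s + D * (aeval Q.X h + s • Zh s)
  have hZf : ∀ s : ℂ, aeval (Q.X + s • D) ((Polynomial.X - C x) * h) *ᵥ Q.v = s • (Zf s *ᵥ Q.v) := by
    intro s
    have e1 : aeval (Q.X + s • D) ((Polynomial.X - C x) * h)
        = (Q.X - x • 1) * aeval Q.X h + s • Zf s := by
      rw [map_mul, hZ, map_sub, aeval_X, aeval_C, Algebra.algebraMap_eq_smul_one]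
      simp only [Zf, smul_add, smul_sub, sub_mul, add_mul, mul_add, Matrix.smul_mul, Matrix.mul_smul, one_mul]
      abel
    rw [e1, Matrix.add_mulVec, ← Matrix.mulVec_mulVec, hh, Matrix.sub_mulVec, Matrix.smul_mulVec,
      Matrix.one_mulVec, hXz, sub_self, zero_add, Matrix.smul_mulVec]
  have hu1 : u ᵥ* (Q.X - x • 1) = 0 := by
    rw [Matrix.vecMul_sub, hux, Matrix.vecMul_smul, Matrix.vecMul_one, sub_self]
  have hcX : Continuous fun s : ℂ => Q.X + s • D := by fun_prop
  have key := pert (T := T) (ι := Option (Fin (Module.finrank ℂ W)))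
    (fun s o => o.elim (Zf s *ᵥ Q.v) (fun i => aeval (Q.X + s • D) (p i) *ᵥ Q.v))
    (by
      rintro (_ | i)
      · simp only [Option.elim_none, Zf]
        have h1 : Continuous fun s => (Q.X - x • 1) * Zh s := continuous_const.matrix_mul hZc
        have h2 : Continuous fun s : ℂ => aeval Q.X h + s • Zh s := by fun_prop
        have h3 : Continuous fun s : ℂ => D * (aeval Q.X h + s • Zh s) :=
          continuous_const.matrix_mul h2
        exact (h1.add h3).matrix_mulVec continuous_const
      · simp only [Option.elim_some]
        obtain ⟨Z, h1, h2⟩ := aeval_pert Q.X D (p i)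
        simp only [h2]
        have h3 : Continuous fun s : ℂ => aeval Q.X (p i) + s • Z s := by fun_prop
        exact h3.matrix_mulVec continuous_const)
    (by
      rw [linearIndependent_option]
      have e : ((fun o : Option (Fin (Module.finrank ℂ W)) => o.elim (Zf 0 *ᵥ Q.v)
          (fun i => aeval (Q.X + (0 : ℂ) • D) (p i) *ᵥ Q.v)) ∘ some) = fun i => (b i : T → ℂ) := by
        ext i; simp [hp]
      rw [e]
      refine ⟨b.linearIndependent.map' W.subtype (Submodule.ker_subtype W), fun hmem => hne ?_⟩
      have hle : Submodule.span ℂ (Set.range fun i => (b i : T → ℂ)) ≤ W := by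
        apply Submodule.span_le.mpr
        rintro _ ⟨i, rfl⟩
        exact (b i).2
      have h1 := huAn _ (hle hmem)
      simp only [Option.elim_none, Zf, zero_smul, add_zero] at h1
      rw [Matrix.add_mulVec, dotProduct_add, ← Matrix.mulVec_mulVec, ← Matrix.mulVec_mulVec,
        Matrix.dotProduct_mulVec, hu1, zero_dotProduct, zero_add, hh] at h1
      exact h1)
    (fun s => LinearMap.range (evp (Q.X + s • D) Q.v))
    (by
      rintro s hs (_ | i)
      · refine ⟨s⁻¹ • ((Polynomial.X - C x) * h), ?_⟩
        rw [map_smul, evp_apply, hZf, smul_smul, inv_mul_cancel₀ hs, one_smul]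
        rfl
      · exact ⟨p i, rfl⟩)
    (fun s => (Q.X + s • D).det ≠ 0) (by
      have : Continuous fun s : ℂ => (Q.X + s • D).det := hcX.matrix_det
      apply this.continuousAt.eventually_ne
      simpa using hQd)
  obtain ⟨s, hs, hsd, hcard⟩ := key
  have hmv := two_moves (deg := deg) (P := Q) t s hq
  rw [← hD] at hmv
  have hfin := hmax _ ⟨hPQ.trans hmv, hsd⟩
  simp only at hfin
  rw [Fintype.card_option, Fintype.card_fin] at hcard
  omega

lemma reach_cyclic [NeZero m] {lam : ZMod m → ℂ} (hg : Gen lam) {n : ℕ}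
    (hn : ∀ r, Fintype.card {t // deg t = r} = n) {P : RD T} (hP : IsR deg lam P) :
    ∃ Q, Orb deg P Q ∧ LinearMap.range (evp Q.X Q.v) = ⊤ := by
  obtain ⟨Q, h1, h2⟩ := stepA hg hn hP
  obtain ⟨R, h3, h4⟩ := stepB hg (h1.isR hP) h2
  exact ⟨R, h1.trans h3, h4⟩

end cyc
end Tot

namespace Tot
section can
variable {m : ℕ} {T : Type} [Fintype T] [DecidableEq T] {deg : T → ZMod m}

def sg (lam : ZMod m → ℂ) (k : ℕ) : ℂ := ∑ j ∈ Finset.range k, lam (-(j : ZMod m))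

lemma sg_succ (lam : ZMod m → ℂ) (k : ℕ) : sg lam (k + 1) = sg lam k + lam (-(k : ZMod m)) := by
  simp [sg, Finset.sum_range_succ]

lemma sg_inj {lam : ZMod m → ℂ} (hg : Gen lam) : Function.Injective (sg lam) := by
  intro a b hab
  apply hg.dual.inj 0
  simpa [sg] using hab

lemma trace_rel [NeZero m] {lam : ZMod m → ℂ} {n : ℕ}
    (hn : ∀ r, Fintype.card {t // deg t = r} = n) {P : RD T} (hP : IsR deg lam P) :
    P.w ⬝ᵥ P.v = sg lam (Fintype.card T) := by
  have h1 := congrArg Matrix.trace hP.rel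
  rw [Matrix.trace_add, Matrix.trace_sub, Matrix.trace_mul_comm, sub_self, zero_add,
    Matrix.trace_vecMulVec, Dg, Matrix.trace_diagonal] at h1
  have hfc : ∀ r, (Finset.univ.filter (fun t => deg t = r)).card = n := fun r => by
    rw [← hn r, Fintype.card_subtype]
  have h2 : ∑ t, lam (deg t) = n * ∑ r, lam r := by
    rw [← Finset.sum_fiberwise Finset.univ deg, Finset.mul_sum]
    refine Finset.sum_congr rfl fun r _ => ?_
    rw [Finset.sum_congr rfl (g := fun _ => lam r)]
    · rw [Finset.sum_const, hfc, nsmul_eq_mul]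
    · intro t ht; rw [(Finset.mem_filter.mp ht).2]
  have h3 : Fintype.card T = m * n := by
    rw [← Finset.card_univ, Finset.card_eq_sum_card_fiberwise (f := deg) (t := Finset.univ)
      (by simp)]
    simp [hfc, ZMod.card]
  have h4 := sum_period (fun i => - lam (-i)) 0 n
  have h5 : ∑ i : ZMod m, - lam (-i) = - ∑ i, lam i := by
    rw [Finset.sum_neg_distrib]
    exact congrArg Neg.neg (Equiv.sum_comp (Equiv.neg (ZMod m)) lam)
  rw [h5] at h4
  simp only [zero_add, Finset.sum_neg_distrib] at h4
  rw [dotProduct_comm, h1, h2, h3, sg]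
  linear_combination h4

lemma exists_mul_sub {j : ℕ} (h : ((j : ZMod m) + 1) = 0) : ∃ k, 1 ≤ k ∧ j = m * k - 1 := by
  have : ((j + 1 : ℕ) : ZMod m) = 0 := by push_cast; exact h
  obtain ⟨k, hk⟩ := (ZMod.natCast_eq_zero_iff _ _).mp this
  refine ⟨k, ?_, by omega⟩
  rcases Nat.eq_zero_or_pos k with h | h
  · subst h; omega
  · exact h

lemma orb_Phi (P : RD T) (c : ℕ → ℂ) (s : Finset ℕ) (hs : ∀ j ∈ s, ((j : ZMod m) + 1) = 0) :
    Orb deg P ⟨P.X, P.Y + ∑ j ∈ s, c j • P.X ^ j, P.v, P.w⟩ := by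
  classical
  induction s using Finset.induction_on with
  | empty => simp; exact .refl
  | insert j s hj ih =>
    obtain ⟨k, hk, hjk⟩ := exists_mul_sub (hs j (by simp))
    refine (ih fun i hi => hs i (by simp [hi])).tail (Or.inr (Or.inl ⟨k, c j, hk, ?_⟩))
    rw [Finset.sum_insert hj]
    simp only [← hjk]
    congr 1; abel

lemma orb_Psi (P : RD T) (c : ℕ → ℂ) (s : Finset ℕ) (hs : ∀ j ∈ s, ((j : ZMod m) + 1) = 0) :
    Orb deg P ⟨P.X + ∑ j ∈ s, c j • P.Y ^ j, P.Y, P.v, P.w⟩ := by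
  classical
  induction s using Finset.induction_on with
  | empty => simp; exact .refl
  | insert j s hj ih =>
    obtain ⟨k, hk, hjk⟩ := exists_mul_sub (hs j (by simp))
    refine (ih fun i hi => hs i (by simp [hi])).tail (Or.inl ⟨k, c j, hk, ?_⟩)
    rw [Finset.sum_insert hj]
    simp only [← hjk]
    congr 1; abel

/-- graded selection -/
lemma select {N : ℕ} {y : T → ℂ} {f : ℕ → T → ℂ} {d : ℕ → ZMod m} {r : ZMod m} {c : ℕ → ℂ}
    (hy : HomV deg r y) (hf : ∀ j, HomV deg (d j) (f j))
    (h : y = ∑ j ∈ Finset.range N, c j • f j) :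
    y = ∑ j ∈ (Finset.range N).filter (fun j => d j = r), c j • f j := by
  have h1 := congrArg (fun y => Dg deg (fun i => if i = r then 1 else 0) *ᵥ y) h
  beta_reduce at h1
  rw [Dg_mulVec hy, Matrix.mulVec_sum] at h1
  simp only [if_true, one_smul] at h1
  rw [h1, Finset.sum_filter]
  refine Finset.sum_congr rfl fun j _ => ?_
  rw [Matrix.mulVec_smul, Dg_mulVec (hf j)]
  split_ifs <;> simp

open Polynomial in
lemma cyc_sum {X : Matrix T T ℂ} {v : T → ℂ} (h : LinearMap.range (evp X v) = ⊤) (y : T → ℂ) :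
    ∃ c : ℕ → ℂ, y = ∑ j ∈ Finset.range (Fintype.card T), c j • (X ^ j *ᵥ v) := by
  obtain ⟨p, rfl⟩ : y ∈ LinearMap.range (evp X v) := h ▸ Submodule.mem_top
  rcases isEmpty_or_nonempty T with hT | hT
  · exact ⟨0, Subsingleton.elim _ _⟩
  set q := p %ₘ X.charpoly
  have hq : aeval X q = aeval X p :=
    Polynomial.aeval_modByMonic_eq_self_of_root (Matrix.aeval_self_charpoly X)
  have hd : q.natDegree < Fintype.card T := by
    rw [← Matrix.charpoly_natDegree_eq_dim X]
    apply Polynomial.natDegree_modByMonic_lt _ (Matrix.charpoly_monic X)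
    intro h1
    have := Matrix.charpoly_natDegree_eq_dim X
    rw [h1, natDegree_one] at this
    exact Fintype.card_ne_zero this.symm
  refine ⟨q.coeff, ?_⟩
  rw [evp_apply, ← hq, Polynomial.aeval_eq_sum_range' hd, Matrix.sum_mulVec]
  simp [Matrix.smul_mulVec]

/-- Step 2a -/
lemma step2a [NeZero m] {lam : ZMod m → ℂ} {P : RD T} (hP : IsR deg lam P)
    (h : LinearMap.range (evp P.X P.v) = ⊤) :
    ∃ Q, Orb deg P Q ∧ LinearMap.range (evp Q.X Q.v) = ⊤ ∧ Q.Y *ᵥ Q.v = 0 := by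
  obtain ⟨c, hc⟩ := cyc_sum h (P.Y *ᵥ P.v)
  have hsel := select (deg := deg) (d := fun j => 0 + j * (-1)) (hP.hY.mulVec hP.hv)
    (fun j => (hP.hX.pow j).mulVec hP.hv) hc
  refine ⟨_, orb_Phi P (fun j => - c j) (s := (Finset.range (Fintype.card T)).filter
    (fun j => 0 + (j : ZMod m) * (-1) = 0 + 1)) ?_, h, ?_⟩
  · intro j hj
    have := (Finset.mem_filter.mp hj).2
    simp only [zero_add, mul_neg, mul_one] at this
    rw [← this]; ring
  · simp only
    rw [Matrix.add_mulVec, hsel, Matrix.sum_mulVec]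
    simp only [neg_smul, Matrix.neg_mulVec, Matrix.smul_mulVec, Finset.sum_neg_distrib, add_neg_cancel]

structure Can (P : RD T) : Prop where
  wX : P.w ᵥ* P.X = 0
  Yv : P.Y *ᵥ P.v = 0
  nil : P.Y ^ (Fintype.card T) = 0
  ind : LinearIndependent ℂ (fun k : Fin (Fintype.card T) => P.w ᵥ* P.Y ^ (k : ℕ))

/-- span of the first `k` Krylov vectors -/
def Vk (P : RD T) (k : ℕ) : Submodule ℂ (T → ℂ) :=
  Submodule.span ℂ {y | ∃ j < k, y = P.X ^ j *ᵥ P.v}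

lemma Vk_X {P : RD T} {k : ℕ} {y : T → ℂ} (hy : y ∈ Vk P k) : P.X *ᵥ y ∈ Vk P (k + 1) := by
  have : Vk P k ≤ (Vk P (k + 1)).comap (Matrix.toLin' P.X) := by
    apply Submodule.span_le.mpr
    rintro y ⟨j, hj, rfl⟩
    simp only [Submodule.comap_coe, Set.mem_preimage, Matrix.toLin'_apply]
    refine Submodule.subset_span ⟨j + 1, by omega, ?_⟩
    rw [pow_succ', Matrix.mulVec_mulVec]
  simpa using this hy

lemma Vk_mono {P : RD T} {a b : ℕ} (h : a ≤ b) : Vk P a ≤ Vk P b := by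
  apply Submodule.span_mono
  rintro y ⟨j, hj, rfl⟩
  exact ⟨j, by omega, rfl⟩

lemma YX_mulVec {lam : ZMod m → ℂ} {P : RD T} (hP : IsR deg lam P) (y : T → ℂ) :
    P.Y *ᵥ (P.X *ᵥ y) = P.X *ᵥ (P.Y *ᵥ y) - Dg deg lam *ᵥ y + (P.w ⬝ᵥ y) • P.v := by
  rw [comm_mulVec hP]; abel

lemma Y_tri [NeZero m] {lam : ZMod m → ℂ} {n : ℕ}
    (hn : ∀ r, Fintype.card {t // deg t = r} = n) {P : RD T} (hP : IsR deg lam P)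
    (hYv : P.Y *ᵥ P.v = 0) (k : ℕ) :
    P.Y *ᵥ (P.X ^ (k + 1) *ᵥ P.v) - (sg lam (Fintype.card T) - sg lam (k + 1)) • (P.X ^ k *ᵥ P.v)
      ∈ Vk P k := by
  have e : ∀ k, P.X ^ (k + 1) *ᵥ P.v = P.X *ᵥ (P.X ^ k *ᵥ P.v) := fun k => by
    rw [pow_succ', Matrix.mulVec_mulVec]
  induction k with
  | zero =>
    rw [e, YX_mulVec hP]
    simp only [pow_zero, Matrix.one_mulVec, hYv, Matrix.mulVec_zero, Dg_mulVec hP.hv,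
      trace_rel hn hP, sg_succ]
    convert Submodule.zero_mem _ using 1
    simp [sg]
    module
  | succ k ih =>
    rw [e (k + 1), YX_mulVec hP, Dg_mulVec ((hP.hX.pow (k + 1)).mulVec hP.hv)]
    have h1 := Vk_X ih
    have h2 : P.v ∈ Vk P (k + 1) := Submodule.subset_span ⟨0, by omega, by simp⟩
    have h3 := Submodule.add_mem _ h1 (Submodule.smul_mem _ (P.w ⬝ᵥ (P.X ^ (k + 1) *ᵥ P.v)) h2)
    rw [Matrix.mulVec_sub, Matrix.mulVec_smul, ← e] at h3
    convert h3 using 1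
    have e2 : (0 : ZMod m) + ((k + 1 : ℕ) : ZMod m) * (-1) = -((k + 1 : ℕ) : ZMod m) := by ring
    rw [e2, sg_succ lam (k + 1)]
    module

/-- Step 2b -/
lemma step2b [NeZero m] {lam : ZMod m → ℂ} (hg : Gen lam) {n : ℕ}
    (hn : ∀ r, Fintype.card {t // deg t = r} = n) {P : RD T} (hP : IsR deg lam P)
    (h : LinearMap.range (evp P.X P.v) = ⊤) (hYv : P.Y *ᵥ P.v = 0) :
    P.Y ^ (Fintype.card T) = 0 ∧
    LinearIndependent ℂ (fun k : Fin (Fintype.card T) => P.w ᵥ* P.Y ^ (k : ℕ)) := by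
  have hstep : ∀ k, ∀ y ∈ Vk P (k + 1), P.Y *ᵥ y ∈ Vk P k := by
    intro k y hy
    have : Vk P (k + 1) ≤ (Vk P k).comap (Matrix.toLin' P.Y) := by
      apply Submodule.span_le.mpr
      rintro y ⟨j, hj, rfl⟩
      simp only [Submodule.comap_coe, Set.mem_preimage, Matrix.toLin'_apply]
      cases j with
      | zero => simp [hYv]
      | succ j =>
        have h1 := Vk_mono (show j ≤ k by omega) (Y_tri hn hP hYv j)
        have h2 : P.X ^ j *ᵥ P.v ∈ Vk P k := Submodule.subset_span ⟨j, by omega, rfl⟩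
        have := Submodule.add_mem _ h1 (Submodule.smul_mem _
          (sg lam (Fintype.card T) - sg lam (j + 1)) h2)
        simpa using this
    simpa using this hy
  have hV0 : Vk P 0 = ⊥ := by simp [Vk]
  have hkill : ∀ k, ∀ y ∈ Vk P k, P.Y ^ k *ᵥ y = 0 := by
    intro k
    induction k with
    | zero => intro y hy; rw [hV0, Submodule.mem_bot] at hy; simp [hy]
    | succ k ih =>
      intro y hy
      rw [pow_succ, ← Matrix.mulVec_mulVec]
      exact ih _ (hstep k y hy)
  have hdiag : ∀ k, P.Y ^ k *ᵥ (P.X ^ k *ᵥ P.v) =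
      (∏ i ∈ Finset.range k, (sg lam (Fintype.card T) - sg lam (i + 1))) • P.v := by
    intro k
    induction k with
    | zero => simp
    | succ k ih =>
      have h1 := hkill k _ (Y_tri hn hP hYv k)
      rw [Matrix.mulVec_sub, sub_eq_zero, Matrix.mulVec_smul, ih, Matrix.mulVec_mulVec,
        ← pow_succ] at h1
      rw [h1, smul_smul, Finset.prod_range_succ, mul_comm]
  constructor
  · have hz : ∀ y, P.Y ^ (Fintype.card T) *ᵥ y = 0 := by
      intro y
      apply hkill
      obtain ⟨c, rfl⟩ := cyc_sum h y
      refine Submodule.sum_mem _ fun j hj => Submodule.smul_mem _ _ ?_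
      exact Submodule.subset_span ⟨j, by simpa using hj, rfl⟩
    ext s t
    have := congrFun (hz (Pi.single t 1)) s
    simpa using this
  · rw [Fintype.linearIndependent_iff]
    intro a ha
    have hall : ∀ j : ℕ, ∀ hj : j < Fintype.card T, a ⟨j, hj⟩ = 0 := by
      intro j
      induction j using Nat.strong_induction_on with
      | _ j ih =>
        intro hj
        have h1 := congrArg (fun y => y ⬝ᵥ (P.X ^ j *ᵥ P.v)) ha
        simp only [sum_dotProduct, smul_dotProduct, zero_dotProduct] at h1
        rw [Finset.sum_eq_single ⟨j, hj⟩] at h1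
        · rw [← Matrix.dotProduct_mulVec, hdiag, dotProduct_smul, trace_rel hn hP] at h1
          simp only [smul_eq_mul] at h1
          rcases mul_eq_zero.mp h1 with h | h
          · exact h
          · exfalso
            rcases mul_eq_zero.mp h with h | h
            · obtain ⟨i, hi, h0⟩ := Finset.prod_eq_zero_iff.mp h
              have := sg_inj hg (sub_eq_zero.mp h0)
              have := Finset.mem_range.mp hi
              omega
            · have h00 : sg lam 0 = 0 := by simp [sg]
              have := sg_inj hg (h.trans h00.symm)
              omega
        · rintro ⟨i, hi⟩ _ hne
          rcases Nat.lt_or_ge i j with h2 | h2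
          · rw [ih i h2 hi, zero_smul]
          · have h3 : j + 1 ≤ i := by
              rcases Nat.lt_or_ge j i with h4 | h4
              · exact h4
              · exact absurd (Fin.ext (by simp; omega)) hne
            have h4 : P.Y ^ i *ᵥ (P.X ^ j *ᵥ P.v) = 0 := by
              have := hkill (j + 1) _ (Submodule.subset_span ⟨j, by omega, rfl⟩ :
                P.X ^ j *ᵥ P.v ∈ Vk P (j + 1))
              have e : i = (i - (j + 1)) + (j + 1) := by omega
              rw [e, pow_add, ← Matrix.mulVec_mulVec, this, Matrix.mulVec_zero]
            rw [← Matrix.dotProduct_mulVec, h4]; simp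
        · simp
    exact fun i => hall i i.2

lemma reach_can [NeZero m] {lam : ZMod m → ℂ} (hg : Gen lam) {n : ℕ}
    (hn : ∀ r, Fintype.card {t // deg t = r} = n) {P : RD T} (hP : IsR deg lam P) :
    ∃ Q, Orb deg P Q ∧ Can Q := by
  obtain ⟨P1, o1, h1⟩ := reach_cyclic hg hn hP
  obtain ⟨P2, o2, h2, hYv⟩ := step2a (o1.isR hP) h1
  have hP2 := o2.isR (o1.isR hP)
  obtain ⟨hnil, hind⟩ := step2b hg hn hP2 h2 hYv
  have hspan : ∃ c : ℕ → ℂ, P2.w ᵥ* P2.X =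
      ∑ j ∈ Finset.range (Fintype.card T), c j • (P2.w ᵥ* P2.Y ^ j) := by
    have htop := hind.span_eq_top_of_card_eq_finrank' (by simp)
    have hmem : P2.w ᵥ* P2.X ∈ Submodule.span ℂ
        (Set.range (fun k : Fin (Fintype.card T) => P2.w ᵥ* P2.Y ^ (k : ℕ))) :=
      htop ▸ Submodule.mem_top
    rw [Submodule.mem_span_range_iff_exists_fun] at hmem
    obtain ⟨c, hc⟩ := hmem
    refine ⟨fun j => if h : j < Fintype.card T then c ⟨j, h⟩ else 0, ?_⟩
    rw [← hc, Finset.sum_range]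
    simp
  obtain ⟨c, hc⟩ := hspan
  have hsel := select (deg := deg) (d := fun j => 0 - j * 1) (hP2.hX.vecMul hP2.hw)
    (fun j => (hP2.hY.pow j).vecMul hP2.hw) hc
  refine ⟨_, (o1.trans o2).trans (orb_Psi P2 (fun j => - c j) (s := (Finset.range
    (Fintype.card T)).filter (fun j => 0 - (j : ZMod m) * 1 = 0 - (-1))) ?_), ?_, hYv, hnil, hind⟩
  · intro j hj
    have := (Finset.mem_filter.mp hj).2
    simp only [zero_sub, mul_one, neg_neg] at this
    rw [← this]; ring
  · simp only
    rw [Matrix.vecMul_add, hsel, Matrix.vecMul_sum]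
    simp only [neg_smul, Matrix.vecMul_neg, Matrix.vecMul_smul, Finset.sum_neg_distrib, add_neg_cancel]

lemma Can.RX [NeZero m] {lam : ZMod m → ℂ} {n : ℕ}
    (hn : ∀ r, Fintype.card {t // deg t = r} = n) {P : RD T} (hP : IsR deg lam P) (hc : Can P)
    (j : ℕ) : (P.w ᵥ* P.Y ^ (j + 1)) ᵥ* P.X =
      (sg lam (Fintype.card T) - sg lam (j + 1)) • (P.w ᵥ* P.Y ^ j) := by
  have hrel : P.Y * P.X = P.X * P.Y - Dg deg lam + vecMulVec P.v P.w := by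
    rw [← hP.rel]; abel
  have e : ∀ j : ℕ, (P.w ᵥ* P.Y ^ (j + 1)) ᵥ* P.X = ((P.w ᵥ* P.Y ^ j) ᵥ* P.X) ᵥ* P.Y
      - lam (-(j : ZMod m)) • (P.w ᵥ* P.Y ^ j) + ((P.w ᵥ* P.Y ^ j) ⬝ᵥ P.v) • P.w := by
    intro j
    have h1 := (hP.hY.pow j).vecMul hP.hw
    have e1 : (0 : ZMod m) - (j : ZMod m) * 1 = -(j : ZMod m) := by ring
    rw [e1] at h1
    have h2 : (P.w ᵥ* P.Y ^ j) ᵥ* Dg deg lam = lam (-(j : ZMod m)) • (P.w ᵥ* P.Y ^ j) := by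
      rw [← Dg_mulVec h1, ← Matrix.mulVec_transpose, Dg_transpose]
    rw [pow_succ, ← Matrix.vecMul_vecMul, Matrix.vecMul_vecMul _ P.Y P.X, hrel, Matrix.vecMul_add,
      Matrix.vecMul_sub, h2, Matrix.vecMul_vecMul _ P.X, Matrix.vecMul_vecMulVec]
  induction j with
  | zero =>
    rw [e]
    simp only [pow_zero, Matrix.vecMul_one, hc.wX, Matrix.zero_vecMul, trace_rel hn hP, sg_succ]
    simp [sg]
    module
  | succ j ih =>
    rw [e, ih, Matrix.smul_vecMul, Matrix.vecMul_vecMul, ← pow_succ, sg_succ lam (j + 1)]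
    have : (P.w ᵥ* P.Y ^ (j + 1)) ⬝ᵥ P.v = 0 := by
      rw [← Matrix.dotProduct_mulVec, pow_succ, ← Matrix.mulVec_mulVec, hc.Yv]; simp
    rw [this]
    module

lemma can_unique [NeZero m] {lam : ZMod m → ℂ} {n : ℕ}
    (hn : ∀ r, Fintype.card {t // deg t = r} = n) {P Q : RD T} (hP : IsR deg lam P)
    (hQ : IsR deg lam Q) (hcP : Can P) (hcQ : Can Q) : Orb deg P Q := by
  rcases isEmpty_or_nonempty T with hT | hT
  · have : P = Q := by
      cases P; cases Q; congr <;> exact Subsingleton.elim _ _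
    rw [this]; exact .refl
  let e : T ≃ Fin (Fintype.card T) := Fintype.equivFin T
  let K : RD T → Matrix T T ℂ := fun P => fun t => P.w ᵥ* P.Y ^ (e t : ℕ)
  have hK : ∀ P, Can P → IsUnit (K P) := by
    intro P hc
    rw [← Matrix.linearIndependent_rows_iff_isUnit]
    exact hc.ind.comp e e.injective
  have hKP := hK P hcP
  have hKQ := hK Q hcQ
  have hdP := (Matrix.isUnit_iff_isUnit_det _).mp hKP
  have hdQ := (Matrix.isUnit_iff_isUnit_det _).mp hKQ
  let g := (K Q)⁻¹ * K P
  let h := (K P)⁻¹ * K Q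
  have hgh : g * h = 1 := by
    simp only [g, h]
    rw [mul_assoc, ← mul_assoc (K P), Matrix.mul_nonsing_inv _ hdP, one_mul,
      Matrix.nonsing_inv_mul _ hdQ]
  have hKg : K Q * g = K P := by
    simp only [g]
    rw [← mul_assoc, Matrix.mul_nonsing_inv _ hdQ, one_mul]
  clear_value g h
  have hR : ∀ j, j ≤ Fintype.card T → (Q.w ᵥ* Q.Y ^ j) ᵥ* g = P.w ᵥ* P.Y ^ j := by
    intro j hj
    rcases Nat.lt_or_ge j (Fintype.card T) with h1 | h1
    · have h2 := congrFun hKg (e.symm ⟨j, h1⟩)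
      rw [Matrix.mul_apply_eq_vecMul] at h2
      simpa [K] using h2
    · have : j = Fintype.card T := by omega
      rw [this, hcP.nil, hcQ.nil]; simp
  -- cancellation
  have hcan : ∀ A B : Matrix T T ℂ, (∀ j < Fintype.card T,
      (Q.w ᵥ* Q.Y ^ j) ᵥ* A = (Q.w ᵥ* Q.Y ^ j) ᵥ* B) → A = B := by
    intro A B hAB
    have : K Q * A = K Q * B := by
      funext t
      rw [Matrix.mul_apply_eq_vecMul, Matrix.mul_apply_eq_vecMul]
      exact hAB _ (e t).2
    exact hKQ.mul_left_cancel this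
  have hgX : Q.X * g = g * P.X := by
    apply hcan
    intro j hj
    rw [← Matrix.vecMul_vecMul, ← Matrix.vecMul_vecMul, hR j hj.le]
    cases j with
    | zero => simp [hcP.wX, hcQ.wX]
    | succ j => rw [hcQ.RX hn hQ, hcP.RX hn hP, Matrix.smul_vecMul, hR j (by omega)]
  have hgY : Q.Y * g = g * P.Y := by
    apply hcan
    intro j hj
    rw [← Matrix.vecMul_vecMul, ← Matrix.vecMul_vecMul, hR j hj.le, Matrix.vecMul_vecMul Q.w,
      ← pow_succ, hR (j + 1) hj, Matrix.vecMul_vecMul, ← pow_succ]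
  have hgD : ∀ φ, Dg deg φ * g = g * Dg deg φ := by
    intro φ
    apply hcan
    intro j hj
    have aux : ∀ P : RD T, IsR deg lam P →
        (P.w ᵥ* P.Y ^ j) ᵥ* Dg deg φ = φ (0 - j * 1) • (P.w ᵥ* P.Y ^ j) := by
      intro P hP
      rw [← Dg_mulVec ((hP.hY.pow j).vecMul hP.hw), ← Matrix.mulVec_transpose, Dg_transpose]
    rw [← Matrix.vecMul_vecMul, ← Matrix.vecMul_vecMul, hR j hj.le, aux Q hQ, aux P hP,
      Matrix.smul_vecMul, hR j hj.le]
  have hhg : h * g = 1 := mul_eq_one_comm.mp hgh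
  have hhD : ∀ φ, Dg deg φ * h = h * Dg deg φ := by
    intro φ
    calc Dg deg φ * h = h * g * Dg deg φ * h := by rw [hhg, one_mul]
      _ = h * (g * Dg deg φ) * h := by simp only [mul_assoc]
      _ = h * Dg deg φ * (g * h) := by rw [← hgD]; simp only [mul_assoc]
      _ = _ := by rw [hgh, mul_one]
  have hHom : ∀ A : Matrix T T ℂ, (∀ φ, Dg deg φ * A = A * Dg deg φ) → Hom deg 0 A := by
    intro A hA s t hst
    have h1 := congrFun (congrFun (hA (fun i => if i = deg s then 1 else 0)) s) t
    simp only [Dg, Matrix.diagonal_mul, Matrix.mul_diagonal, if_true, one_mul] at h1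
    by_contra hne
    rw [add_zero] at hne
    rw [if_neg (fun h => hne h.symm), mul_zero] at h1
    exact hst h1
  refine .single (Or.inr (Or.inr ⟨g, h, hgh, hHom g hgD, hHom h hhD, ?_⟩))
  have e1 : g * P.X * h = Q.X := by rw [← hgX, mul_assoc, hgh, mul_one]
  have e2 : g * P.Y * h = Q.Y := by rw [← hgY, mul_assoc, hgh, mul_one]
  have e3 : P.w ᵥ* h = Q.w := by
    have := hR 0 (by omega)
    simp only [pow_zero, Matrix.vecMul_one] at this
    rw [← this, Matrix.vecMul_vecMul, hgh, Matrix.vecMul_one]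
  have e4 : g *ᵥ P.v = Q.v := by
    have h1 : K Q *ᵥ (g *ᵥ P.v) = K Q *ᵥ Q.v := by
      rw [Matrix.mulVec_mulVec, hKg]
      funext t
      show (P.w ᵥ* P.Y ^ (e t : ℕ)) ⬝ᵥ P.v = (Q.w ᵥ* Q.Y ^ (e t : ℕ)) ⬝ᵥ Q.v
      generalize (e t : ℕ) = j
      cases j with
      | zero => simp [trace_rel hn hP, trace_rel hn hQ]
      | succ j =>
        rw [← Matrix.dotProduct_mulVec, ← Matrix.dotProduct_mulVec, pow_succ, pow_succ,
          ← Matrix.mulVec_mulVec, ← Matrix.mulVec_mulVec, hcP.Yv, hcQ.Yv]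
        simp
    exact Matrix.mulVec_injective_of_isUnit hKQ h1
  rw [e1, e2, e3, e4]

lemma const_case [NeZero m] {lam : ZMod m → ℂ} (hg : Gen lam) {n : ℕ}
    (hn : ∀ r, Fintype.card {t // deg t = r} = n) {P Q : RD T} (hP : IsR deg lam P)
    (hQ : IsR deg lam Q) : Orb deg P Q := by
  obtain ⟨P', o1, h1⟩ := reach_can hg hn hP
  obtain ⟨Q', o2, h2⟩ := reach_can hg hn hQ
  exact (o1.trans (can_unique hn (o1.isR hP) (o2.isR hQ) h1 h2)).trans o2.symm

end can
end Tot

namespace Tot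
section refl
variable {m : ℕ} {S A A' : Type} [Fintype S] [DecidableEq S] [Fintype A] [DecidableEq A]
  [Fintype A'] [DecidableEq A']

/-- Index type of the space through which vertex `i` is connected. -/
abbrev UU (S : Type) := S ⊕ (S ⊕ Unit)

def Inn (P : RD (S ⊕ A)) : Matrix A (UU S) ℂ := Matrix.of fun a u =>
  Sum.elim (fun s => P.X (Sum.inr a) (Sum.inl s))
    (Sum.elim (fun s => P.Y (Sum.inr a) (Sum.inl s)) (fun _ => P.v (Sum.inr a))) u

def Out (P : RD (S ⊕ A)) : Matrix (UU S) A ℂ := Matrix.of fun u a =>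
  Sum.elim (fun s => P.Y (Sum.inl s) (Sum.inr a))
    (Sum.elim (fun s => - P.X (Sum.inl s) (Sum.inr a)) (fun _ => P.w (Sum.inr a))) u

@[simp] lemma Inn_1 (P : RD (S ⊕ A)) (a : A) (s : S) :
    Inn P a (Sum.inl s) = P.X (Sum.inr a) (Sum.inl s) := rfl
@[simp] lemma Inn_2 (P : RD (S ⊕ A)) (a : A) (s : S) :
    Inn P a (Sum.inr (Sum.inl s)) = P.Y (Sum.inr a) (Sum.inl s) := rfl
@[simp] lemma Inn_3 (P : RD (S ⊕ A)) (a : A) (s : Unit) :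
    Inn P a (Sum.inr (Sum.inr s)) = P.v (Sum.inr a) := rfl
@[simp] lemma Out_1 (P : RD (S ⊕ A)) (a : A) (s : S) :
    Out P (Sum.inl s) a = P.Y (Sum.inl s) (Sum.inr a) := rfl
@[simp] lemma Out_2 (P : RD (S ⊕ A)) (a : A) (s : S) :
    Out P (Sum.inr (Sum.inl s)) a = - P.X (Sum.inl s) (Sum.inr a) := rfl
@[simp] lemma Out_3 (P : RD (S ⊕ A)) (a : A) (s : Unit) :
    Out P (Sum.inr (Sum.inr s)) a = P.w (Sum.inr a) := rfl

/-- weights of the projection `Π` -/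
def piw (dS : S → ZMod m) (i : ZMod m) : UU S → ℂ :=
  Sum.elim (fun s => if dS s = i + 1 then 1 else 0)
    (Sum.elim (fun s => if dS s = i - 1 then 1 else 0) (fun _ => if i = 0 then 1 else 0))

def Pi' (dS : S → ZMod m) (i : ZMod m) : Matrix (UU S) (UU S) ℂ := diagonal (piw dS i)

/-- the extended degree -/
def dg (A : Type) (dS : S → ZMod m) (i : ZMod m) : S ⊕ A → ZMod m := Sum.elim dS (fun _ => i)

structure Refl (dS : S → ZMod m) (i : ZMod m) (c : ℂ) (P : RD (S ⊕ A)) (P' : RD (S ⊕ A')) :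
    Prop where
  X : ∀ s t, P'.X (Sum.inl s) (Sum.inl t) = P.X (Sum.inl s) (Sum.inl t)
  Y : ∀ s t, P'.Y (Sum.inl s) (Sum.inl t) = P.Y (Sum.inl s) (Sum.inl t)
  v : ∀ s, P'.v (Sum.inl s) = P.v (Sum.inl s)
  w : ∀ s, P'.w (Sum.inl s) = P.w (Sum.inl s)
  io : Inn P * Out P = c • 1
  io' : Inn P' * Out P' = (-c) • 1
  N : Out P' * Inn P' = Out P * Inn P - c • Pi' dS i

lemma Refl.symm {dS : S → ZMod m} {i : ZMod m} {c : ℂ} {P : RD (S ⊕ A)} {P' : RD (S ⊕ A')}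
    (h : Refl dS i c P P') : Refl dS i (-c) P' P where
  X s t := (h.X s t).symm
  Y s t := (h.Y s t).symm
  v s := (h.v s).symm
  w s := (h.w s).symm
  io := h.io'
  io' := by rw [h.io, neg_neg]
  N := by rw [h.N]; simp

section isr
variable [Fact (1 < m)] {dS : S → ZMod m} {i : ZMod m} {lam : ZMod m → ℂ} {P : RD (S ⊕ A)}

lemma AAX (hX : Hom (dg A dS i) (-1) P.X) (a b : A) : P.X (Sum.inr a) (Sum.inr b) = 0 := by
  by_contra h
  have := hX _ _ h
  simp [dg] at this

lemma AAY (hY : Hom (dg A dS i) 1 P.Y) (a b : A) : P.Y (Sum.inr a) (Sum.inr b) = 0 := by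
  by_contra h
  have := hY _ _ h
  simp [dg] at this

lemma IsR.io (h : IsR (dg A dS i) lam P) : Inn P * Out P = lam i • 1 := by
  ext a b
  have h1 := congrFun (congrFun h.rel (Sum.inr a)) (Sum.inr b)
  simp only [Matrix.add_apply, Matrix.sub_apply, Matrix.mul_apply, Fintype.sum_sum_type,
    AAX h.hX, AAY h.hY, vecMulVec_apply, Dg] at h1
  simp only [Matrix.mul_apply, Fintype.sum_sum_type, Inn_1, Inn_2, Inn_3, Out_1, Out_2, Out_3,
    Matrix.smul_apply, Matrix.one_apply, Matrix.diagonal_apply, dg, Sum.elim_inr,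
    Finset.univ_unique, Finset.sum_singleton, mul_neg, Finset.sum_neg_distrib, zero_mul,
    Finset.sum_const_zero, add_zero, smul_eq_mul, mul_ite, mul_one, mul_zero,
    Sum.inr.injEq] at h1 ⊢
  rw [← h1]; ring

lemma IsR.InnPi (h : IsR (dg A dS i) lam P) : Inn P * Pi' dS i = Inn P := by
  ext a u
  rw [Pi', Matrix.mul_diagonal]
  by_cases hz : Inn P a u = 0
  · simp [hz]
  suffices piw dS i u = 1 by rw [this, mul_one]
  rcases u with s | s | s
  · have := h.hX _ _ hz
    simp only [dg, Sum.elim_inl, Sum.elim_inr] at this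
    simp [piw, this]
  · have := h.hY _ _ hz
    simp only [dg, Sum.elim_inl, Sum.elim_inr] at this
    simp [piw, this]
  · have := h.hv _ hz
    simp only [dg, Sum.elim_inl, Sum.elim_inr] at this
    simp [piw, this]

lemma IsR.PiOut (h : IsR (dg A dS i) lam P) : Pi' dS i * Out P = Out P := by
  ext u a
  rw [Pi', Matrix.diagonal_mul]
  by_cases hz : Out P u a = 0
  · simp [hz]
  suffices piw dS i u = 1 by rw [this, one_mul]
  rcases u with s | s | s
  · have := h.hY _ _ hz
    simp only [dg, Sum.elim_inl, Sum.elim_inr] at this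
    simp [piw, this]
  · have := h.hX _ _ (neg_ne_zero.mp hz)
    simp only [dg, Sum.elim_inl, Sum.elim_inr] at this
    simp [piw, this, sub_eq_add_neg]
  · have := h.hw _ hz
    simp only [dg, Sum.elim_inl, Sum.elim_inr] at this
    simp [piw, this]

end isr

/-- factorization of idempotents -/
lemma idem_factor {U : Type} [Fintype U] [DecidableEq U] {E : Matrix U U ℂ} (hE : E * E = E) :
    ∃ (k : ℕ) (J : Matrix U (Fin k) ℂ) (K : Matrix (Fin k) U ℂ), J * K = E ∧ K * J = 1 := by
  let f := Matrix.toLin' E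
  let R := LinearMap.range f
  have hf : f ∘ₗ f = f := by
    rw [← Matrix.toLin'_mul, hE]
  let b := Module.finBasis ℂ R
  let e := b.equivFun
  let j : (Fin (Module.finrank ℂ R) → ℂ) →ₗ[ℂ] (U → ℂ) := R.subtype ∘ₗ e.symm.toLinearMap
  let k : (U → ℂ) →ₗ[ℂ] (Fin (Module.finrank ℂ R) → ℂ) := e.toLinearMap ∘ₗ f.rangeRestrict
  refine ⟨_, LinearMap.toMatrix' j, LinearMap.toMatrix' k, ?_, ?_⟩
  · rw [← LinearMap.toMatrix'_comp]
    have : j ∘ₗ k = f := by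
      ext x : 2
      simp [j, k]
    rw [this]; simp [f]
  · rw [← LinearMap.toMatrix'_comp]
    have : k ∘ₗ j = LinearMap.id := by
      refine LinearMap.ext fun x => ?_
      have hx : f.rangeRestrict (e.symm x : U → ℂ) = e.symm x := by
        apply Subtype.ext
        obtain ⟨y, hy⟩ := (e.symm x).2
        show f (e.symm x : U → ℂ) = _
        rw [← hy]
        exact LinearMap.congr_fun hf y
      show e (f.rangeRestrict (e.symm x : U → ℂ)) = x
      rw [hx]; simp
    rw [this]; simp

def lamR (lam : ZMod m → ℂ) (i : ZMod m) : ZMod m → ℂ := fun j =>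
  lam j + (if j = i + 1 then lam i else 0) + (if j = i - 1 then lam i else 0)
    - 2 * (if j = i then lam i else 0)

lemma Gen.refl [Fact (1 < m)] {lam : ZMod m → ℂ} (hg : Gen lam) (i : ZMod m) :
    Gen (lamR lam i) := by
  obtain ⟨θ, hi, hθ⟩ := hg
  let σ : ℤ → ℤ := fun j => j + (if (j : ZMod m) = i then 1 else 0)
    - (if (j : ZMod m) = i + 1 then 1 else 0)
  have hσ : Function.Injective σ := by
    intro a b hab
    simp only [σ] at hab
    have hne : ¬ (i = i + 1) := by simp
    have hab' := congrArg (fun j : ℤ => (j : ZMod m)) hab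
    push_cast at hab'
    by_cases ha : (a : ZMod m) = i <;> by_cases hb : (b : ZMod m) = i <;>
    by_cases ha' : (a : ZMod m) = i + 1 <;> by_cases hb' : (b : ZMod m) = i + 1 <;>
    simp_all
    all_goals first
      | omega
      | (exfalso; apply hb'; linear_combination -hab')
      | (exfalso; apply hb; linear_combination -hab')
      | (exfalso; apply ha'; linear_combination hab')
      | (exfalso; apply ha; linear_combination hab')
      | skip
  have hθσ : ∀ j, θ (σ j) = θ j + (if (j : ZMod m) = i then lam i else 0)
      - (if (j : ZMod m) = i + 1 then lam i else 0) := by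
    intro j
    have hne : ¬ (i = i + 1) := by simp
    by_cases h1 : (j : ZMod m) = i
    · have := hθ j
      simp only [σ, h1, if_true, if_neg hne] at this ⊢
      simp only [sub_zero]
      rw [← this]; ring
    · by_cases h2 : (j : ZMod m) = i + 1
      · have := hθ (j - 1)
        push_cast at this
        simp only [h2, add_sub_cancel_right, sub_add_cancel] at this
        simp only [σ, h1, h2, if_true, if_false, add_zero]
        rw [← this]; simp
      · simp [σ, h1, h2]
  refine ⟨θ ∘ σ, hi.comp hσ, fun j => ?_⟩
  simp only [Function.comp]
  rw [hθσ, hθσ, lamR, ← hθ j]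
  push_cast
  simp only [add_left_inj, eq_sub_iff_add_eq]
  ring

lemma exists_refl [Fact (1 < m)] {dS : S → ZMod m} {i : ZMod m} (hdS : ∀ s, dS s ≠ i)
    {lam : ZMod m → ℂ} (hi : lam i ≠ 0)
    {P : RD (S ⊕ A)} (hP : IsR (dg A dS i) lam P) :
    ∃ (k : ℕ) (P' : RD (S ⊕ Fin k)), Refl dS i (lam i) P P' ∧ IsR (dg (Fin k) dS i) (lamR lam i) P'
      ∧ (k : ℂ) + Fintype.card A = ∑ u, piw dS i u := by
  set c := lam i with hc
  let F := c⁻¹ • (Out P * Inn P)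
  have hF : F * F = F := by
    simp only [F]
    rw [Matrix.smul_mul, Matrix.mul_smul, Matrix.mul_assoc, ← Matrix.mul_assoc (Inn P), hP.io,
      Matrix.smul_mul, Matrix.one_mul, Matrix.mul_smul, ← hc, inv_smul_smul₀ hi]
  have hPF : Pi' dS i * F = F := by
    simp only [F]; rw [Matrix.mul_smul, ← Matrix.mul_assoc, hP.PiOut]
  have hFP : F * Pi' dS i = F := by
    simp only [F]; rw [Matrix.smul_mul, Matrix.mul_assoc, hP.InnPi]
  have hPP : Pi' dS i * Pi' dS i = Pi' dS i := by
    rw [Pi', Matrix.diagonal_mul_diagonal]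
    congr 1; funext u
    rcases u with s | s | s <;> simp only [piw, Sum.elim_inl, Sum.elim_inr] <;> split_ifs <;> simp
  have hE : (Pi' dS i - F) * (Pi' dS i - F) = Pi' dS i - F := by
    rw [Matrix.mul_sub, Matrix.sub_mul, Matrix.sub_mul, hPP, hPF, hFP, hF]; simp
  obtain ⟨k, J, K, hJK, hKJ⟩ := idem_factor hE
  have hPJ : Pi' dS i * J = J := by
    calc Pi' dS i * J = Pi' dS i * (J * K) * J := by
          rw [Matrix.mul_assoc, Matrix.mul_assoc, hKJ, Matrix.mul_one]
      _ = J * K * J := by rw [hJK, Matrix.mul_sub, hPP, hPF]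
      _ = J := by rw [Matrix.mul_assoc, hKJ, Matrix.mul_one]
  have hKP : K * Pi' dS i = K := by
    calc K * Pi' dS i = K * (J * K * Pi' dS i) := by
          rw [← Matrix.mul_assoc, ← Matrix.mul_assoc, hKJ, Matrix.one_mul]
      _ = K * (J * K) := by rw [hJK, Matrix.sub_mul, hPP, hFP]
      _ = K := by rw [← Matrix.mul_assoc, hKJ, Matrix.one_mul]
  have hJw : ∀ u a, J u a ≠ 0 → piw dS i u = 1 := by
    intro u a h
    have := congrFun (congrFun hPJ u) a
    rw [Pi', Matrix.diagonal_mul] at this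
    exact mul_right_cancel₀ h (by rw [this, one_mul])
  have hKw : ∀ u a, K a u ≠ 0 → piw dS i u = 1 := by
    intro u a h
    have := congrFun (congrFun hKP a) u
    rw [Pi', Matrix.mul_diagonal] at this
    exact mul_left_cancel₀ h (by rw [this, mul_one])
  let P' : RD (S ⊕ Fin k) :=
    { X := fromBlocks (P.X.toBlocks₁₁) (Matrix.of fun s a => - J (Sum.inr (Sum.inl s)) a)
        (Matrix.of fun a s => -c * K a (Sum.inl s)) 0
      Y := fromBlocks (P.Y.toBlocks₁₁) (Matrix.of fun s a => J (Sum.inl s) a)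
        (Matrix.of fun a s => -c * K a (Sum.inr (Sum.inl s))) 0
      v := Sum.elim (fun s => P.v (Sum.inl s)) (fun a => -c * K a (Sum.inr (Sum.inr ())))
      w := Sum.elim (fun s => P.w (Sum.inl s)) (fun a => J (Sum.inr (Sum.inr ())) a) }
  have hIn : Inn P' = (-c) • K := by
    ext a u
    rcases u with s | s | s <;> simp [P']
  have hOut : Out P' = J := by
    ext u a
    rcases u with s | s | s <;> simp [P']
  have hR : Refl dS i c P P' := by
    refine ⟨fun s t => rfl, fun s t => rfl, fun s => rfl, fun s => rfl, hP.io, ?_, ?_⟩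
    · rw [hIn, hOut, Matrix.smul_mul, hKJ]
    · rw [hIn, hOut, Matrix.mul_smul, hJK, smul_sub, neg_smul, neg_smul, smul_inv_smul₀ hi]; abel
  have p1 : ∀ s, piw dS i (Sum.inl s) = 1 → dS s = i + 1 := by
    intro s h; by_contra h2; simp [piw, h2] at h
  have p2 : ∀ s, piw dS i (Sum.inr (Sum.inl s)) = 1 → dS s = i - 1 := by
    intro s h; by_contra h2; simp [piw, h2] at h
  have p3 : ∀ s, piw dS i (Sum.inr (Sum.inr s)) = 1 → i = 0 := by
    intro s h; by_contra h2; simp [piw, h2] at h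
  have hX' : Hom (dg (Fin k) dS i) (-1) P'.X := by
    rintro (s | a) (t | b) h
    · exact hP.hX (Sum.inl s) (Sum.inl t) h
    · have := p2 _ (hJw _ _ (neg_ne_zero.mp h))
      simp [dg, this, sub_eq_add_neg]
    · have := p1 _ (hKw _ _ (right_ne_zero_of_mul h))
      simp [dg, this]
    · exact absurd rfl h
  have hY' : Hom (dg (Fin k) dS i) 1 P'.Y := by
    rintro (s | a) (t | b) h
    · exact hP.hY (Sum.inl s) (Sum.inl t) h
    · have := p1 _ (hJw _ _ h)
      simp [dg, this]
    · have := p2 _ (hKw _ _ (right_ne_zero_of_mul h))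
      simp [dg, this]
    · exact absurd rfl h
  have hv' : HomV (dg (Fin k) dS i) 0 P'.v := by
    rintro (s | a) h
    · exact hP.hv (Sum.inl s) h
    · exact p3 () (hKw _ _ (right_ne_zero_of_mul h))
  have hw' : HomV (dg (Fin k) dS i) 0 P'.w := by
    rintro (s | a) h
    · exact hP.hw (Sum.inl s) h
    · exact p3 () (hJw _ _ h)
  refine ⟨k, P', hR, ⟨hX', hY', hv', hw', ?_⟩, ?_⟩
  · -- the relation
    have hdeg : ∀ s t, dg (Fin k) dS i s ≠ dg (Fin k) dS i t →
        (P'.X * P'.Y - P'.Y * P'.X + vecMulVec P'.v P'.w) s t = 0 := by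
      intro s t hst
      have h1 : (P'.X * P'.Y) s t = 0 := by
        by_contra h; exact hst (by simpa using (hX'.mul hY') _ _ h)
      have h2 : (P'.Y * P'.X) s t = 0 := by
        by_contra h; exact hst (by simpa using (hY'.mul hX') _ _ h)
      have h3 : vecMulVec P'.v P'.w s t = 0 := by
        by_contra h
        rw [vecMulVec_apply] at h
        exact hst (by rw [hv' _ (left_ne_zero_of_mul h), hw' _ (right_ne_zero_of_mul h)])
      simp [Matrix.add_apply, Matrix.sub_apply, h1, h2, h3]
    ext s t
    rcases s with s | a <;> rcases t with t | b
    · have h1 := congrFun (congrFun hP.rel (Sum.inl s)) (Sum.inl t)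
      have h2 := congrFun (congrFun hR.N (Sum.inl s)) (Sum.inl t)
      have h3 := congrFun (congrFun hR.N (Sum.inr (Sum.inl s))) (Sum.inr (Sum.inl t))
      simp only [Matrix.add_apply, Matrix.sub_apply, Matrix.mul_apply, Fintype.sum_sum_type,
        vecMulVec_apply, Dg, Matrix.smul_apply, Pi', Out_1, Out_2, Inn_1, Inn_2, neg_mul,
        Finset.sum_neg_distrib, hR.X, hR.Y, hR.v, hR.w, smul_eq_mul] at h1 h2 h3 ⊢
      by_cases hst : s = t
      · subst hst
        simp only [Matrix.diagonal_apply_eq, dg, Sum.elim_inl, Sum.elim_inr, piw] at h1 h2 h3 ⊢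
        have hl : lamR lam i (dS s) = lam (dS s) + c * (if dS s = i + 1 then 1 else 0)
          + c * (if dS s = i - 1 then 1 else 0) := by
          simp [lamR, hdS s, hc]
        rw [hl]
        linear_combination h1 - h2 - h3
      · rw [Matrix.diagonal_apply_ne _ (by simpa using hst)] at h1 h2 h3 ⊢
        linear_combination h1 - h2 - h3
    · rw [hdeg _ _ (by simpa [dg] using hdS s)]
      simp [Dg]
    · rw [hdeg _ _ (by simpa [dg] using (hdS t).symm)]
      simp [Dg]
    · have h1 := congrFun (congrFun hR.io' a) b
      have hl : lamR lam i i = - c := by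
        have hne : i ≠ i - 1 := by
          intro h
          exact one_ne_zero (α := ZMod m) (by linear_combination h)
        simp only [lamR, hc, if_neg hne, if_true, left_eq_add, one_ne_zero, if_false]; ring
      simp only [Matrix.add_apply, Matrix.sub_apply, Matrix.mul_apply, Fintype.sum_sum_type,
        AAX hX', AAY hY', vecMulVec_apply, Dg]
      simp only [Matrix.mul_apply, Fintype.sum_sum_type, Inn_1, Inn_2, Inn_3, Out_1, Out_2, Out_3,
        Matrix.smul_apply, Matrix.one_apply, Matrix.diagonal_apply, dg, Sum.elim_inr,
        Finset.univ_unique, Finset.sum_singleton, mul_neg, Finset.sum_neg_distrib, zero_mul,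
        Finset.sum_const_zero, add_zero, smul_eq_mul, mul_ite, mul_one, mul_zero,
        Sum.inr.injEq, hl] at h1 ⊢
      rw [← h1]; ring
  · -- the trace
    have h1 : (J * K).trace = k := by
      rw [Matrix.trace_mul_comm, hKJ]; simp
    have h2 : F.trace = Fintype.card A := by
      simp only [F]
      rw [Matrix.trace_smul, Matrix.trace_mul_comm, hP.io, Matrix.trace_smul, ← hc,
        inv_smul_smul₀ hi]; simp
    rw [hJK, Matrix.trace_sub, h2, Pi', Matrix.trace_diagonal] at h1
    rw [← h1]; ring

end refl
end Tot

namespace Tot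
section lift
variable {m : ℕ} {S A A' : Type} [Fintype S] [DecidableEq S] [Fintype A] [DecidableEq A]
  [Fintype A'] [DecidableEq A']

lemma Refl.conj {dS : S → ZMod m} {i : ZMod m} {c : ℂ} {P Q : RD (S ⊕ A)} {P' Q' : RD (S ⊕ A')}
    (h : Refl dS i c P P') {B C : Matrix (UU S) (UU S) ℂ} {g h' : Matrix A A ℂ}
    (hI : Inn Q = g * Inn P * B) (hO : Out Q = C * Out P * h')
    (hI' : Inn Q' = Inn P' * B) (hO' : Out Q' = C * Out P')
    (hgh : g * h' = 1) (hBC : B * C = 1) (hPi : C * Pi' dS i * B = Pi' dS i)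
    (hX : ∀ s t, Q'.X (Sum.inl s) (Sum.inl t) = Q.X (Sum.inl s) (Sum.inl t))
    (hY : ∀ s t, Q'.Y (Sum.inl s) (Sum.inl t) = Q.Y (Sum.inl s) (Sum.inl t))
    (hv : ∀ s, Q'.v (Sum.inl s) = Q.v (Sum.inl s))
    (hw : ∀ s, Q'.w (Sum.inl s) = Q.w (Sum.inl s)) : Refl dS i c Q Q' := by
  have hhg : h' * g = 1 := mul_eq_one_comm.mp hgh
  refine ⟨hX, hY, hv, hw, ?_, ?_, ?_⟩
  · rw [hI, hO]
    calc g * Inn P * B * (C * Out P * h') = g * (Inn P * (B * C) * Out P) * h' := by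
          simp only [Matrix.mul_assoc]
      _ = _ := by rw [hBC, Matrix.mul_one, h.io, Matrix.mul_smul, Matrix.smul_mul, Matrix.mul_one, hgh]
  · rw [hI', hO']
    calc Inn P' * B * (C * Out P') = Inn P' * (B * C) * Out P' := by
          simp only [Matrix.mul_assoc]
      _ = _ := by rw [hBC, Matrix.mul_one, h.io']
  · rw [hI', hO', hI, hO]
    calc C * Out P' * (Inn P' * B) = C * (Out P' * Inn P') * B := by
          simp only [Matrix.mul_assoc]
      _ = C * (Out P * Inn P) * B - c • (C * Pi' dS i * B) := by
          rw [h.N, Matrix.mul_sub, Matrix.sub_mul, Matrix.mul_smul, Matrix.smul_mul]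
      _ = C * (Out P * (h' * g) * Inn P) * B - c • Pi' dS i := by rw [hPi, hhg, Matrix.mul_one]
      _ = _ := by simp only [Matrix.mul_assoc]

def Zd (π : Matrix S S ℂ) : Matrix (UU S) (UU S) ℂ := Matrix.of fun u u' =>
  Sum.elim (fun _ => 0) (Sum.elim (fun s => Sum.elim (fun t => π s t) (fun _ => 0) u')
    (fun _ => 0)) u

def Zu (π : Matrix S S ℂ) : Matrix (UU S) (UU S) ℂ := Matrix.of fun u u' =>
  Sum.elim (fun s => Sum.elim (fun _ => 0) (Sum.elim (fun t => π s t) (fun _ => 0)) u')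
    (fun _ => 0) u

lemma Zd_sq (π : Matrix S S ℂ) : Zd π * Zd π = 0 := by
  ext u u'
  rcases u with s | s | s <;> rcases u' with t | t | t <;>
    simp [Zd, Matrix.mul_apply, Fintype.sum_sum_type]

lemma Zu_sq (π : Matrix S S ℂ) : Zu π * Zu π = 0 := by
  ext u u'
  rcases u with s | s | s <;> rcases u' with t | t | t <;>
    simp [Zu, Matrix.mul_apply, Fintype.sum_sum_type]

lemma Zd_comm {dS : S → ZMod m} {i : ZMod m} {π : Matrix S S ℂ}
    (h : Hom dS (-2) π) : Zd π * Pi' dS i = Pi' dS i * Zd π := by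
  ext u u'
  rw [Pi', Matrix.mul_diagonal, Matrix.diagonal_mul]
  rcases u with s | s | s <;> rcases u' with t | t | t <;> simp [Zd]
  by_cases h0 : π s t = 0
  · simp [h0]
  have h1 := h _ _ h0
  simp only [piw, Sum.elim_inl, Sum.elim_inr]
  have : dS s = i - 1 ↔ dS t = i + 1 := by
    rw [h1]
    constructor <;> intro h2
    · linear_combination h2
    · linear_combination h2
  simp [this]

lemma Zu_comm {dS : S → ZMod m} {i : ZMod m} {π : Matrix S S ℂ}
    (h : Hom dS 2 π) : Zu π * Pi' dS i = Pi' dS i * Zu π := by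
  ext u u'
  rw [Pi', Matrix.mul_diagonal, Matrix.diagonal_mul]
  rcases u with s | s | s <;> rcases u' with t | t | t <;> simp [Zu]
  by_cases h0 : π s t = 0
  · simp [h0]
  have h1 := h _ _ h0
  simp only [piw, Sum.elim_inl, Sum.elim_inr]
  have : dS s = i + 1 ↔ dS t = i - 1 := by
    rw [h1]
    constructor <;> intro h2
    · linear_combination h2
    · linear_combination h2
  simp [this]

lemma unip {R : Type} [Ring R] {z p : R} (hz : z * z = 0) (hc : z * p = p * z) :
    (1 + z) * (1 - z) = 1 ∧ (1 - z) * p * (1 + z) = p := by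
  constructor
  · have : (1 + z) * (1 - z) = 1 - z * z := by noncomm_ring
    rw [this, hz, sub_zero]
  · have : (1 - z) * p * (1 + z) = p + p * z - z * p - z * p * z := by noncomm_ring
    rw [this, hc, mul_assoc p, hz]; simp

section pow
variable {a : Matrix S S ℂ} {b : Matrix S A ℂ} {c : Matrix A S ℂ}
  {b' : Matrix S A' ℂ} {c' : Matrix A' S ℂ}

lemma fb21 (n : ℕ) : ((fromBlocks a b c 0) ^ (n + 1)).toBlocks₂₁ =
    c * ((fromBlocks a b c 0) ^ n).toBlocks₁₁ := by
  rw [pow_succ']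
  conv_lhs => rw [← fromBlocks_toBlocks ((fromBlocks a b c 0) ^ n), fromBlocks_multiply]
  simp

lemma fb11 (n : ℕ) : ((fromBlocks a b c 0) ^ (n + 1)).toBlocks₁₁ =
    a * ((fromBlocks a b c 0) ^ n).toBlocks₁₁ + b * ((fromBlocks a b c 0) ^ n).toBlocks₂₁ := by
  rw [pow_succ']
  conv_lhs => rw [← fromBlocks_toBlocks ((fromBlocks a b c 0) ^ n), fromBlocks_multiply]
  simp

lemma fb12 (n : ℕ) : ((fromBlocks a b c 0) ^ (n + 1)).toBlocks₁₂ =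
    ((fromBlocks a b c 0) ^ n).toBlocks₁₁ * b := by
  rw [pow_succ]
  conv_lhs => rw [← fromBlocks_toBlocks ((fromBlocks a b c 0) ^ n), fromBlocks_multiply]
  simp

lemma fb_eq (h : b * c = b' * c') (n : ℕ) : ((fromBlocks a b c 0) ^ n).toBlocks₁₁ =
    ((fromBlocks a b' c' 0) ^ n).toBlocks₁₁ := by
  induction n using Nat.strong_induction_on with
  | _ n ih =>
    match n with
    | 0 =>
      ext s t
      by_cases hst : s = t
      · simp [toBlocks₁₁, hst]
      · simp [toBlocks₁₁, Matrix.one_apply, hst]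
    | 1 => simp
    | n + 2 =>
      rw [fb11 (n + 1), fb11 (b := b') (c := c') (n + 1), fb21, fb21, ih _ (by omega), ih n (by omega), ← Matrix.mul_assoc,
        ← Matrix.mul_assoc, h]
end pow

lemma eq_fb {M : Matrix (S ⊕ A) (S ⊕ A) ℂ} (h : ∀ a b, M (Sum.inr a) (Sum.inr b) = 0) :
    M = fromBlocks M.toBlocks₁₁ M.toBlocks₁₂ M.toBlocks₂₁ 0 := by
  have : M.toBlocks₂₂ = 0 := by ext a b; exact h a b
  rw [← this, fromBlocks_toBlocks]

lemma ssq {Y : Matrix (S ⊕ A) (S ⊕ A) ℂ} {Y' : Matrix (S ⊕ A') (S ⊕ A') ℂ}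
    (h : ∀ a b, Y (Sum.inr a) (Sum.inr b) = 0) (h' : ∀ a b, Y' (Sum.inr a) (Sum.inr b) = 0)
    (hs : ∀ s t, Y' (Sum.inl s) (Sum.inl t) = Y (Sum.inl s) (Sum.inl t))
    (hN : ∀ s t, ∑ a, Y' (Sum.inl s) (Sum.inr a) * Y' (Sum.inr a) (Sum.inl t) =
      ∑ a, Y (Sum.inl s) (Sum.inr a) * Y (Sum.inr a) (Sum.inl t)) (n : ℕ) :
    (Y' ^ n).toBlocks₁₁ = (Y ^ n).toBlocks₁₁ := by
  rw [eq_fb h, eq_fb h']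
  have : Y'.toBlocks₁₁ = Y.toBlocks₁₁ := by ext s t; exact hs s t
  rw [this]
  apply fb_eq
  ext s t
  exact hN s t

lemma pow21 {Y : Matrix (S ⊕ A) (S ⊕ A) ℂ} (h : ∀ a b, Y (Sum.inr a) (Sum.inr b) = 0) (n : ℕ) (a : A)
    (t : S) : (Y ^ (n + 1)) (Sum.inr a) (Sum.inl t) =
      ∑ s, Y (Sum.inr a) (Sum.inl s) * (Y ^ n).toBlocks₁₁ s t := by
  have := @fb21 S A _ _ _ _ Y.toBlocks₁₁ Y.toBlocks₁₂ Y.toBlocks₂₁ n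
  rw [← eq_fb h] at this
  have := congrFun (congrFun this a) t
  rw [Matrix.mul_apply] at this
  exact this

lemma pow12 {Y : Matrix (S ⊕ A) (S ⊕ A) ℂ} (h : ∀ a b, Y (Sum.inr a) (Sum.inr b) = 0) (n : ℕ) (a : A)
    (t : S) : (Y ^ (n + 1)) (Sum.inl t) (Sum.inr a) =
      ∑ s, (Y ^ n).toBlocks₁₁ t s * Y (Sum.inl s) (Sum.inr a) := by
  have := @fb12 S A _ _ _ _ Y.toBlocks₁₁ Y.toBlocks₁₂ Y.toBlocks₂₁ n
  rw [← eq_fb h] at this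
  have := congrFun (congrFun this t) a
  rw [Matrix.mul_apply] at this
  exact this

lemma Inn_psi {P : RD (S ⊕ A)} (h : ∀ a b, P.Y (Sum.inr a) (Sum.inr b) = 0) (μ : ℂ) (n : ℕ)
    {π : Matrix S S ℂ} (hπ : (P.Y ^ n).toBlocks₁₁ = π) :
    Inn (⟨P.X + μ • P.Y ^ (n + 1), P.Y, P.v, P.w⟩ : RD (S ⊕ A)) = Inn P * (1 + μ • Zd π) ∧
    Out (⟨P.X + μ • P.Y ^ (n + 1), P.Y, P.v, P.w⟩ : RD (S ⊕ A)) = (1 - μ • Zd π) * Out P := by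
  subst hπ
  rw [Matrix.mul_add, Matrix.mul_one, Matrix.sub_mul, Matrix.one_mul, Matrix.mul_smul,
    Matrix.smul_mul]
  constructor
  · ext a u
    rcases u with s | s | s <;>
      simp [Zd, Matrix.mul_apply, Fintype.sum_sum_type, pow21 h]
  · ext u a
    rcases u with s | s | s <;>
      simp [Zd, Matrix.mul_apply, Fintype.sum_sum_type, pow12 h]
    ring

lemma Inn_phi {P : RD (S ⊕ A)} (h : ∀ a b, P.X (Sum.inr a) (Sum.inr b) = 0) (μ : ℂ) (n : ℕ)
    {π : Matrix S S ℂ} (hπ : (P.X ^ n).toBlocks₁₁ = π) :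
    Inn (⟨P.X, P.Y + μ • P.X ^ (n + 1), P.v, P.w⟩ : RD (S ⊕ A)) = Inn P * (1 + μ • Zu π) ∧
    Out (⟨P.X, P.Y + μ • P.X ^ (n + 1), P.v, P.w⟩ : RD (S ⊕ A)) = (1 - μ • Zu π) * Out P := by
  subst hπ
  rw [Matrix.mul_add, Matrix.mul_one, Matrix.sub_mul, Matrix.one_mul, Matrix.mul_smul,
    Matrix.smul_mul]
  constructor
  · ext a u
    rcases u with s | s | s <;>
      simp [Zu, Matrix.mul_apply, Fintype.sum_sum_type, pow21 h]
  · ext u a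
    rcases u with s | s | s <;>
      simp [Zu, Matrix.mul_apply, Fintype.sum_sum_type, pow12 h]

/-- diagonal action on `UU S` -/
def DD (g : Matrix S S ℂ) : Matrix (UU S) (UU S) ℂ := fromBlocks g 0 0 (fromBlocks g 0 0 1)

lemma DD_mul {g h : Matrix S S ℂ} (hgh : g * h = 1) : DD g * DD h = 1 := by
  simp [DD, fromBlocks_multiply, hgh]

lemma DD_comm {dS : S → ZMod m} {i : ZMod m} {g : Matrix S S ℂ}
    (h : Hom dS 0 g) : DD g * Pi' dS i = Pi' dS i * DD g := by
  ext u u'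
  rw [Pi', Matrix.mul_diagonal, Matrix.diagonal_mul]
  rcases u with s | s | s <;> rcases u' with t | t | t <;> simp [DD, piw] <;>
  · by_cases h0 : g s t = 0
    · simp [h0]
    · have := h _ _ h0
      rw [add_zero] at this
      simp [this]

lemma bc_blocks {g : Matrix (S ⊕ A) (S ⊕ A) ℂ} {dS : S → ZMod m} {i : ZMod m}
    (hdS : ∀ s, dS s ≠ i) (hg : Hom (dg A dS i) 0 g) :
    g = fromBlocks g.toBlocks₁₁ 0 0 g.toBlocks₂₂ := by
  conv_lhs => rw [← fromBlocks_toBlocks g]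
  congr 1
  · ext s a
    by_contra h
    exact hdS s (by simpa [dg] using hg _ _ h)
  · ext a s
    by_contra h
    exact hdS s (by simpa [dg] using (hg _ _ h).symm)

lemma Inn_bc (P : RD (S ⊕ A)) (gs hs : Matrix S S ℂ) (ga ha : Matrix A A ℂ) :
    Inn (⟨fromBlocks gs 0 0 ga * P.X * fromBlocks hs 0 0 ha,
      fromBlocks gs 0 0 ga * P.Y * fromBlocks hs 0 0 ha, fromBlocks gs 0 0 ga *ᵥ P.v,
      P.w ᵥ* fromBlocks hs 0 0 ha⟩ : RD (S ⊕ A)) = ga * Inn P * DD hs ∧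
    Out (⟨fromBlocks gs 0 0 ga * P.X * fromBlocks hs 0 0 ha,
      fromBlocks gs 0 0 ga * P.Y * fromBlocks hs 0 0 ha, fromBlocks gs 0 0 ga *ᵥ P.v,
      P.w ᵥ* fromBlocks hs 0 0 ha⟩ : RD (S ⊕ A)) = DD gs * Out P * ha := by
  constructor
  · ext a u
    rcases u with s | s | s <;>
      simp [DD, Matrix.mul_apply, Fintype.sum_sum_type, Matrix.mulVec, dotProduct]
  · ext u a
    rcases u with s | s | s <;>
      simp [DD, Matrix.mul_apply, Fintype.sum_sum_type, Matrix.vecMul, dotProduct]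

lemma ss_bc (M : Matrix (S ⊕ A) (S ⊕ A) ℂ) (gs hs : Matrix S S ℂ) (ga ha : Matrix A A ℂ) (s t : S) :
    (fromBlocks gs 0 0 ga * M * fromBlocks hs 0 0 ha) (Sum.inl s) (Sum.inl t) =
    ∑ x, (∑ y, gs s y * M (Sum.inl y) (Sum.inl x)) * hs x t := by
  simp [Matrix.mul_apply, Fintype.sum_sum_type]

lemma lift_mv [Fact (1 < m)] [NeZero m] {dS : S → ZMod m} {i : ZMod m} (hdS : ∀ s, dS s ≠ i) {c : ℂ}
    {lam lam' : ZMod m → ℂ} {P Q : RD (S ⊕ A)} {P' : RD (S ⊕ A')}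
    (hP : IsR (dg A dS i) lam P) (hP' : IsR (dg A' dS i) lam' P')
    (hR : Refl dS i c P P') (hM : Mv (dg A dS i) P Q) :
    ∃ Q', Mv (dg A' dS i) P' Q' ∧ Refl dS i c Q Q' := by
  have hm : 1 < m := Fact.out
  rcases hM with ⟨k, μ, hk, rfl⟩ | ⟨k, μ, hk, rfl⟩ | ⟨g, h, hgh, hg, hh, rfl⟩
  · refine ⟨_, Or.inl ⟨k, μ, hk, rfl⟩, ?_⟩
    have hN : ∀ s t, ∑ a, P'.Y (Sum.inl s) (Sum.inr a) * P'.Y (Sum.inr a) (Sum.inl t) =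
      ∑ a, P.Y (Sum.inl s) (Sum.inr a) * P.Y (Sum.inr a) (Sum.inl t) := by
      intro s t
      have := congrFun (congrFun hR.N (Sum.inl s)) (Sum.inr (Sum.inl t))
      simpa [Matrix.mul_apply, Pi'] using this
    have hss := ssq (AAY hP.hY) (AAY hP'.hY) hR.Y hN
    have hmk : 2 ≤ m * k := by nlinarith
    obtain ⟨n, hn⟩ : ∃ n, m * k - 1 = n + 1 := ⟨m * k - 2, by omega⟩
    have hd : Hom dS (-2) ((P.Y ^ n).toBlocks₁₁) := by
      intro s t hst
      have h1 := (hP.hY.pow n) (Sum.inl s) (Sum.inl t) hst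
      have h2 : ((n + 2 : ℕ) : ZMod m) = 0 := by
        rw [show n + 2 = m * k by omega]; simp
      push_cast at h2
      simp only [dg, Sum.elim_inl] at h1
      linear_combination h1 + h2
    rw [hn]
    obtain ⟨i1, o1⟩ := Inn_psi (AAY hP.hY) μ n rfl
    obtain ⟨i2, o2⟩ := Inn_psi (AAY hP'.hY) μ n (hss n)
    obtain ⟨u1, u2⟩ := unip (z := μ • Zd (P.Y ^ n).toBlocks₁₁) (p := Pi' dS i)
      (by rw [Matrix.smul_mul, Matrix.mul_smul, Zd_sq]; simp)
      (by rw [Matrix.smul_mul, Matrix.mul_smul, Zd_comm hd])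
    refine hR.conj (g := 1) (h' := 1) (by rw [Matrix.one_mul]; exact i1)
      (by rw [Matrix.mul_one]; exact o1) i2 o2 (by simp) u1 u2 ?_ hR.Y hR.v hR.w
    intro s t
    have := congrFun (congrFun (hss (n + 1)) s) t
    simp only [toBlocks₁₁, Matrix.of_apply] at this
    simp [hR.X, this]
  · refine ⟨_, Or.inr (Or.inl ⟨k, μ, hk, rfl⟩), ?_⟩
    have hN : ∀ s t, ∑ a, P'.X (Sum.inl s) (Sum.inr a) * P'.X (Sum.inr a) (Sum.inl t) =
      ∑ a, P.X (Sum.inl s) (Sum.inr a) * P.X (Sum.inr a) (Sum.inl t) := by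
      intro s t
      have := congrFun (congrFun hR.N (Sum.inr (Sum.inl s))) (Sum.inl t)
      simpa [Matrix.mul_apply, Pi'] using this
    have hss := ssq (AAX hP.hX) (AAX hP'.hX) hR.X hN
    have hmk : 2 ≤ m * k := by nlinarith
    obtain ⟨n, hn⟩ : ∃ n, m * k - 1 = n + 1 := ⟨m * k - 2, by omega⟩
    have hd : Hom dS 2 ((P.X ^ n).toBlocks₁₁) := by
      intro s t hst
      have h1 := (hP.hX.pow n) (Sum.inl s) (Sum.inl t) hst
      have h2 : ((n + 2 : ℕ) : ZMod m) = 0 := by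
        rw [show n + 2 = m * k by omega]; simp
      push_cast at h2
      simp only [dg, Sum.elim_inl] at h1
      linear_combination h1 - h2
    rw [hn]
    obtain ⟨i1, o1⟩ := Inn_phi (AAX hP.hX) μ n rfl
    obtain ⟨i2, o2⟩ := Inn_phi (AAX hP'.hX) μ n (hss n)
    obtain ⟨u1, u2⟩ := unip (z := μ • Zu (P.X ^ n).toBlocks₁₁) (p := Pi' dS i)
      (by rw [Matrix.smul_mul, Matrix.mul_smul, Zu_sq]; simp)
      (by rw [Matrix.smul_mul, Matrix.mul_smul, Zu_comm hd])
    refine hR.conj (g := 1) (h' := 1) (by rw [Matrix.one_mul]; exact i1)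
      (by rw [Matrix.mul_one]; exact o1) i2 o2 (by simp) u1 u2 hR.X ?_ hR.v hR.w
    intro s t
    have := congrFun (congrFun (hss (n + 1)) s) t
    simp only [toBlocks₁₁, Matrix.of_apply] at this
    simp [hR.Y, this]
  · have eg := bc_blocks hdS hg
    have eh := bc_blocks hdS hh
    have dgs : Hom dS 0 g.toBlocks₁₁ := fun s t hst => hg (Sum.inl s) (Sum.inl t) hst
    have dhs : Hom dS 0 h.toBlocks₁₁ := fun s t hst => hh (Sum.inl s) (Sum.inl t) hst
    generalize g.toBlocks₁₁ = gs at *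
    generalize g.toBlocks₂₂ = ga at *
    generalize h.toBlocks₁₁ = hs at *
    generalize h.toBlocks₂₂ = ha at *
    subst eg eh
    rw [fromBlocks_multiply] at hgh
    simp only [Matrix.mul_zero, Matrix.zero_mul, add_zero, zero_add] at hgh
    rw [← fromBlocks_one, fromBlocks_inj] at hgh
    obtain ⟨h1, -, -, h2⟩ := hgh
    refine ⟨_, Or.inr (Or.inr ⟨fromBlocks gs 0 0 1, fromBlocks hs 0 0 1, ?_, ?_, ?_, rfl⟩), ?_⟩
    · simp [fromBlocks_multiply, h1]
    · rintro (s | a) (t | b) hst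
      · exact dgs s t hst
      · exact absurd rfl hst
      · exact absurd rfl hst
      · simp [dg]
    · rintro (s | a) (t | b) hst
      · exact dhs s t hst
      · exact absurd rfl hst
      · exact absurd rfl hst
      · simp [dg]
    · obtain ⟨i1, o1⟩ := Inn_bc P gs hs ga ha
      obtain ⟨i2, o2⟩ := Inn_bc P' gs hs 1 1
      rw [Matrix.one_mul] at i2
      rw [Matrix.mul_one] at o2
      refine hR.conj i1 o1 i2 o2 h2 (DD_mul (mul_eq_one_comm.mp h1)) ?_ ?_ ?_ ?_ ?_
      · rw [DD_comm dgs, Matrix.mul_assoc, DD_mul h1, Matrix.mul_one]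
      · intro s t; simp only [ss_bc, hR.X]
      · intro s t; simp only [ss_bc, hR.Y]
      · intro s; simp [Matrix.mulVec, dotProduct, Fintype.sum_sum_type, hR.v]
      · intro s; simp [Matrix.vecMul, dotProduct, Fintype.sum_sum_type, hR.w]

lemma lift_orb [Fact (1 < m)] [NeZero m] {dS : S → ZMod m} {i : ZMod m} (hdS : ∀ s, dS s ≠ i) {c : ℂ}
    {lam lam' : ZMod m → ℂ} {P Q : RD (S ⊕ A)} {P' : RD (S ⊕ A')}
    (hP : IsR (dg A dS i) lam P) (hP' : IsR (dg A' dS i) lam' P')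
    (hR : Refl dS i c P P') (hM : Orb (dg A dS i) P Q) :
    ∃ Q', Orb (dg A' dS i) P' Q' ∧ Refl dS i c Q Q' := by
  induction hM with
  | refl => exact ⟨P', .refl, hR⟩
  | tail h1 h2 ih =>
    obtain ⟨Q1, o, r⟩ := ih
    obtain ⟨Q2, o2, r2⟩ := lift_mv hdS (Orb.isR hP h1) (Orb.isR hP' o) r h2
    exact ⟨Q2, o.tail o2, r2⟩

lemma refl_unique [Fact (1 < m)] {dS : S → ZMod m} {i : ZMod m} {c : ℂ} (hc : c ≠ 0)
    {lam : ZMod m → ℂ} {P Q : RD (S ⊕ A)} {P' : RD (S ⊕ A')}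
    (hP : IsR (dg A dS i) lam P) (hQ : IsR (dg A dS i) lam Q)
    (h1 : Refl dS i c P P') (h2 : Refl dS i c Q P') : Orb (dg A dS i) P Q := by
  have hN : Out P * Inn P = Out Q * Inn Q := by
    have := h1.N.symm.trans h2.N
    exact sub_left_injective this
  let g := c⁻¹ • (Inn Q * Out P)
  let h := c⁻¹ • (Inn P * Out Q)
  have hgI : g * Inn P = Inn Q := by
    simp only [g]
    rw [Matrix.smul_mul, Matrix.mul_assoc, hN, ← Matrix.mul_assoc, h2.io, Matrix.smul_mul,
      Matrix.one_mul, inv_smul_smul₀ hc]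
  have hOh : Out P * h = Out Q := by
    simp only [h]
    rw [Matrix.mul_smul, ← Matrix.mul_assoc, hN, Matrix.mul_assoc, h2.io, Matrix.mul_smul,
      Matrix.mul_one, inv_smul_smul₀ hc]
  have hgh : g * h = 1 := by
    simp only [h]
    rw [Matrix.mul_smul, ← Matrix.mul_assoc, hgI, h2.io, inv_smul_smul₀ hc]
  clear_value g h
  refine .single (Or.inr (Or.inr ⟨fromBlocks 1 0 0 g, fromBlocks 1 0 0 h, ?_, ?_, ?_, ?_⟩))
  · simp [fromBlocks_multiply, hgh]
  · rintro (s | a) (t | b) hst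
    · exact Hom.one (deg := dS) s t hst
    · exact absurd rfl hst
    · exact absurd rfl hst
    · simp [dg]
  · rintro (s | a) (t | b) hst
    · exact Hom.one (deg := dS) s t hst
    · exact absurd rfl hst
    · exact absurd rfl hst
    · simp [dg]
  · have eI : ∀ a u, Inn Q a u = ∑ b, g a b * Inn P b u := by
      intro a u; rw [← hgI, Matrix.mul_apply]
    have eO : ∀ a u, Out Q u a = ∑ b, Out P u b * h b a := by
      intro a u; rw [← hOh, Matrix.mul_apply]
    obtain ⟨QX, QY, Qv, Qw⟩ := Q
    congr 1
    · ext (s | a) (t | b)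
      · simp [Matrix.mul_apply, Fintype.sum_sum_type, Matrix.one_apply, ← h1.X]
        exact (h2.X s t).symm
      · have := eO b (Sum.inr (Sum.inl s))
        simp only [Out_2] at this
        simp [Matrix.mul_apply, Fintype.sum_sum_type, Matrix.one_apply]
        simpa using this
      · have := eI a (Sum.inl t)
        simpa [Matrix.mul_apply, Fintype.sum_sum_type, Matrix.one_apply] using this
      · have := AAX hQ.hX a b
        simp only at this
        rw [this]
        simp [Matrix.mul_apply, Fintype.sum_sum_type, Matrix.one_apply, AAX hP.hX]
    · ext (s | a) (t | b)
      · simp [Matrix.mul_apply, Fintype.sum_sum_type, Matrix.one_apply, ← h1.Y]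
        exact (h2.Y s t).symm
      · have := eO b (Sum.inl s)
        simpa [Matrix.mul_apply, Fintype.sum_sum_type, Matrix.one_apply] using this
      · have := eI a (Sum.inr (Sum.inl t))
        simpa [Matrix.mul_apply, Fintype.sum_sum_type, Matrix.one_apply] using this
      · have := AAY hQ.hY a b
        simp only at this
        rw [this]
        simp [Matrix.mul_apply, Fintype.sum_sum_type, Matrix.one_apply, AAY hP.hY]
    · ext (s | a)
      · simp [Matrix.mulVec, dotProduct, Fintype.sum_sum_type, Matrix.one_apply, ← h1.v]
        exact (h2.v s).symm
      · have := eI a (Sum.inr (Sum.inr ()))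
        simpa [Matrix.mulVec, dotProduct, Fintype.sum_sum_type, Matrix.one_apply] using this
    · ext (s | a)
      · simp [Matrix.vecMul, dotProduct, Fintype.sum_sum_type, Matrix.one_apply, ← h1.w]
        exact (h2.w s).symm
      · have := eO a (Sum.inr (Sum.inr ()))
        simpa [Matrix.vecMul, dotProduct, Fintype.sum_sum_type, Matrix.one_apply] using this

end lift
end Tot

namespace Tot
section main
variable {m : ℕ} {T T' : Type} [Fintype T] [DecidableEq T] [Fintype T'] [DecidableEq T']

def RD.re (e : T' ≃ T) (P : RD T) : RD T' :=
  ⟨P.X.submatrix e e, P.Y.submatrix e e, P.v ∘ e, P.w ∘ e⟩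

lemma re_re (e : T' ≃ T) (P : RD T) : (P.re e).re e.symm = P := by
  cases P
  simp only [RD.re, Matrix.submatrix_submatrix, Equiv.self_comp_symm, Matrix.submatrix_id_id,
    Function.comp_assoc, Function.comp_id]

lemma sub_pow (e : T' ≃ T) (M : Matrix T T ℂ) (k : ℕ) :
    (M ^ k).submatrix e e = (M.submatrix e e) ^ k := by
  induction k with
  | zero => simp
  | succ k ih => rw [pow_succ, pow_succ, ← ih, Matrix.submatrix_mul_equiv]

lemma IsR.re {deg : T → ZMod m} {lam : ZMod m → ℂ} {P : RD T} (h : IsR deg lam P) (e : T' ≃ T) :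
    IsR (deg ∘ e) lam (P.re e) where
  hX s t hst := h.hX _ _ hst
  hY s t hst := h.hY _ _ hst
  hv s hs := h.hv _ hs
  hw s hs := h.hw _ hs
  rel := by
    have := congrArg (fun M => M.submatrix e e) h.rel
    simp only [Matrix.submatrix_add, Matrix.submatrix_sub, Pi.add_apply, Pi.sub_apply, Dg,
      Matrix.submatrix_diagonal_equiv] at this
    simp only [RD.re, Matrix.submatrix_mul_equiv]
    exact this

lemma Mv.re {deg : T → ZMod m} {P Q : RD T} (h : Mv deg P Q) (e : T' ≃ T) :
    Mv (deg ∘ e) (P.re e) (Q.re e) := by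
  rcases h with ⟨k, μ, hk, rfl⟩ | ⟨k, μ, hk, rfl⟩ | ⟨g, h, hgh, hg, hh, rfl⟩
  · refine Or.inl ⟨k, μ, hk, ?_⟩
    simp [RD.re, ← sub_pow, Matrix.submatrix_add, Matrix.submatrix_smul]
  · refine Or.inr (Or.inl ⟨k, μ, hk, ?_⟩)
    simp [RD.re, ← sub_pow, Matrix.submatrix_add, Matrix.submatrix_smul]
  · refine Or.inr (Or.inr ⟨g.submatrix e e, h.submatrix e e, ?_, fun s t => hg _ _,
      fun s t => hh _ _, ?_⟩)
    · rw [Matrix.submatrix_mul_equiv, hgh]; simp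
    · simp only [RD.re, Matrix.submatrix_mul_equiv]
      congr 1
      · funext s
        simp only [Matrix.mulVec, dotProduct, Function.comp, Matrix.submatrix_apply]
        exact (e.sum_comp (fun t => g (e s) t * P.v t)).symm
      · funext s
        simp only [Matrix.vecMul, dotProduct, Function.comp, Matrix.submatrix_apply]
        exact (e.sum_comp (fun t => P.w t * h t (e s))).symm

lemma Orb.re {deg : T → ZMod m} {P Q : RD T} (h : Orb deg P Q) (e : T' ≃ T) :
    Orb (deg ∘ e) (P.re e) (Q.re e) := by
  induction h with
  | refl => exact .refl
  | tail _ h ih => exact ih.tail (h.re e)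

lemma Orb.of_re {deg : T → ZMod m} {P Q : RD T} (e : T' ≃ T)
    (h : Orb (deg ∘ e) (P.re e) (Q.re e)) : Orb deg P Q := by
  have := h.re e.symm
  rw [re_re, re_re] at this
  have hd : (deg ∘ e) ∘ e.symm = deg := by ext; simp
  rwa [hd] at this

/-- the combinatorial lemma -/
lemma exists_big [NeZero m] (a : ZMod m → ℕ)
    (h : ∀ i, 2 * a i ≤ a (i - 1) + a (i + 1) + (if i = 0 then 1 else 0)) :
    ∃ n, ∀ r, a r = n := by
  obtain ⟨i0, hmax⟩ := Finite.exists_max a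
  refine ⟨a i0, ?_⟩
  generalize hM : a i0 = M at *
  by_cases hm : m = 1
  · subst hm
    intro r; rw [← hM]; congr 1; exact Subsingleton.elim _ _
  have hm2 : 2 ≤ m := by have := NeZero.ne m; omega
  -- a nonzero index attaining the max
  have hk : ∃ k : ℕ, 1 ≤ k ∧ k < m ∧ a (k : ZMod m) = M := by
    by_cases h0 : i0 = 0
    · have h1 := h 0
      rw [h0] at hM
      have h2 := hmax (0 - 1)
      have h3 := hmax (0 + 1)
      simp only [if_true] at h1
      rcases Nat.lt_or_ge (a (0 + 1)) M with h4 | h4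
      · refine ⟨m - 1, by omega, by omega, ?_⟩
        rw [Nat.cast_sub (by omega)]
        simp only [CharP.cast_eq_zero, Nat.cast_one]
        omega
      · refine ⟨1, le_refl _, by omega, ?_⟩
        simp only [zero_add, Nat.cast_one] at *
        omega
    · refine ⟨i0.val, ?_, ZMod.val_lt _, ?_⟩
      · have : i0.val ≠ 0 := by rwa [Ne, ZMod.val_eq_zero]
        omega
      · rw [ZMod.natCast_zmod_val]; exact hM
  have hstep : ∀ k : ℕ, 1 ≤ k → k < m → a (k : ZMod m) = M →
      a ((k - 1 : ℕ) : ZMod m) = M ∧ a ((k + 1 : ℕ) : ZMod m) = M := by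
    intro k h1 h2 h3
    have hne : (k : ZMod m) ≠ 0 := by
      rw [Ne, ZMod.natCast_eq_zero_iff]
      exact Nat.not_dvd_of_pos_of_lt h1 h2
    have h4 := h k
    rw [if_neg hne, h3] at h4
    have h5 := hmax ((k : ZMod m) - 1)
    have h6 := hmax ((k : ZMod m) + 1)
    rw [Nat.cast_sub h1]; push_cast
    constructor <;> omega
  obtain ⟨k, hk1, hk2, hk3⟩ := hk
  have hup : ∀ j, k + j < m → a ((k + j : ℕ) : ZMod m) = M := by
    intro j
    induction j with
    | zero => intro _; exact hk3
    | succ j ih => intro hj; exact (hstep (k + j) (by omega) (by omega) (ih (by omega))).2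
  have hdown : ∀ j, j ≤ k → a ((k - j : ℕ) : ZMod m) = M := by
    intro j
    induction j with
    | zero => intro _; exact hk3
    | succ j ih =>
      intro hj
      have := (hstep (k - j) (by omega) (by omega) (ih (by omega))).1
      rwa [show k - (j + 1) = k - j - 1 by omega]
  intro r
  rw [← ZMod.natCast_zmod_val r]
  have hr := ZMod.val_lt r
  rcases Nat.lt_or_ge r.val k with h1 | h1
  · have := hdown (k - r.val) (by omega)
    rwa [show k - (k - r.val) = r.val by omega] at this
  · have := hup (r.val - k) (by omega)
    rwa [show k + (r.val - k) = r.val by omega] at this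

lemma sum_piw [NeZero m] (hm : 1 < m) (deg : T → ZMod m) (i : ZMod m) :
    ∑ u, piw (fun s : {t // deg t ≠ i} => deg s) i u =
      (Fintype.card {t // deg t = i + 1} : ℂ) + Fintype.card {t // deg t = i - 1}
      + (if i = 0 then 1 else 0) := by
  haveI : Fact (1 < m) := ⟨hm⟩
  have key : ∀ j, j ≠ i → ∑ s : {t // deg t ≠ i}, (if deg s = j then (1 : ℂ) else 0) =
      Fintype.card {t // deg t = j} := by
    intro j hj
    have h1 : ∑ t, (if deg t = j then (1 : ℂ) else 0) = Fintype.card {t // deg t = j} := by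
      rw [Finset.sum_boole, Fintype.card_subtype]
    rw [← h1, ← (Equiv.sumCompl (fun t => deg t ≠ i)).sum_comp, Fintype.sum_sum_type]
    refine (add_eq_left.mpr ?_).symm
    apply Finset.sum_eq_zero
    rintro ⟨t, ht⟩ _
    rw [if_neg]
    intro h; apply ht; exact fun h' => hj (h.symm.trans h')
  simp only [Fintype.sum_sum_type, piw, Sum.elim_inl, Sum.elim_inr]
  rw [key _ (by simp), key (i - 1) (by intro h; exact one_ne_zero (α := ZMod m) (by linear_combination -h))]
  simp only [Finset.univ_unique, Finset.sum_singleton]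
  ring

theorem main_tot [NeZero m] (N : ℕ) : ∀ (T : Type) [Fintype T] [DecidableEq T] (deg : T → ZMod m)
    (lam : ZMod m → ℂ) (hg : Gen lam) (P Q : RD T) (hP : IsR deg lam P) (hQ : IsR deg lam Q),
    Fintype.card T = N → Orb deg P Q := by
  induction N using Nat.strong_induction_on with
  | _ N ih =>
  intro T _ _ deg lam hg P Q hP hQ hN
  let a : ZMod m → ℕ := fun r => Fintype.card {t // deg t = r}
  by_cases hcon : ∃ n, ∀ r, a r = n
  · obtain ⟨n, hn⟩ := hcon
    exact const_case hg hn hP hQ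
  have hm1 : m ≠ 1 := by
    rintro rfl
    exact hcon ⟨a 0, fun r => by congr 1; exact Subsingleton.elim _ _⟩
  have hm : 1 < m := by have := NeZero.ne m; omega
  haveI : Fact (1 < m) := ⟨hm⟩
  have : ∃ i, a (i - 1) + a (i + 1) + (if i = 0 then 1 else 0) < 2 * a i := by
    by_contra hno
    push Not at hno
    exact hcon (exists_big a hno)
  obtain ⟨i, hi⟩ := this
  have hli : lam i ≠ 0 := by
    have := hg.ne i (k := 1) (by norm_num)
    simpa using this
  let S := {t // deg t ≠ i}
  let A := {t // ¬ deg t ≠ i}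
  let dS : S → ZMod m := fun s => deg s
  have hdS : ∀ s, dS s ≠ i := fun s => s.2
  let e : S ⊕ A ≃ T := Equiv.sumCompl (fun t => deg t ≠ i)
  have hde : deg ∘ e = dg A dS i := by
    funext u
    rcases u with s | s
    · rfl
    · have := s.2
      simp only [not_not] at this
      exact this
  have hPe := hP.re e
  have hQe := hQ.re e
  rw [hde] at hPe hQe
  obtain ⟨k, P', rP, hP', kP⟩ := exists_refl hdS hli hPe
  obtain ⟨k', Q', rQ, hQ', kQ⟩ := exists_refl hdS hli hQe
  have hkk : k = k' := by
    have := kP.trans kQ.symm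
    have := add_right_cancel this
    exact_mod_cast this
  subst hkk
  have hcA : Fintype.card A = a i := by
    apply Fintype.card_congr
    exact Equiv.subtypeEquivRight (by simp)
  have hk : k < Fintype.card A := by
    rw [sum_piw hm deg i] at kP
    have h2 : k + Fintype.card A = a (i + 1) + a (i - 1) + (if i = 0 then 1 else 0) := by
      have : ((k + Fintype.card A : ℕ) : ℂ) = ((a (i + 1) + a (i - 1) + (if i = 0 then 1 else 0) : ℕ) : ℂ) := by
        push_cast
        exact kP
      exact_mod_cast this
    omega
  have hcT : Fintype.card S + Fintype.card A = N := by
    rw [← hN, ← Fintype.card_sum]; exact Fintype.card_congr e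
  have ho : Orb (dg (Fin k) dS i) P' Q' := by
    apply ih (Fintype.card (S ⊕ Fin k)) _ (S ⊕ Fin k) (dg (Fin k) dS i) (lamR lam i) (hg.refl i) P' Q'
      hP' hQ' rfl
    rw [Fintype.card_sum, Fintype.card_fin]; omega
  obtain ⟨P1, o1, r1⟩ := lift_orb hdS hP' hPe rP.symm ho
  have r1' := r1.symm
  rw [neg_neg] at r1'
  have o2 := refl_unique hli (Orb.isR hPe o1) hQe r1' rQ
  apply Orb.of_re e
  rw [hde]
  exact o1.trans o2

end main
end Tot

namespace Tot
section transfer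
variable {p : ℕ} {α : ℕ → ℕ}

/-- total index set -/
abbrev TT (p : ℕ) (α : ℕ → ℕ) : Type := Σ i : Fin (p + 1), Fin (α i)

def dT (p : ℕ) (α : ℕ → ℕ) : TT p α → ZMod (p + 1) := fun t => ((t.1 : ℕ) : ZMod (p + 1))

/-- inclusion of the fibre over `k ≤ p + 1` -/
def inc (h0 : α (p + 1) = α 0) (k : ℕ) (hk : k ≤ p + 1) : Fin (α k) → TT p α := fun a =>
  if h : k < p + 1 then ⟨⟨k, h⟩, a⟩
  else ⟨⟨0, Nat.succ_pos p⟩, Fin.cast (by rw [show k = p + 1 by omega]; exact h0) a⟩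

variable (h0 : α (p + 1) = α 0)

lemma inc_lt {k : ℕ} (hk : k < p + 1) (a : Fin (α k)) : inc h0 k hk.le a = ⟨⟨k, hk⟩, a⟩ := by
  simp [inc, hk]

lemma inc_top {k : ℕ} (hk : k = p + 1) (h : α k = α 0) (a : Fin (α k)) :
    inc h0 k hk.le a = inc h0 0 (Nat.zero_le _) (Fin.cast h a) := by
  subst hk
  simp [inc]

lemma dT_inc {k : ℕ} (hk : k ≤ p + 1) (a : Fin (α k)) : dT p α (inc h0 k hk a) = (k : ZMod (p + 1)) := by
  rcases Nat.lt_or_ge k (p + 1) with h | h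
  · rw [inc_lt h0 h]; rfl
  · obtain rfl : k = p + 1 := by omega
    rw [inc_top h0 rfl h0, inc_lt h0 (Nat.succ_pos p)]
    simp [dT]

lemma inc_inj {k : ℕ} (hk : k ≤ p + 1) : Function.Injective (inc h0 k hk) := by
  intro a b hab
  rcases Nat.lt_or_ge k (p + 1) with h | h
  · rw [inc_lt h0 h, inc_lt h0 h] at hab
    simpa using hab
  · obtain rfl : k = p + 1 := by omega
    rw [inc_top h0 rfl h0, inc_top h0 rfl h0, inc_lt h0 (Nat.succ_pos p), inc_lt h0 (Nat.succ_pos p)] at hab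
    have h2 := eq_of_heq (Sigma.mk.inj_iff.mp hab).2
    exact Fin.ext (by simpa using congrArg Fin.val h2)

lemma sum_lt {k : ℕ} (hk : k < p + 1) (f : TT p α → ℂ)
    (hf : ∀ t, f t ≠ 0 → dT p α t = (k : ZMod (p + 1))) :
    ∑ t, f t = ∑ a, f (inc h0 k hk.le a) := by
  rw [Fintype.sum_sigma, Finset.sum_eq_single (⟨k, hk⟩ : Fin (p + 1))]
  · refine Finset.sum_congr rfl fun a _ => ?_
    rw [inc_lt h0 hk]
  · intro j _ hj
    refine Finset.sum_eq_zero fun a _ => ?_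
    by_contra h
    have h1 := hf _ h
    simp only [dT] at h1
    rw [ZMod.natCast_eq_natCast_iff'] at h1
    rw [Nat.mod_eq_of_lt j.2, Nat.mod_eq_of_lt hk] at h1
    exact hj (Fin.ext h1)
  · simp

lemma sum_fib {k : ℕ} (hk : k ≤ p + 1) (f : TT p α → ℂ)
    (hf : ∀ t, f t ≠ 0 → dT p α t = (k : ZMod (p + 1))) :
    ∑ t, f t = ∑ a, f (inc h0 k hk a) := by
  rcases Nat.lt_or_ge k (p + 1) with h | h
  · exact sum_lt h0 h f hf
  · obtain rfl : k = p + 1 := by omega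
    rw [sum_lt h0 (Nat.succ_pos p) f (fun t ht => by rw [hf t ht]; simp)]
    rw [← (finCongr h0).sum_comp]
    refine Finset.sum_congr rfl fun a _ => ?_
    rw [inc_top h0 rfl h0]; rfl

def Rr {k l : ℕ} (hk : k ≤ p + 1) (hl : l ≤ p + 1) (M : Matrix (TT p α) (TT p α) ℂ) :
    Matrix (Fin (α k)) (Fin (α l)) ℂ := M.submatrix (inc h0 k hk) (inc h0 l hl)

variable {h0}

lemma Rr_mul {j k l : ℕ} {hj : j ≤ p + 1} {hk : k ≤ p + 1} {hl : l ≤ p + 1}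
    {M N : Matrix (TT p α) (TT p α) ℂ} {c : ZMod (p + 1)}
    (hN : Hom (dT p α) c N) (hc : (k : ZMod (p + 1)) = l + c) :
    Rr h0 hj hl (M * N) = Rr h0 hj hk M * Rr h0 hk hl N := by
  ext a b
  simp only [Rr, Matrix.submatrix_apply, Matrix.mul_apply]
  apply sum_fib h0 hk
  intro t ht
  have := hN _ _ (right_ne_zero_of_mul ht)
  rw [this, dT_inc, hc]

lemma Rr_one {k : ℕ} {hk : k ≤ p + 1} : Rr h0 hk hk 1 = 1 := by
  ext a b
  simp [Rr, Matrix.one_apply, (inc_inj h0 hk).eq_iff]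

lemma Rr_ext {M N : Matrix (TT p α) (TT p α) ℂ} (hM : Hom (dT p α) 0 M) (hN : Hom (dT p α) 0 N)
    (h : ∀ k (hk : k < p + 1), Rr h0 hk.le hk.le M = Rr h0 hk.le hk.le N) : M = N := by
  ext ⟨⟨k, hk⟩, a⟩ ⟨⟨l, hl⟩, b⟩
  by_cases hkl : k = l
  · subst hkl
    have := congrFun (congrFun (h k hk) a) b
    simpa [Rr, inc_lt h0 hk] using this
  · have hne : dT p α ⟨⟨k, hk⟩, a⟩ ≠ dT p α ⟨⟨l, hl⟩, b⟩ + 0 := by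
      simp only [dT, add_zero]
      rw [Ne, ZMod.natCast_eq_natCast_iff', Nat.mod_eq_of_lt hk, Nat.mod_eq_of_lt hl]
      exact hkl
    have h1 : M ⟨⟨k, hk⟩, a⟩ ⟨⟨l, hl⟩, b⟩ = 0 := by by_contra h; exact hne (hM _ _ h)
    have h2 : N ⟨⟨k, hk⟩, a⟩ ⟨⟨l, hl⟩, b⟩ = 0 := by by_contra h; exact hne (hN _ _ h)
    rw [h1, h2]

variable (h0)

/-- restriction to components -/
def fr (P : RD (TT p α)) : Datum α where
  X := fun i => if h : i ≤ p then Rr h0 (by omega) (by omega) P.X else 0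
  Y := fun i => if h : i ≤ p then Rr h0 (by omega) (by omega) P.Y else 0
  v := fun a => P.v (inc h0 0 (Nat.zero_le _) a)
  w := fun a => P.w (inc h0 0 (Nat.zero_le _) a)

/-- total representation -/
def tot (d : Datum α) : RD (TT p α) where
  X := Matrix.of fun s t => ∑ b, if t = inc h0 (s.1 + 1) (by omega) b then d.X s.1 s.2 b else 0
  Y := Matrix.of fun s t => ∑ b, if s = inc h0 (t.1 + 1) (by omega) b then d.Y t.1 b t.2 else 0
  v := fun s => ∑ a, if s = inc h0 0 (Nat.zero_le _) a then d.v a else 0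
  w := fun s => ∑ a, if s = inc h0 0 (Nat.zero_le _) a then d.w a else 0

lemma tot_RX (d : Datum α) {i : ℕ} (hi : i < p + 1) :
    Rr h0 hi.le hi (tot h0 d).X = d.X i := by
  ext a b
  simp only [Rr, Matrix.submatrix_apply, inc_lt h0 hi, tot, Matrix.of_apply, (inc_inj h0 _).eq_iff]
  simp

lemma tot_RY (d : Datum α) {i : ℕ} (hi : i < p + 1) :
    Rr h0 hi hi.le (tot h0 d).Y = d.Y i := by
  ext a b
  simp only [Rr, Matrix.submatrix_apply, inc_lt h0 hi, tot, Matrix.of_apply, (inc_inj h0 _).eq_iff]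
  simp

lemma tot_v (d : Datum α) (a : Fin (α 0)) : (tot h0 d).v (inc h0 0 (Nat.zero_le _) a) = d.v a := by
  simp [tot, (inc_inj h0 _).eq_iff]

lemma tot_w (d : Datum α) (a : Fin (α 0)) : (tot h0 d).w (inc h0 0 (Nat.zero_le _) a) = d.w a := by
  simp [tot, (inc_inj h0 _).eq_iff]

lemma fr_tot (d : Datum α) (hX : ∀ i : ℕ, p < i → d.X i = 0) (hY : ∀ i : ℕ, p < i → d.Y i = 0) :
    fr h0 (tot h0 d) = d := by
  obtain ⟨X, Y, v, w⟩ := d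
  simp only [fr, Datum.mk.injEq]
  refine ⟨?_, ?_, ?_, ?_⟩
  · funext i
    split_ifs with h
    · exact tot_RX h0 _ (by omega)
    · exact (hX i (by omega)).symm
  · funext i
    split_ifs with h
    · exact tot_RY h0 _ (by omega)
    · exact (hY i (by omega)).symm
  · funext a; exact tot_v h0 _ a
  · funext a; exact tot_w h0 _ a

def lamZ (p : ℕ) (lam : ℕ → ℂ) : ZMod (p + 1) → ℂ := fun i => lam i.val

lemma tot_isR {lam : ℕ → ℂ} {d : Datum α} (hd : IsRepDatum p lam h0 d) :
    IsR (dT p α) (lamZ p lam) (tot h0 d) := by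
  have hX : Hom (dT p α) (-1) (tot h0 d).X := by
    intro s t h
    simp only [tot, Matrix.of_apply] at h
    obtain ⟨b, _, hb⟩ := Finset.exists_ne_zero_of_sum_ne_zero h
    have : t = inc h0 (s.1 + 1) (by omega) b := by by_contra hne; exact hb (if_neg hne)
    rw [this, dT_inc]; simp [dT]
  have hY : Hom (dT p α) 1 (tot h0 d).Y := by
    intro s t h
    simp only [tot, Matrix.of_apply] at h
    obtain ⟨b, _, hb⟩ := Finset.exists_ne_zero_of_sum_ne_zero h
    have : s = inc h0 (t.1 + 1) (by omega) b := by by_contra hne; exact hb (if_neg hne)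
    rw [this, dT_inc]; simp [dT]
  have hv : HomV (dT p α) 0 (tot h0 d).v := by
    intro s h
    simp only [tot, Matrix.of_apply] at h
    obtain ⟨b, _, hb⟩ := Finset.exists_ne_zero_of_sum_ne_zero h
    have : s = inc h0 0 (Nat.zero_le _) b := by by_contra hne; exact hb (if_neg hne)
    rw [this, dT_inc]; simp
  have hw : HomV (dT p α) 0 (tot h0 d).w := by
    intro s h
    simp only [tot, Matrix.of_apply] at h
    obtain ⟨b, _, hb⟩ := Finset.exists_ne_zero_of_sum_ne_zero h
    have : s = inc h0 0 (Nat.zero_le _) b := by by_contra hne; exact hb (if_neg hne)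
    rw [this, dT_inc]; simp
  refine ⟨hX, hY, hv, hw, ?_⟩
  have hvw : Hom (dT p α) 0 (vecMulVec (tot h0 d).v (tot h0 d).w) := by
    intro s t h
    rw [vecMulVec_apply] at h
    rw [hv _ (left_ne_zero_of_mul h), hw _ (right_ne_zero_of_mul h), add_zero]
  have hXY : Hom (dT p α) 0 ((tot h0 d).X * (tot h0 d).Y) := by
    have := hX.mul hY
    rwa [neg_add_cancel] at this
  have hYX : Hom (dT p α) 0 ((tot h0 d).Y * (tot h0 d).X) := by
    have := hY.mul hX
    rwa [add_neg_cancel] at this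
  refine Rr_ext (h0 := h0) ?_ (Dg_hom _) ?_
  · rw [sub_eq_add_neg]
    exact (hXY.add hYX.neg).add hvw
  intro k hk
  have e1 : Rr h0 hk.le hk.le ((tot h0 d).X * (tot h0 d).Y) = d.X k * d.Y k := by
    rw [Rr_mul (k := k + 1) (hk := hk) hY (by push_cast; rfl), tot_RX, tot_RY]
  have eD : Rr h0 hk.le hk.le (Dg (dT p α) (lamZ p lam)) = lam k • 1 := by
    ext a b
    simp only [Rr, Dg, Matrix.submatrix_apply, Matrix.diagonal_apply, (inc_inj h0 _).eq_iff, dT_inc,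
      Matrix.smul_apply, Matrix.one_apply, lamZ, ZMod.val_natCast, Nat.mod_eq_of_lt hk]
    simp
  have eYX : ∀ j (hj : j < p + 1), Rr h0 hj hj ((tot h0 d).Y * (tot h0 d).X) = d.Y j * d.X j := by
    intro j hj
    rw [Rr_mul (k := j) (hk := hj.le) hX (by push_cast; ring), tot_RX, tot_RY]
  have split : Rr h0 hk.le hk.le ((tot h0 d).X * (tot h0 d).Y - (tot h0 d).Y * (tot h0 d).X +
      vecMulVec (tot h0 d).v (tot h0 d).w) =
      Rr h0 hk.le hk.le ((tot h0 d).X * (tot h0 d).Y) - Rr h0 hk.le hk.le ((tot h0 d).Y * (tot h0 d).X)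
      + Rr h0 hk.le hk.le (vecMulVec (tot h0 d).v (tot h0 d).w) := rfl
  rw [split, e1, eD]
  cases k with
  | zero =>
    rw [← hd.1, ← eYX p (Nat.lt_succ_self p)]
    congr 1
    · congr 1
      ext a b
      simp only [Rr, recast, Matrix.submatrix_apply]
      rw [inc_top h0 rfl h0, inc_top h0 rfl h0]
      simp
    · ext a b
      simp [Rr, vecMulVec_apply, tot_v, tot_w]
  | succ k =>
    rw [← hd.2 k (by omega), ← eYX k (by omega)]
    have : Rr h0 hk.le hk.le (vecMulVec (tot h0 d).v (tot h0 d).w) = 0 := by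
      ext a b
      simp only [Rr, Matrix.submatrix_apply, vecMulVec_apply, Matrix.zero_apply]
      by_contra h
      have := hv _ (left_ne_zero_of_mul h)
      rw [dT_inc, ZMod.natCast_eq_zero_iff] at this
      exact absurd this (Nat.not_dvd_of_pos_of_lt (by omega) hk)
    rw [this, add_zero]

section powers
variable {h0} {P : RD (TT p α)}

lemma R_yprod (hY : Hom (dT p α) 1 P.Y) (k : ℕ) (hk : k ≤ p + 1) :
    Rr h0 hk (Nat.zero_le _) (P.Y ^ k) = yprod (fr h0 P).Y k := by
  induction k with
  | zero => rw [pow_zero, Rr_one]; rfl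
  | succ k ih =>
    rw [pow_succ', Rr_mul (k := k) (hk := by omega) (hY.pow k) (by push_cast; ring), ih (by omega)]
    simp only [yprod, fr]
    rw [dif_pos (by omega)]

lemma R_yseg (hY : Hom (dT p α) 1 P.Y) (i k : ℕ) (hk : i + k ≤ p + 1) :
    Rr h0 hk (by omega) (P.Y ^ k) = ysegFrom (fr h0 P).Y i k := by
  induction k with
  | zero => rw [pow_zero]; exact Rr_one
  | succ k ih =>
    rw [pow_succ']
    refine (Rr_mul (k := i + k) (hk := by omega) (hY.pow k) (by push_cast; ring)).trans ?_
    rw [ih (by omega)]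
    simp only [ysegFrom, fr]
    rw [dif_pos (by omega)]

lemma R_Amat (hY : Hom (dT p α) 1 P.Y) :
    Rr h0 (Nat.zero_le _) (Nat.zero_le _) (P.Y ^ (p + 1)) = Amat p h0 (fr h0 P).Y := by
  rw [Amat, ← R_yprod hY _ le_rfl]
  ext a b
  simp only [Rr, Matrix.submatrix_apply]
  rw [inc_top h0 rfl h0]
  simp

lemma R_Apow (hY : Hom (dT p α) 1 P.Y) (j : ℕ) :
    Rr h0 (Nat.zero_le _) (Nat.zero_le _) (P.Y ^ ((p + 1) * j)) = Amat p h0 (fr h0 P).Y ^ j := by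
  induction j with
  | zero => simp [Rr_one]
  | succ j ih =>
    rw [Nat.mul_succ, pow_add, pow_succ (Amat p h0 (fr h0 P).Y), ← ih, ← R_Amat hY]
    apply Rr_mul (hY.pow (p + 1))
    rw [ZMod.natCast_self]; simp

lemma R_ycap (hY : Hom (dT p α) 1 P.Y) (i : ℕ) (hi : i ≤ p) :
    Rr h0 (Nat.zero_le _) (by omega) (P.Y ^ (p - i)) = ycap p h0 (fr h0 P).Y i := by
  rw [ycap, dif_pos hi, ← R_yseg hY (i + 1) (p - i) (by omega)]
  ext a b
  simp only [Rr, Matrix.submatrix_apply]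
  rw [inc_top h0 (k := i + 1 + (p - i)) (by omega)
    ((congrArg α (by omega : i + 1 + (p - i) = p + 1)).trans h0)]
  simp

lemma R_psi (hY : Hom (dT p α) 1 P.Y) (k : ℕ) (hk : 1 ≤ k) (i : ℕ) (hi : i ≤ p) :
    Rr h0 (show i ≤ p + 1 by omega) (show i + 1 ≤ p + 1 by omega) (P.Y ^ ((p + 1) * k - 1)) =
    yprod (fr h0 P).Y i * Amat p h0 (fr h0 P).Y ^ (k - 1) * ycap p h0 (fr h0 P).Y i := by
  obtain ⟨j, rfl⟩ : ∃ j, k = j + 1 := ⟨k - 1, by omega⟩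
  have e : (p + 1) * (j + 1) - 1 = i + (p + 1) * j + (p - i) := by
    rw [Nat.mul_succ]; omega
  rw [e, pow_add, pow_add, Nat.add_sub_cancel, ← R_yprod hY i (by omega), ← R_Apow hY,
    ← R_ycap hY i hi]
  have hz : ((p + 1 : ℕ) : ZMod (p + 1)) = 0 := ZMod.natCast_self _
  rw [Rr_mul (k := 0) (hk := Nat.zero_le _) (hY.pow (p - i)),
    Rr_mul (k := 0) (hk := Nat.zero_le _) (hY.pow ((p + 1) * j))]
  · rw [Nat.cast_mul, hz]; simp
  · have h1 : ((i + 1 + (p - i) : ℕ) : ZMod (p + 1)) = 0 := by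
      rw [show i + 1 + (p - i) = p + 1 by omega, hz]
    rw [mul_one, ← Nat.cast_add, h1]; simp

lemma R_xprod (hX : Hom (dT p α) (-1) P.X) (k : ℕ) (hk : k ≤ p + 1) :
    Rr h0 (Nat.zero_le _) hk (P.X ^ k) = xprod (fr h0 P).X k := by
  induction k with
  | zero => rw [pow_zero, Rr_one]; rfl
  | succ k ih =>
    rw [pow_succ, Rr_mul (k := k) (hk := by omega) hX (by push_cast; ring), ih (by omega)]
    simp only [xprod, fr]
    rw [dif_pos (by omega)]

lemma R_xseg (hX : Hom (dT p α) (-1) P.X) (i k : ℕ) (hk : i + k ≤ p + 1) :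
    Rr h0 (by omega) hk (P.X ^ k) = xsegFrom (fr h0 P).X i k := by
  induction k with
  | zero => rw [pow_zero]; exact Rr_one
  | succ k ih =>
    rw [pow_succ]
    refine (Rr_mul (k := i + k) (hk := by omega) hX (by push_cast; ring)).trans ?_
    rw [ih (by omega)]
    simp only [xsegFrom, fr]
    rw [dif_pos (by omega)]

lemma R_Bmat (hX : Hom (dT p α) (-1) P.X) :
    Rr h0 (Nat.zero_le _) (Nat.zero_le _) (P.X ^ (p + 1)) = Bmat p h0 (fr h0 P).X := by
  rw [Bmat, ← R_xprod hX _ le_rfl]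
  ext a b
  simp only [Rr, Matrix.submatrix_apply]
  rw [inc_top h0 rfl h0]
  simp

lemma R_Bpow (hX : Hom (dT p α) (-1) P.X) (j : ℕ) :
    Rr h0 (Nat.zero_le _) (Nat.zero_le _) (P.X ^ ((p + 1) * j)) = Bmat p h0 (fr h0 P).X ^ j := by
  induction j with
  | zero => simp [Rr_one]
  | succ j ih =>
    rw [Nat.mul_succ, pow_add, pow_succ (Bmat p h0 (fr h0 P).X), ← ih, ← R_Bmat hX]
    apply Rr_mul (hX.pow (p + 1))
    rw [ZMod.natCast_self]; simp

lemma R_xcap (hX : Hom (dT p α) (-1) P.X) (i : ℕ) (hi : i ≤ p) :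
    Rr h0 (by omega) (Nat.zero_le _) (P.X ^ (p - i)) = xcap p h0 (fr h0 P).X i := by
  rw [xcap, dif_pos hi, ← R_xseg hX (i + 1) (p - i) (by omega)]
  ext a b
  simp only [Rr, Matrix.submatrix_apply]
  rw [inc_top h0 (k := i + 1 + (p - i)) (by omega)
    ((congrArg α (by omega : i + 1 + (p - i) = p + 1)).trans h0)]
  simp

lemma R_phi (hX : Hom (dT p α) (-1) P.X) (k : ℕ) (hk : 1 ≤ k) (i : ℕ) (hi : i ≤ p) :
    Rr h0 (show i + 1 ≤ p + 1 by omega) (show i ≤ p + 1 by omega) (P.X ^ ((p + 1) * k - 1)) =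
    xcap p h0 (fr h0 P).X i * Bmat p h0 (fr h0 P).X ^ (k - 1) * xprod (fr h0 P).X i := by
  obtain ⟨j, rfl⟩ : ∃ j, k = j + 1 := ⟨k - 1, by omega⟩
  have e : (p + 1) * (j + 1) - 1 = (p - i) + (p + 1) * j + i := by
    rw [Nat.mul_succ]; omega
  rw [e, pow_add, pow_add, Nat.add_sub_cancel, ← R_xprod hX i (by omega), ← R_Bpow hX,
    ← R_xcap hX i hi]
  have hz : ((p + 1 : ℕ) : ZMod (p + 1)) = 0 := ZMod.natCast_self _
  rw [Rr_mul (k := 0) (hk := Nat.zero_le _) (hX.pow i),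
    Rr_mul (k := 0) (hk := Nat.zero_le _) (hX.pow ((p + 1) * j))]
  · rw [Nat.cast_mul, hz]; simp
  · simp

end powers

lemma fr_step {lam : ZMod (p + 1) → ℂ} {P Q : RD (TT p α)} (hP : IsR (dT p α) lam P)
    (h : Mv (dT p α) P Q) : Step p h0 (fr h0 P) (fr h0 Q) := by
  rcases h with ⟨k, μ, hk, rfl⟩ | ⟨k, μ, hk, rfl⟩ | ⟨g, h, hgh, hg, hh, rfl⟩
  · refine Or.inl ⟨k, μ, hk, ?_⟩
    simp only [psiT]
    rw [fr, Datum.mk.injEq]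
    refine ⟨?_, rfl, rfl, rfl⟩
    funext i
    by_cases hi : i ≤ p
    · rw [dif_pos hi, ← R_psi hP.hY k hk i hi]
      simp only [fr, dif_pos hi]
      rfl
    · rw [dif_neg hi]
      simp [fr, hi, ycap]
  · refine Or.inr (Or.inl ⟨k, μ, hk, ?_⟩)
    simp only [phiT]
    rw [fr, Datum.mk.injEq]
    refine ⟨rfl, ?_, rfl, rfl⟩
    funext i
    by_cases hi : i ≤ p
    · rw [dif_pos hi, ← R_phi hP.hX k hk i hi]
      simp only [fr, dif_pos hi]
      rfl
    · rw [dif_neg hi]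
      simp [fr, hi, xcap]
  · have hR : ∀ i (hi : i ≤ p + 1), Rr h0 hi hi g * Rr h0 hi hi h = 1 := by
      intro i hi
      rw [← Rr_mul hh (by simp), hgh, Rr_one]
    have hinv : ∀ i (hi : i ≤ p + 1), (Rr h0 hi hi g)⁻¹ = Rr h0 hi hi h :=
      fun i hi => Matrix.inv_eq_right_inv (hR i hi)
    let G : ∀ i : ℕ, Matrix (Fin (α i)) (Fin (α i)) ℂ := fun i =>
      if hi : i ≤ p + 1 then Rr h0 hi hi g else 1
    have hG : ∀ i (hi : i ≤ p + 1), G i = Rr h0 hi hi g := fun i hi => dif_pos hi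
    refine Or.inr (Or.inr ⟨G, ?_, ?_, ?_⟩)
    · intro i
      by_cases hi : i ≤ p + 1
      · rw [hG i hi]
        exact IsUnit.of_mul_eq_one _ (hR i hi)
      · simp [G, hi]
    · rw [hG _ le_rfl, hG 0 (Nat.zero_le _)]
      ext a b
      simp only [Rr, recast, Matrix.submatrix_apply]
      rw [inc_top h0 rfl h0, inc_top h0 rfl h0]
    · simp only [bcT]
      rw [fr, Datum.mk.injEq]
      refine ⟨?_, ?_, ?_, ?_⟩
      · funext i
        by_cases hi : i ≤ p
        · rw [dif_pos hi, if_pos hi, hG i (by omega), hG (i + 1) (by omega), hinv]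
          simp only [fr, dif_pos hi]
          rw [Rr_mul (k := i + 1) (hk := by omega) hh (by simp),
            Rr_mul (k := i) (hk := by omega) hP.hX (by push_cast; ring)]
        · rw [dif_neg hi, if_neg hi]
          simp [fr, hi]
      · funext i
        by_cases hi : i ≤ p
        · rw [dif_pos hi, if_pos hi, hG i (by omega), hG (i + 1) (by omega), hinv]
          simp only [fr, dif_pos hi]
          rw [Rr_mul (k := i) (hk := by omega) hh (by simp),
            Rr_mul (k := i + 1) (hk := by omega) hP.hY (by push_cast; ring)]
        · rw [dif_neg hi, if_neg hi]
          simp [fr, hi]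
      · funext a
        rw [hG 0 (Nat.zero_le _)]
        simp only [Matrix.mulVec, dotProduct, fr, Rr, Matrix.submatrix_apply]
        apply sum_fib h0 (Nat.zero_le _)
        intro t ht
        rw [hP.hv _ (right_ne_zero_of_mul ht)]; simp
      · funext a
        rw [hG 0 (Nat.zero_le _), hinv]
        simp only [Matrix.vecMul, dotProduct, fr, Rr, Matrix.submatrix_apply]
        apply sum_fib h0 (Nat.zero_le _)
        intro t ht
        rw [hP.hw _ (left_ne_zero_of_mul ht)]; simp

lemma fr_orb {lam : ZMod (p + 1) → ℂ} {P Q : RD (TT p α)} (hP : IsR (dT p α) lam P)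
    (h : Orb (dT p α) P Q) : Relation.ReflTransGen (Step p h0) (fr h0 P) (fr h0 Q) := by
  induction h with
  | refl => exact .refl
  | tail h1 h2 ih => exact ih.tail (fr_step h0 (Orb.isR hP h1) h2)

lemma gen_of_generic {lam : ℕ → ℂ} (hg : Generic p lam) : Gen (lamZ p lam) := by
  obtain ⟨hc, hr⟩ := hg
  set c := ∑ t ∈ Finset.range (p + 1), lam t with hcdef
  let M : ℤ := ((p + 1 : ℕ) : ℤ)
  have hM : 0 < M := by simp only [M]; positivity
  let σ : ℕ → ℂ := fun n => ∑ t ∈ Finset.range n, lam t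
  let θ : ℤ → ℂ := fun j => ((j / M : ℤ) : ℂ) * c + σ (j % M).toNat
  have hθ : ∀ (q : ℤ) (r : ℕ), r < p + 1 → θ (M * q + r) = (q : ℂ) * c + σ r := by
    intro q r hr
    have hr' : (r : ℤ) < M := by simp only [M]; exact_mod_cast hr
    have h1 : (M * q + r) / M = q := by
      rw [Int.add_comm, Int.add_mul_ediv_left _ _ hM.ne', Int.ediv_eq_zero_of_lt (by omega) hr', zero_add]
    have h2 : (M * q + r) % M = r := by
      rw [Int.add_comm, Int.add_mul_emod_self_left, Int.emod_eq_of_lt (by omega) hr']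
    simp only [θ, h1, h2, Int.toNat_natCast]
  have hdec : ∀ j : ℤ, ∃ (q : ℤ) (r : ℕ), r < p + 1 ∧ j = M * q + r := by
    intro j
    refine ⟨j / M, (j % M).toNat, ?_, ?_⟩
    · have := Int.emod_lt_of_pos j hM
      have := Int.emod_nonneg j hM.ne'
      simp only [M] at *
      omega
    · rw [Int.toNat_of_nonneg (Int.emod_nonneg j hM.ne')]
      exact (Int.mul_ediv_add_emod j M).symm
  have hlt : ∀ r r' : ℕ, r < r' → r' < p + 1 → ∀ k : ℤ, σ r' - σ r + (k : ℂ) * c ≠ 0 := by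
    intro r r' h1 h2 k h
    rcases Nat.eq_zero_or_pos r with h0 | h0
    · subst h0
      apply hr r' p (by omega) (by omega) le_rfl (-k - 1)
      have h3 : σ r' + ∑ t ∈ Finset.Icc r' p, lam t = c := by
        rw [hcdef, ← Finset.sum_range_add_sum_Ico lam (show r' ≤ p + 1 by omega)]
        congr 1
      have h4 : σ 0 = 0 := by simp [σ]
      push_cast
      rw [h4] at h
      linear_combination h3 - h
    · apply hr r (r' - 1) h0 (by omega) (by omega) k
      have h3 : σ r + ∑ t ∈ Finset.Icc r (r' - 1), lam t = σ r' := by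
        simp only [σ]
        rw [← Finset.sum_range_add_sum_Ico lam h1.le]
        congr 1
        apply Finset.sum_congr _ fun _ _ => rfl
        ext t; simp; omega
      linear_combination h3 + h
  refine ⟨θ, ?_, ?_⟩
  · intro a b hab
    obtain ⟨q, r, hr1, rfl⟩ := hdec a
    obtain ⟨q', r', hr2, rfl⟩ := hdec b
    rw [hθ q r hr1, hθ q' r' hr2] at hab
    rcases lt_trichotomy r r' with h | h | h
    · exfalso
      apply hlt r r' h hr2 (q' - q)
      push_cast
      linear_combination -hab
    · subst h
      have : ((q : ℂ) - q') * c = 0 := by linear_combination hab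
      rcases mul_eq_zero.mp this with h | h
      · have : q = q' := by exact_mod_cast sub_eq_zero.mp h
        rw [this]
      · exact absurd h hc
    · exfalso
      apply hlt r' r h hr1 (q - q')
      push_cast
      linear_combination hab
  · intro j
    obtain ⟨q, r, hr1, rfl⟩ := hdec j
    have hl : lamZ p lam ((M * q + r : ℤ) : ZMod (p + 1)) = lam r := by
      have : ((M * q + r : ℤ) : ZMod (p + 1)) = ((r : ℕ) : ZMod (p + 1)) := by
        simp only [M]
        rw [Int.cast_add, Int.cast_mul, Int.cast_natCast, Int.cast_natCast, ZMod.natCast_self,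
          zero_mul, zero_add]
      rw [this, lamZ, ZMod.val_natCast, Nat.mod_eq_of_lt hr1]
    rw [hl, hθ q r hr1]
    rcases Nat.lt_or_ge (r + 1) (p + 1) with h | h
    · have := hθ q (r + 1) h
      push_cast at this
      rw [add_assoc, this]
      simp only [σ, Finset.sum_range_succ]; ring
    · have hrp : r = p := by omega
      have := hθ (q + 1) 0 (by omega)
      have e : M * q + r + 1 = M * (q + 1) + ((0 : ℕ) : ℤ) := by
        simp only [M]; rw [hrp]; push_cast; ring
      rw [e, this]
      have h5 : c = σ r + lam r := by
        rw [hcdef, hrp, Finset.sum_range_succ]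
      simp only [σ, Finset.range_zero, Finset.sum_empty] at *
      push_cast
      linear_combination h5

end transfer
end Tot

/-- For `m = p + 1 ≥ 1` vertices and generic `λ`, the group of
transformations generated by all `Ψ_{k,μ}`, all `Φ_{k,ν}` (`k ≥ 1`) and all base changes
acts transitively on the set of representation data of dimension vector `α`: any two tuples
satisfying (qv1)–(qv2) are joined by a finite composition of such elementary moves. -/
theorem statement0 (p : ℕ) (α : ℕ → ℕ) (lam : ℕ → ℂ) (h0 : α (p + 1) = α 0)
    (hgen : Generic p lam) (d₁ d₂ : Datum α)
    (h₁ : IsRepDatum p lam h0 d₁) (h₂ : IsRepDatum p lam h0 d₂)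
    (hX₁ : ∀ i : ℕ, p < i → d₁.X i = 0) (hY₁ : ∀ i : ℕ, p < i → d₁.Y i = 0)
    (hX₂ : ∀ i : ℕ, p < i → d₂.X i = 0) (hY₂ : ∀ i : ℕ, p < i → d₂.Y i = 0) :
    Relation.ReflTransGen (Step p h0) d₁ d₂ := by
  have := Tot.fr_orb h0 (Tot.tot_isR h0 h₁) (Tot.main_tot _ (Tot.TT p α) (Tot.dT p α) (Tot.lamZ p lam)
    (Tot.gen_of_generic hgen) _ _ (Tot.tot_isR h0 h₁) (Tot.tot_isR h0 h₂) rfl)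
  rwa [Tot.fr_tot h0 d₁ hX₁ hY₁, Tot.fr_tot h0 d₂ hX₂ hY₂] at this

end
end CM
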